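/- For every finite-dimensional simple complex Lie algebra 𝔤 of rank ℓ and every integer n ≥ 1, the center Z(𝔤_n) of the universal enveloping algebra U(𝔤_n) of the Takiff (jet) algebra 𝔤_n is isomorphic, as a commutative ℂ-algebra, to a polynomial algebra in n·ℓ variables, i.e. Z(𝔤_n) ≃ₐ[ℂ] MvPolynomial (Fin ℓ × Fin n) ℂ. (This is the Rais–Tauvel/Geoffriau theorem: Z(𝔤_n) ≅ ℂ[(𝔥*/W)_n], combined with the fact that ℂ[(𝔥*/W)_n] is a polynomial ring in nℓ variables.) -/

import Mathlib

/-!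
STATEMENT 0 (Rais–Tauvel / Geoffriau theorem).
For a finite-dimensional simple complex Lie algebra `L` of rank `ℓ` and `n ≥ 1`, the
centre of the universal enveloping algebra of the Takiff (jet) algebra
`L_n = (ℂ[X]/(X^n)) ⊗[ℂ] L` is isomorphic as a commutative ℂ-algebra to a polynomial
algebra in `n ⬝ ℓ` variables.
-/

noncomputable section

open scoped TensorProduct

/-- The truncated polynomial ring `ℂ[X]/(X^n)`. -/
abbrev TruncPoly (n : ℕ) : Type :=
  Polynomial ℂ ⧸ (Ideal.span {(Polynomial.X : Polynomial ℂ) ^ n})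

variable (L : Type) [LieRing L] [LieAlgebra ℂ L]

/-- The Takiff (jet) algebra `L_n := (ℂ[X]/(X^n)) ⊗[ℂ] L`, with the canonical Lie
bracket `[p ⊗ x, q ⊗ y] = pq ⊗ [x,y]` obtained by extension of scalars, regarded
as a Lie algebra over `ℂ` (by restricting scalars). -/
abbrev Takiff (n : ℕ) : Type :=
  RestrictScalars ℂ (TruncPoly n) (TruncPoly n ⊗[ℂ] L)

namespace TakiffCenter

open MvPolynomial

section SymmetricAction

variable {q J : Type} [LieRing q] [LieAlgebra ℂ q] (b : Module.Basis J ℂ q)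

/-- The inclusion of `q` into its symmetric algebra, in the coordinates given by a basis. -/
def lin : q →ₗ[ℂ] MvPolynomial J ℂ := b.constr ℂ X

@[simp] lemma lin_basis (j : J) : lin b (b j) = X j := by
  simp [lin]

/-- The derivation of the symmetric algebra extending `ad z`. -/
def actDer (z : q) : Derivation ℂ (MvPolynomial J ℂ) (MvPolynomial J ℂ) :=
  mkDerivation ℂ fun j => lin b ⁅z, b j⁆

lemma actDer_lin (z y : q) : actDer b z (lin b y) = lin b ⁅z, y⁆ := by
  have : (actDer b z).toLinearMap ∘ₗ lin b = lin b ∘ₗ LieAlgebra.ad ℂ q z := by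
    apply b.ext
    intro j
    simp [actDer, mkDerivation_X]
  exact LinearMap.congr_fun this y

lemma actDer_X (z : q) (j : J) : actDer b z (X j) = lin b ⁅z, b j⁆ := by
  simp [actDer, mkDerivation_X]

/-- The adjoint action of `q` on its symmetric algebra. -/
def act : q →ₗ⁅ℂ⁆ Derivation ℂ (MvPolynomial J ℂ) (MvPolynomial J ℂ) where
  toFun := actDer b
  map_add' x y := by
    apply MvPolynomial.derivation_ext
    intro j
    simp [actDer_X]
  map_smul' c x := by
    apply MvPolynomial.derivation_ext
    intro j
    simp [actDer_X]
  map_lie' {x y} := by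
    apply MvPolynomial.derivation_ext
    intro j
    simp [actDer_X, Derivation.commutator_apply, actDer_lin]

lemma act_lin (z y : q) : act b z (lin b y) = lin b ⁅z, y⁆ := actDer_lin b z y

lemma act_X (z : q) (j : J) : act b z (X j) = lin b ⁅z, b j⁆ := actDer_X b z j

end SymmetricAction

end TakiffCenter

namespace TakiffCenter

open MvPolynomial UniversalEnvelopingAlgebra

attribute [local instance] LieRing.ofAssociativeRing

section Symmetrization

variable {q J : Type} [LieRing q] [LieAlgebra ℂ q] [Fintype J] (b : Module.Basis J ℂ q)

local notation "𝓤" => UniversalEnvelopingAlgebra ℂ q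

lemma ι_mul_ι (x y : q) : ι ℂ x * ι ℂ y = ι ℂ y * ι ℂ x + ι ℂ ⁅x, y⁆ := by
  rw [LieHom.map_lie, LieRing.of_associative_ring_bracket]
  abel

/-- Symmetrization of the degree `k` part of the symmetric algebra. -/
def symm : ℕ → (MvPolynomial J ℂ →ₗ[ℂ] 𝓤)
  | 0 => Algebra.linearMap ℂ 𝓤 ∘ₗ lcoeff ℂ 0
  | k + 1 => ((k : ℂ) + 1)⁻¹ • ∑ j,
      LinearMap.mulLeft ℂ (ι ℂ (b j)) ∘ₗ symm k ∘ₗ (pderiv j : Derivation ℂ _ _).toLinearMap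

lemma symm_zero (f : MvPolynomial J ℂ) : symm b 0 f = algebraMap ℂ 𝓤 (constantCoeff f) := rfl

lemma symm_succ (k : ℕ) (f : MvPolynomial J ℂ) :
    ((k : ℂ) + 1) • symm b (k + 1) f = ∑ j, ι ℂ (b j) * symm b k (pderiv j f) := by
  have : (k : ℂ) + 1 ≠ 0 := by exact_mod_cast Nat.succ_ne_zero k
  simp [symm, smul_smul, this, LinearMap.sum_apply]

lemma lin_eq_sum (y : q) : lin b y = ∑ j, C (b.repr y j) * X j := by
  have h := congrArg (lin b) (b.sum_repr y)
  rw [map_sum] at h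
  rw [← h]
  simp [smul_eq_C_mul]

lemma ι_eq_sum (y : q) : ι ℂ y = ∑ j, b.repr y j • ι ℂ (b j) := by
  have h := congrArg (ι ℂ : q →ₗ⁅ℂ⁆ 𝓤).toLinearMap (b.sum_repr y)
  rw [map_sum] at h
  rw [← LieHom.coe_toLinearMap, ← h]
  simp [-ι_apply]

lemma pderiv_lin (j : J) (y : q) : pderiv j (lin b y) = C (b.repr y j) := by
  classical
  rw [lin_eq_sum, map_sum, Finset.sum_eq_single j]
  · simp
  · intro i _ hi
    simp [pderiv_X_of_ne hi]
  · simp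

lemma constantCoeff_lin (y : q) : constantCoeff (lin b y) = 0 := by
  simp [lin_eq_sum]

lemma derivation_sum_apply {R A ι : Type*} [CommRing R] [CommRing A] [Algebra R A]
    (s : Finset ι) (D : ι → Derivation R A A) (f : A) : (∑ i ∈ s, D i) f = ∑ i ∈ s, D i f := by
  classical
  induction s using Finset.induction_on with
  | empty => simp
  | insert i s hi ih => rw [Finset.sum_insert hi, Finset.sum_insert hi, Derivation.add_apply, ih]

lemma derivation_eq_sum (D : Derivation ℂ (MvPolynomial J ℂ) (MvPolynomial J ℂ))
    (f : MvPolynomial J ℂ) : D f = ∑ j, D (X j) * pderiv j f := by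
  classical
  have : D = ∑ j, D (X j) • pderiv (R := ℂ) j := by
    apply MvPolynomial.derivation_ext
    intro i
    rw [derivation_sum_apply, Finset.sum_eq_single i]
    · simp
    · intro j _ hj
      simp [pderiv_X_of_ne (Ne.symm hj)]
    · simp
  conv_lhs => rw [this]
  simp [derivation_sum_apply]

lemma constantCoeff_act (y : q) (f : MvPolynomial J ℂ) : constantCoeff (act b y f) = 0 := by
  rw [derivation_eq_sum, map_sum]
  simp [act_X, constantCoeff_lin]

lemma pderiv_pderiv_comm {J : Type} (i j : J) (f : MvPolynomial J ℂ) :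
    pderiv i (pderiv j f) = pderiv j (pderiv i f) := by
  classical
  have : ⁅(pderiv i : Derivation ℂ (MvPolynomial J ℂ) (MvPolynomial J ℂ)),
      (pderiv j : Derivation ℂ (MvPolynomial J ℂ) (MvPolynomial J ℂ))⁆ = 0 := by
    apply MvPolynomial.derivation_ext
    intro k
    simp only [Derivation.commutator_apply, pderiv_X, Derivation.coe_zero, Pi.zero_apply]
    by_cases h : j = k <;> by_cases h' : i = k <;> simp [h, h']
  have := congrArg (fun D => D f) this
  simpa [Derivation.commutator_apply, sub_eq_zero] using this

lemma pderiv_act (y : q) (j : J) (f : MvPolynomial J ℂ) :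
    pderiv j (act b y f) =
      act b y (pderiv j f) + ∑ i, C (b.repr ⁅y, b i⁆ j) * pderiv i f := by
  rw [derivation_eq_sum (act b y) f, derivation_eq_sum (act b y) (pderiv j f), map_sum,
    ← Finset.sum_add_distrib]
  refine Finset.sum_congr rfl fun i _ => ?_
  rw [Derivation.leibniz, act_X, pderiv_lin, pderiv_pderiv_comm j i]
  simp only [smul_eq_mul]
  ring

lemma ι_mul_symm (y : q) (k : ℕ) (f : MvPolynomial J ℂ) :
    ι ℂ y * symm b k f - symm b k f * ι ℂ y = symm b k (act b y f) := by
  induction k generalizing f with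
  | zero => simp [symm_zero, constantCoeff_act, Algebra.commutes]
  | succ k ih =>
    have hk : (k : ℂ) + 1 ≠ 0 := by exact_mod_cast Nat.succ_ne_zero k
    refine smul_right_injective _ hk ?_
    simp only [smul_sub]
    rw [← mul_smul_comm, ← smul_mul_assoc, symm_succ, symm_succ]
    simp only [pderiv_act, map_add, mul_add, Finset.sum_add_distrib]
    have h2 : ∑ j, ι ℂ (b j) * symm b k (∑ i, C (b.repr ⁅y, b i⁆ j) * pderiv i f) =
        ∑ i, ι ℂ ⁅y, b i⁆ * symm b k (pderiv i f) := by
      simp only [← smul_eq_C_mul, map_sum, map_smul, Finset.mul_sum]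
      rw [Finset.sum_comm]
      refine Finset.sum_congr rfl fun i _ => ?_
      rw [ι_eq_sum b ⁅y, b i⁆]
      simp [Finset.sum_mul, -ι_apply]
    rw [h2, Finset.mul_sum, Finset.sum_mul, ← Finset.sum_sub_distrib, ← Finset.sum_add_distrib]
    refine Finset.sum_congr rfl fun i _ => ?_
    rw [← ih, ← mul_assoc, ι_mul_ι y]
    noncomm_ring

variable (q) in
/-- The filtration by degree: `filt k` consists of the elements of degree less than `k`. -/
def filt : ℕ → Submodule ℂ 𝓤
  | 0 => ⊥
  | k + 1 => (1 ⊔ LinearMap.range (ι ℂ : q →ₗ⁅ℂ⁆ 𝓤).toLinearMap) ^ k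

lemma one_le_gen : (1 : Submodule ℂ 𝓤) ≤
    1 ⊔ LinearMap.range (ι ℂ : q →ₗ⁅ℂ⁆ 𝓤).toLinearMap := le_sup_left

lemma filt_mono {a c : ℕ} (h : a ≤ c) : filt q a ≤ filt q c := by
  obtain _ | a := a
  · exact bot_le
  · obtain ⟨c, rfl⟩ : ∃ d, c = d + 1 := ⟨c - 1, by omega⟩
    exact pow_le_pow_right' one_le_gen (by omega)

lemma filt_mul {a c : ℕ} {u v : 𝓤} (hu : u ∈ filt q a) (hv : v ∈ filt q (c + 1)) :
    u * v ∈ filt q (a + c) := by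
  obtain _ | a := a
  · simp [(Submodule.mem_bot ℂ).1 hu]
  · rw [show a + 1 + c = a + c + 1 by ring]
    change _ ∈ _ ^ (a + c)
    rw [pow_add]
    exact Submodule.mul_mem_mul hu hv

lemma filt_mul' {a c : ℕ} {u v : 𝓤} (hu : u ∈ filt q (a + 1)) (hv : v ∈ filt q c) :
    u * v ∈ filt q (a + c) := by
  obtain _ | c := c
  · simp [(Submodule.mem_bot ℂ).1 hv]
  · rw [show a + (c + 1) = a + c + 1 by ring]
    change _ ∈ _ ^ (a + c)
    rw [pow_add]
    exact Submodule.mul_mem_mul hu hv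

lemma ι_mem_filt (y : q) : ι ℂ y ∈ filt q 2 := by
  change _ ∈ _ ^ 1
  rw [pow_one]
  exact Submodule.mem_sup_right ⟨y, rfl⟩

lemma algebraMap_mem_filt (c : ℂ) : algebraMap ℂ 𝓤 c ∈ filt q 1 := by
  change _ ∈ _ ^ 0
  rw [pow_zero]
  exact Submodule.algebraMap_mem c

lemma symm_mem_filt (k : ℕ) (f : MvPolynomial J ℂ) : symm b k f ∈ filt q (k + 1) := by
  induction k generalizing f with
  | zero => exact algebraMap_mem_filt _
  | succ k ih =>
    have hk : (k : ℂ) + 1 ≠ 0 := by exact_mod_cast Nat.succ_ne_zero k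
    rw [← Submodule.smul_mem_iff _ hk, symm_succ]
    refine Submodule.sum_mem _ fun j _ => ?_
    rw [show k + 1 + 1 = 1 + (k + 1) by ring]
    exact filt_mul' (ι_mem_filt _) (ih _)

/-- Induction on elements of degree at most `k`. -/
lemma filt_induction {p : ℕ → 𝓤 → Prop} (hadd : ∀ k u v, p k u → p k v → p k (u + v))
    (h0 : ∀ c : ℂ, p 0 (algebraMap ℂ 𝓤 c)) (hmono : ∀ k u, u ∈ filt q (k + 1) → p k u → p (k + 1) u)
    (hsmul : ∀ k (c : ℂ) u, p k u → p k (c • u))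
    (hι : ∀ k y u, u ∈ filt q (k + 1) → p k u → p (k + 1) (ι ℂ y * u))
    (k : ℕ) (u : 𝓤) (hu : u ∈ filt q (k + 1)) : p k u := by
  induction k generalizing u with
  | zero =>
    change u ∈ _ ^ 0 at hu
    rw [pow_zero] at hu
    obtain ⟨c, rfl⟩ := Submodule.mem_one.1 hu
    exact h0 c
  | succ k ih =>
    change u ∈ _ ^ (k + 1) at hu
    rw [pow_succ'] at hu
    refine Submodule.mul_induction_on hu ?_ (fun x y => hadd _ x y)
    intro m hm v hv
    obtain ⟨c, hc, z, hz, rfl⟩ := Submodule.mem_sup.1 hm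
    obtain ⟨c, rfl⟩ := Submodule.mem_one.1 hc
    obtain ⟨z, rfl⟩ := hz
    rw [add_mul]
    refine hadd _ _ _ ?_ (hι _ _ _ hv (ih v hv))
    rw [← Algebra.smul_def]
    exact hsmul _ _ _ (hmono _ _ hv (ih v hv))

lemma commutator_mem_filt (y : q) (k : ℕ) {u : 𝓤} (hu : u ∈ filt q k) :
    ι ℂ y * u - u * ι ℂ y ∈ filt q k := by
  obtain _ | k := k
  · simp [(Submodule.mem_bot ℂ).1 hu, filt]
  refine filt_induction (p := fun k u => ι ℂ y * u - u * ι ℂ y ∈ filt q (k + 1))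
    ?_ ?_ ?_ ?_ ?_ k u hu
  · intro k u v hu hv
    convert add_mem hu hv using 1
    noncomm_ring
  · intro c
    simp [Algebra.commutes]
  · intro k u _ h
    exact filt_mono (by omega) h
  · intro k c u h
    convert Submodule.smul_mem _ c h using 1
    simp [smul_sub]
  · intro k z u hu h
    have : ι ℂ y * (ι ℂ z * u) - ι ℂ z * u * ι ℂ y =
        ι ℂ z * (ι ℂ y * u - u * ι ℂ y) + ι ℂ ⁅y, z⁆ * u := by
      rw [← mul_assoc, ι_mul_ι y z]
      noncomm_ring
    rw [this, show k + 1 + 1 = 1 + (k + 1) by ring]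
    exact add_mem (filt_mul' (ι_mem_filt _) h) (filt_mul' (ι_mem_filt _) hu)

lemma exists_mem_filt (u : 𝓤) : ∃ k, u ∈ filt q k := by
  let S : Subalgebra ℂ 𝓤 :=
    { carrier := {u | ∃ k, u ∈ filt q (k + 1)}
      mul_mem' := by
        rintro x y ⟨k, hk⟩ ⟨l, hl⟩
        refine ⟨k + l, ?_⟩
        rw [show k + l + 1 = k + (l + 1) by ring]
        exact filt_mul' hk hl
      add_mem' := by
        rintro x y ⟨k, hk⟩ ⟨l, hl⟩
        exact ⟨k + l, add_mem (filt_mono (by omega) hk) (filt_mono (by omega) hl)⟩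
      algebraMap_mem' := fun c => ⟨0, algebraMap_mem_filt c⟩ }
  let f : q →ₗ⁅ℂ⁆ S :=
    { toFun := fun y => ⟨ι ℂ y, 1, ι_mem_filt y⟩
      map_add' := fun x y => Subtype.ext (by simp)
      map_smul' := fun c x => Subtype.ext (by simp)
      map_lie' := fun {x y} => Subtype.ext (by
        simp [LieRing.of_associative_ring_bracket]) }
  have h : S.val.comp (lift ℂ f) = AlgHom.id ℂ 𝓤 := by
    apply hom_ext
    ext y
    change ((lift ℂ f (ι ℂ y) : S) : 𝓤) = ι ℂ y
    rw [lift_ι_apply]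
    rfl
  have h2 : S.val (lift ℂ f u) = u := DFunLike.congr_fun h u
  obtain ⟨k, hk⟩ := (lift ℂ f u).2
  exact ⟨k + 1, h2 ▸ hk⟩

lemma mem_center_of_commute {u : 𝓤} (h : ∀ y : q, ι ℂ y * u = u * ι ℂ y) :
    u ∈ Subalgebra.center ℂ 𝓤 := by
  rw [Subalgebra.mem_center_iff]
  intro v
  obtain ⟨k, hk⟩ := exists_mem_filt v
  have hk := filt_mono (Nat.le_succ k) hk
  refine filt_induction (p := fun _ v => v * u = u * v) ?_ ?_ ?_ ?_ ?_ k v hk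
  · intro _ x y hx hy
    rw [add_mul, hx, hy, mul_add]
  · intro c
    exact Algebra.commutes c u
  · exact fun _ _ _ h => h
  · intro _ c x hx
    rw [smul_mul_assoc, hx, mul_smul_comm]
  · intro _ y x _ hx
    rw [mul_assoc, hx, ← mul_assoc, h, mul_assoc]

lemma ι_mul_symm_sub_mem (y : q) (k : ℕ) (f : MvPolynomial J ℂ) :
    ι ℂ y * symm b k f - symm b (k + 1) (lin b y * f) ∈ filt q (k + 1) := by
  have sum_ι : ∀ v : 𝓤, ∑ j, ι ℂ (b j) * (C (b.repr y j) : MvPolynomial J ℂ).coeff 0 • v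
      = ι ℂ y * v := by
    intro v
    rw [ι_eq_sum b y]
    simp [Finset.sum_mul, -ι_apply]
  have key : ∀ (k : ℕ) (f : MvPolynomial J ℂ), ((k : ℂ) + 1) • symm b (k + 1) (lin b y * f) =
      ι ℂ y * symm b k f + ∑ j, ι ℂ (b j) * symm b k (lin b y * pderiv j f) := by
    intro k f
    rw [symm_succ, ← sum_ι, ← Finset.sum_add_distrib]
    refine Finset.sum_congr rfl fun j _ => ?_
    rw [Derivation.leibniz, pderiv_lin, smul_eq_mul, smul_eq_mul, map_add, mul_add, add_comm,
      mul_comm f, ← smul_eq_C_mul, map_smul]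
    simp
  induction k generalizing f with
  | zero =>
    have := key 0 f
    simp only [symm_zero, map_mul, constantCoeff_lin] at this
    simp at this
    simp [this, symm_zero]
  | succ k ih =>
    have hk : ((k + 1 : ℕ) : ℂ) + 1 ≠ 0 := by exact_mod_cast Nat.succ_ne_zero (k + 1)
    rw [← Submodule.smul_mem_iff _ hk, smul_sub, key]
    have h3 : ((k + 1 : ℕ) : ℂ) • (ι ℂ y * symm b (k + 1) f) =
        ∑ j, ι ℂ y * (ι ℂ (b j) * symm b k (pderiv j f)) := by
      rw [← Finset.mul_sum, ← symm_succ, mul_smul_comm]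
      push_cast
      rfl
    have : (((k + 1 : ℕ) : ℂ) + 1) • (ι ℂ y * symm b (k + 1) f) -
        (ι ℂ y * symm b (k + 1) f + ∑ j, ι ℂ (b j) * symm b (k + 1) (lin b y * pderiv j f)) =
        ∑ j, (ι ℂ (b j) * (ι ℂ y * symm b k (pderiv j f) -
            symm b (k + 1) (lin b y * pderiv j f)) + ι ℂ ⁅y, b j⁆ * symm b k (pderiv j f)) := by
      rw [add_smul, one_smul, h3, add_comm, add_sub_add_left_eq_sub, ← Finset.sum_sub_distrib]
      refine Finset.sum_congr rfl fun j _ => ?_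
      rw [← mul_assoc, ι_mul_ι y]
      noncomm_ring
    rw [this]
    refine Submodule.sum_mem _ fun j _ => ?_
    rw [show k + 1 + 1 = 1 + (k + 1) by ring]
    exact add_mem (filt_mul' (ι_mem_filt _) (ih _))
      (filt_mul' (ι_mem_filt _) (symm_mem_filt b _ _))

lemma symm_mul_symm_sub_mem {a : ℕ} {f : MvPolynomial J ℂ} (hf : f.IsHomogeneous a) (c : ℕ)
    (g : MvPolynomial J ℂ) :
    symm b a f * symm b c g - symm b (a + c) (f * g) ∈ filt q (a + c) := by
  have mono : ∀ (a : ℕ) (m : J →₀ ℕ) (r : ℂ), m.degree = a →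
      symm b a (monomial m r) * symm b c g - symm b (a + c) (monomial m r * g) ∈
        filt q (a + c) := by
    intro a
    induction a with
    | zero =>
      intro m r hm
      obtain rfl : m = 0 := (Finsupp.degree_eq_zero_iff m).1 hm
      have : monomial (0 : J →₀ ℕ) r * g = r • g := by rw [smul_eq_C_mul]; rfl
      rw [this, symm_zero, zero_add, map_smul]
      simp [Algebra.smul_def]
    | succ a ih =>
      intro m r hm
      obtain ⟨j, hj⟩ : ∃ j, m j ≠ 0 := by
        by_contra! h
        obtain rfl : m = 0 := Finsupp.ext h
        simp at hm
      obtain ⟨m, rfl⟩ : ∃ m', m = Finsupp.single j 1 + m' :=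
        exists_add_of_le (by simpa [Nat.one_le_iff_ne_zero] using hj)
      have hm' : m.degree = a := by
        rw [map_add, Finsupp.degree_single] at hm
        omega
      have hX : monomial (Finsupp.single j 1 + m) r = lin b (b j) * monomial m r := by
        rw [lin_basis, monomial_single_add, pow_one]
      have h1 := ι_mul_symm_sub_mem b (b j) a (monomial m r)
      have h2 := filt_mul' (ι_mem_filt (b j)) (ih m r hm')
      have h3 := ι_mul_symm_sub_mem b (b j) (a + c) (monomial m r * g)
      have h4 := filt_mul h1 (symm_mem_filt b c g)
      rw [hX, mul_assoc]
      rw [show 1 + (a + c) = a + 1 + c by ring] at h2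
      rw [show a + c + 1 = a + 1 + c by ring] at h3
      convert add_mem (sub_mem h2 h4) h3 using 1
      noncomm_ring
  have hsum := f.as_sum
  rw [hsum, map_sum, Finset.sum_mul, Finset.sum_mul, map_sum, ← Finset.sum_sub_distrib]
  refine Submodule.sum_mem _ fun m hm => mono a m _ ?_
  exact (hf.degree_eq_sum_deg_support hm).symm ▸ rfl

lemma exists_symm_sub_mem (k : ℕ) (u : 𝓤) (hu : u ∈ filt q (k + 1)) :
    ∃ f : MvPolynomial J ℂ, f.IsHomogeneous k ∧ u - symm b k f ∈ filt q k := by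
  refine filt_induction
    (p := fun k u => ∃ f : MvPolynomial J ℂ, f.IsHomogeneous k ∧ u - symm b k f ∈ filt q k)
    ?_ ?_ ?_ ?_ ?_ k u hu
  · rintro k u v ⟨f, hf, hu⟩ ⟨g, hg, hv⟩
    refine ⟨f + g, hf.add hg, ?_⟩
    convert add_mem hu hv using 1
    simp only [map_add]
    abel
  · intro c
    exact ⟨C c, isHomogeneous_C _ _, by simp [symm_zero]⟩
  · intro k u hu _
    exact ⟨0, isHomogeneous_zero _ _ _, by simpa using hu⟩
  · rintro k c u ⟨f, hf, hu⟩
    refine ⟨c • f, ?_, ?_⟩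
    · rw [smul_eq_C_mul]
      exact hf.C_mul c
    · rw [map_smul, ← smul_sub]
      exact Submodule.smul_mem _ _ hu
  · rintro k y u - ⟨f, hf, hu⟩
    refine ⟨lin b y * f, ?_, ?_⟩
    · rw [add_comm]
      refine IsHomogeneous.mul ?_ hf
      rw [lin_eq_sum]
      exact IsHomogeneous.sum _ _ _ fun j _ => isHomogeneous_C_mul_X _ _
    · have h1 := filt_mul' (ι_mem_filt y) hu
      rw [add_comm 1 k] at h1
      convert add_mem h1 (ι_mul_symm_sub_mem b y k f) using 1
      noncomm_ring

end Symmetrization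

lemma derivation_mem_pow {R A : Type*} [CommRing R] [CommRing A] [Algebra R A]
    (D : Derivation R A A) (I : Ideal A) {k : ℕ} {x : A} (hx : x ∈ I ^ (k + 1)) :
    D x ∈ I ^ k := by
  induction k generalizing x with
  | zero => simp
  | succ k ih =>
    rw [pow_succ'] at hx
    refine Submodule.mul_induction_on hx ?_ fun a c ha hc => ?_
    · intro a ha c hc
      rw [Derivation.leibniz, smul_eq_mul, smul_eq_mul]
      refine add_mem ?_ (Ideal.mul_mem_right _ _ hc)
      rw [pow_succ']
      exact Ideal.mul_mem_mul ha (ih hc)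
    · rw [map_add]
      exact add_mem ha hc

lemma derivation_mem_pow_sub {R A : Type*} [CommRing R] [CommRing A] [Algebra R A]
    (D : Derivation R A A) (I : Ideal A) {k : ℕ} {x : A} (hx : x ∈ I ^ k) :
    D x ∈ I ^ (k - 1) := by
  obtain _ | k := k
  · simp
  · exact derivation_mem_pow D I hx

section Separation

variable {q J Q : Type} [LieRing q] [LieAlgebra ℂ q] [CommRing Q] [Algebra ℂ Q]
  (D : q →ₗ⁅ℂ⁆ Derivation ℂ Q Q) (𝔪 : Ideal Q)

/-- The action of the enveloping algebra obtained from an action by derivations. -/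
def derivationRep : UniversalEnvelopingAlgebra ℂ q →ₐ[ℂ] Module.End ℂ Q :=
  lift ℂ
    { toFun := fun y => (D y).toLinearMap
      map_add' := fun x y => by ext; simp
      map_smul' := fun c x => by ext; simp
      map_lie' := fun {x y} => by
        ext
        simp [LieRing.of_associative_ring_bracket] }

lemma derivationRep_ι (y : q) (x : Q) : derivationRep D (ι ℂ y) x = D y x := by
  rw [derivationRep, lift_ι_apply]
  rfl

lemma derivationRep_mem_pow {k m : ℕ} {u : UniversalEnvelopingAlgebra ℂ q}
    (hu : u ∈ filt q (k + 1)) {x : Q} (hx : x ∈ 𝔪 ^ m) : derivationRep D u x ∈ 𝔪 ^ (m - k) := by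
  refine filt_induction (p := fun k u => derivationRep D u x ∈ 𝔪 ^ (m - k)) ?_ ?_ ?_ ?_ ?_ k u hu
  · intro k u v hu hv
    rw [map_add]
    exact add_mem hu hv
  · intro c
    rw [AlgHom.commutes, Module.algebraMap_end_apply]
    exact Submodule.smul_of_tower_mem _ c hx
  · exact fun k u _ h => Ideal.pow_le_pow_right (by omega) h
  · intro k c u h
    rw [map_smul]
    exact Submodule.smul_of_tower_mem _ c h
  · intro k y u _ h
    rw [map_mul, Module.End.mul_apply, derivationRep_ι, ← Nat.sub_sub]
    exact derivation_mem_pow_sub _ _ h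

variable [Fintype J] (b : Module.Basis J ℂ q) {φ : Q} (hφ : φ ∈ 𝔪) (lam : q →ₗ[ℂ] ℂ)
  (hlam : ∀ y, D y φ - algebraMap ℂ Q (lam y) ∈ 𝔪)

include hφ hlam in
lemma derivationRep_symm_pow {k m : ℕ} (hkm : k ≤ m) {f : MvPolynomial J ℂ}
    (hf : f.IsHomogeneous k) :
    derivationRep D (symm b k f) (φ ^ m) -
      (m.descFactorial k * eval (fun j => lam (b j)) f) • φ ^ (m - k) ∈ 𝔪 ^ (m - k + 1) := by
  induction k generalizing f with
  | zero =>
    obtain ⟨c, rfl⟩ : ∃ c, f = C c :=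
      ⟨_, totalDegree_eq_zero_iff_eq_C.1 (Nat.le_zero.1 hf.totalDegree_le)⟩
    simp [symm_zero]
  | succ k ih =>
    have hk : (k : ℂ) + 1 ≠ 0 := by exact_mod_cast Nat.succ_ne_zero k
    set l : J → ℂ := fun j => lam (b j)
    obtain ⟨d, rfl⟩ := Nat.exists_eq_add_of_le hkm
    have e1 : k + 1 + d - k = d + 1 := by omega
    have e2 : k + 1 + d - (k + 1) = d := by omega
    rw [e2]
    set t := k + 1 + d
    have euler : ∑ j, l j * eval l (pderiv j f) = ((k : ℂ) + 1) * eval l f := by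
      have := congrArg (eval l) hf.sum_X_mul_pderiv
      simpa using this
    have hD : ∀ j, D (b j) (φ ^ (d + 1)) - (((d + 1 : ℕ) : ℂ) * l j) • φ ^ d ∈ 𝔪 ^ (d + 1) := by
      intro j
      have : D (b j) (φ ^ (d + 1)) - (((d + 1 : ℕ) : ℂ) * l j) • φ ^ d =
          (d + 1) • (φ ^ d * (D (b j) φ - algebraMap ℂ Q (lam (b j)))) := by
        rw [Derivation.leibniz_pow, mul_smul, Nat.cast_smul_eq_nsmul, ← smul_sub, smul_eq_mul,
          mul_sub, Algebra.smul_def (l j), mul_comm (algebraMap ℂ Q _)]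
        simp [l]
      rw [this, pow_succ]
      exact Submodule.smul_of_tower_mem _ _
        (Ideal.mul_mem_mul (Ideal.pow_mem_pow hφ d) (hlam _))
    have step : ∀ j, D (b j) (derivationRep D (symm b k (pderiv j f)) (φ ^ t)) -
        ((t.descFactorial k * eval l (pderiv j f)) * (((d + 1 : ℕ) : ℂ) * l j)) • φ ^ d ∈
          𝔪 ^ (d + 1) := by
      intro j
      have h1 := derivation_mem_pow (D (b j)) 𝔪 (ih (by omega) (hf.pderiv (i := j)))
      rw [e1, map_sub, Derivation.map_smul] at h1
      have h2 := Submodule.smul_of_tower_mem _ (t.descFactorial k * eval l (pderiv j f)) (hD j)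
      convert add_mem h1 h2 using 1
      rw [smul_sub, mul_smul]
      abel
    have hsum := Submodule.sum_mem _ fun j (_ : j ∈ Finset.univ) => step j
    rw [Finset.sum_sub_distrib, ← Finset.sum_smul] at hsum
    have h3 : ∑ j, (t.descFactorial k * eval l (pderiv j f)) * (((d + 1 : ℕ) : ℂ) * l j) =
        ((k : ℂ) + 1) * (t.descFactorial (k + 1) * eval l f) := by
      rw [Nat.descFactorial_succ, e1]
      push_cast
      have : ∀ j, (t.descFactorial k * eval l (pderiv j f)) * (((d : ℂ) + 1) * l j) =
        ((d : ℂ) + 1) * t.descFactorial k * (l j * eval l (pderiv j f)) := fun j => by ring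
      simp only [this]
      rw [← Finset.mul_sum, euler]
      ring
    have h4 : ∑ j, D (b j) (derivationRep D (symm b k (pderiv j f)) (φ ^ t)) =
        ((k : ℂ) + 1) • derivationRep D (symm b (k + 1) f) (φ ^ t) := by
      rw [← LinearMap.smul_apply, ← map_smul, symm_succ, map_sum, LinearMap.sum_apply]
      refine Finset.sum_congr rfl fun j _ => ?_
      rw [map_mul, Module.End.mul_apply, derivationRep_ι]
    rw [h3, h4, mul_smul, ← smul_sub] at hsum
    have := Submodule.smul_of_tower_mem _ ((k : ℂ) + 1)⁻¹ hsum
    rwa [smul_smul, inv_mul_cancel₀ hk, one_smul] at this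

include hφ hlam in
lemma eval_eq_zero_of_symm_mem (h1 : 𝔪 ≠ ⊤) {k : ℕ} {f : MvPolynomial J ℂ}
    (hf : f.IsHomogeneous k) (h : symm b k f ∈ filt q k) : eval (fun j => lam (b j)) f = 0 := by
  have h2 := derivationRep_symm_pow D 𝔪 b hφ lam hlam le_rfl hf
  have h3 : derivationRep D (symm b k f) (φ ^ k) ∈ 𝔪 := by
    obtain _ | k := k
    · simp [(Submodule.mem_bot ℂ).1 h]
    · have := derivationRep_mem_pow D 𝔪 h (Ideal.pow_mem_pow hφ (k + 1))
      simpa using this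
  rw [Nat.sub_self, pow_zero, zero_add, pow_one] at h2
  have h4 := (Submodule.sub_mem_iff_right _ h3).1 h2
  by_contra h5
  refine h1 ((Ideal.eq_top_iff_one _).2 ?_)
  have h6 : ((k.descFactorial k : ℂ) * eval (fun j => lam (b j)) f) ≠ 0 := by
    rw [Nat.descFactorial_self]
    exact mul_ne_zero (by exact_mod_cast k.factorial_ne_zero) h5
  have := Submodule.smul_of_tower_mem 𝔪
    ((k.descFactorial k : ℂ) * eval (fun j => lam (b j)) f)⁻¹ h4
  rwa [smul_smul, inv_mul_cancel₀ h6, one_smul] at this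

end Separation

section PBW

variable {q J : Type} [LieRing q] [LieAlgebra ℂ q] [Fintype J] [DecidableEq J]
  (b : Module.Basis J ℂ q)

/-- The right-invariant vector fields on the adjoint group, on matrix coordinates. -/
def matrixField : q →ₗ⁅ℂ⁆ Derivation ℂ (MvPolynomial (J × J) ℂ) (MvPolynomial (J × J) ℂ) where
  toFun y := mkDerivation ℂ fun p =>
    ∑ l, LinearMap.toMatrix b b (LieAlgebra.ad ℂ q y) l p.2 • X (p.1, l)
  map_add' x y := by
    apply MvPolynomial.derivation_ext
    intro p
    simp [mkDerivation_X, add_smul, Finset.sum_add_distrib]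
  map_smul' c x := by
    apply MvPolynomial.derivation_ext
    intro p
    simp [mkDerivation_X, mul_smul, Finset.smul_sum]
  map_lie' {x y} := by
    apply MvPolynomial.derivation_ext
    intro p
    simp only [Derivation.commutator_apply, mkDerivation_X, map_sum, Derivation.map_smul,
      LieHom.map_lie, Finset.smul_sum, smul_smul, LieRing.of_associative_ring_bracket, map_sub,
      LinearMap.toMatrix_mul, Matrix.sub_apply, Matrix.mul_apply, sub_smul, Finset.sum_smul,
      Finset.sum_sub_distrib]
    congr 1 <;> (rw [Finset.sum_comm]; simp only [mul_comm])

lemma matrixField_X (y : q) (p : J × J) : matrixField b y (X p) =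
    ∑ l, LinearMap.toMatrix b b (LieAlgebra.ad ℂ q y) l p.2 • X (p.1, l) :=
  mkDerivation_X _ _ _

lemma eq_zero_of_symm_mem (had : Function.Injective (LieAlgebra.ad ℂ q)) {k : ℕ}
    {f : MvPolynomial J ℂ} (hf : f.IsHomogeneous k) (h : symm b k f ∈ filt q k) : f = 0 := by
  apply MvPolynomial.funext
  intro l
  rw [map_zero]
  let lam : q →ₗ[ℂ] ℂ := b.constr ℂ l
  let pt : J × J → ℂ := fun p => if p.1 = p.2 then 1 else 0
  let M : q →ₗ[ℂ] Matrix J J ℂ :=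
    (LinearMap.toMatrix b b).toLinearMap ∘ₗ (LieAlgebra.ad ℂ q : q →ₗ[ℂ] Module.End ℂ q)
  have hM : LinearMap.ker M = ⊥ := by
    rw [LinearMap.ker_eq_bot]
    exact (LinearMap.toMatrix b b).injective.comp had
  obtain ⟨N, hN⟩ := LinearMap.exists_leftInverse_of_injective M hM
  let ν : Matrix J J ℂ →ₗ[ℂ] ℂ := lam ∘ₗ N
  let φ : MvPolynomial (J × J) ℂ :=
    ∑ i, ∑ j, ν (Matrix.single i j 1) • (X (i, j) - C (pt (i, j)))
  have key := eval_eq_zero_of_symm_mem (matrixField b) (RingHom.ker (eval pt)) b (φ := φ) ?_ lam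
    ?_ ?_ hf h
  · simpa [lam] using key
  · simp [φ, RingHom.mem_ker]
  · intro y
    have hl : lam y = ∑ i, ∑ j, ν (Matrix.single i j 1) * M y i j := by
      have h1 : lam y = ν (M y) := by
        change lam y = lam ((N ∘ₗ M) y)
        rw [hN]
        rfl
      rw [h1]
      conv_lhs => rw [Matrix.matrix_eq_sum_single (M y)]
      simp only [map_sum]
      refine Finset.sum_congr rfl fun i _ => Finset.sum_congr rfl fun j _ => ?_
      rw [← mul_one (M y i j), ← smul_eq_mul (M y i j), ← Matrix.smul_single, map_smul,
        smul_eq_mul, smul_eq_mul, mul_comm, mul_one]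
    rw [RingHom.mem_ker, map_sub, sub_eq_zero, hl]
    simp only [φ, map_sum, Derivation.map_smul, map_sub, matrixField_X, derivation_C, sub_zero]
    simp [pt, smul_eval, M]
  · exact RingHom.ker_ne_top _

end PBW

section Center

variable {q J κ : Type} [LieRing q] [LieAlgebra ℂ q] [Fintype J] (b : Module.Basis J ℂ q)
  (F : κ → MvPolynomial J ℂ) (d : κ → ℕ) (hF : ∀ i, (F i).IsHomogeneous (d i))
  (hinv : ∀ i z, act b z (F i) = 0)

lemma isHomogeneous_aeval_of_weighted {J κ : Type} {F : κ → MvPolynomial J ℂ} {d : κ → ℕ}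
    (hF : ∀ i, (F i).IsHomogeneous (d i)) {w : ℕ} {p : MvPolynomial κ ℂ}
    (hp : p.IsWeightedHomogeneous d w) : (aeval F p).IsHomogeneous w := by
  rw [p.as_sum, map_sum]
  refine IsHomogeneous.sum _ _ _ fun m hm => ?_
  rw [aeval_monomial, algebraMap_eq]
  refine IsHomogeneous.C_mul ?_ _
  have hw := hp (mem_support_iff.1 hm)
  rw [← hw, Finsupp.weight_apply]
  refine IsHomogeneous.prod _ _ _ fun i _ => ?_
  simpa [mul_comm] using (hF i).pow (m i)

include hinv in
lemma symm_mem_center (i : κ) :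
    symm b (d i) (F i) ∈ Subalgebra.center ℂ (UniversalEnvelopingAlgebra ℂ q) := by
  refine mem_center_of_commute fun y => ?_
  rw [← sub_eq_zero, ι_mul_symm, hinv, map_zero]

/-- The homomorphism from a polynomial algebra to the centre given by symmetrizing invariants. -/
def centerHom : MvPolynomial κ ℂ →ₐ[ℂ] Subalgebra.center ℂ (UniversalEnvelopingAlgebra ℂ q) :=
  aeval fun i => ⟨symm b (d i) (F i), symm_mem_center b F d hinv i⟩

include hF in
lemma centerHom_sub_mem {w : ℕ} {p : MvPolynomial κ ℂ} (hp : p.IsWeightedHomogeneous d w) :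
    (centerHom b F d hinv p : UniversalEnvelopingAlgebra ℂ q) - symm b w (aeval F p) ∈
      filt q w := by
  classical
  have mono : ∀ (m : κ →₀ ℕ) (r : ℂ),
      (centerHom b F d hinv (monomial m r) : UniversalEnvelopingAlgebra ℂ q) -
        symm b (Finsupp.weight d m) (aeval F (monomial m r)) ∈ filt q (Finsupp.weight d m) := by
    intro m r
    induction m using Finsupp.induction_linear generalizing r with
    | zero => simp [symm_zero, centerHom]
    | add m m' h h' =>
      obtain ⟨r', hr'⟩ : ∃ r' : ℂ, r' = 1 := ⟨1, rfl⟩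
      have e : monomial (m + m') r = monomial m r * monomial m' r' := by
        rw [monomial_mul, hr', mul_one]
      have h := h r
      have h' := h' r'
      rw [e, map_mul, map_mul, map_add]
      have hom : (aeval F (monomial m r)).IsHomogeneous (Finsupp.weight d m) :=
        isHomogeneous_aeval_of_weighted hF (isWeightedHomogeneous_monomial _ _ _ rfl)
      have h3 := symm_mul_symm_sub_mem b hom (Finsupp.weight d m') (aeval F (monomial m' r'))
      have h4 := filt_mul' (symm_mem_filt b (Finsupp.weight d m) (aeval F (monomial m r))) h'
      have h5 : (centerHom b F d hinv (monomial m' r') : UniversalEnvelopingAlgebra ℂ q) ∈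
          filt q (Finsupp.weight d m' + 1) := by
        have := add_mem (filt_mono (Nat.le_succ _) h')
          (symm_mem_filt b (Finsupp.weight d m') (aeval F (monomial m' r')))
        rwa [sub_add_cancel] at this
      have h6 := filt_mul h h5
      convert add_mem (add_mem h6 h4) h3 using 1
      rw [Subalgebra.coe_mul, mul_sub, sub_mul]
      abel
    | single i n =>
      induction n generalizing r with
      | zero => simp [symm_zero, centerHom]
      | succ n ih =>
        have e : monomial (Finsupp.single i (n + 1)) r = X i * monomial (Finsupp.single i n) r := by
          rw [add_comm n, Finsupp.single_add, monomial_single_add, pow_one]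
        have hw : Finsupp.weight d (Finsupp.single i (n + 1)) =
            d i + Finsupp.weight d (Finsupp.single i n) := by
          simp [Finsupp.weight_apply, Finsupp.sum_single_index, -Finsupp.single_add]; ring
        rw [e, hw, map_mul, map_mul, aeval_X]
        have h1 := symm_mul_symm_sub_mem b (hF i) (Finsupp.weight d (Finsupp.single i n))
          (aeval F (monomial (Finsupp.single i n) r))
        have h2 := filt_mul' (symm_mem_filt b (d i) (F i)) (ih r)
        convert add_mem h2 h1 using 1
        have : (centerHom b F d hinv (X i) : UniversalEnvelopingAlgebra ℂ q) =
          symm b (d i) (F i) := by simp [centerHom]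
        rw [Subalgebra.coe_mul, this, mul_sub]
        abel
  rw [p.as_sum]
  simp only [map_sum, AddSubmonoidClass.coe_finsetSum]
  rw [← Finset.sum_sub_distrib]
  refine Submodule.sum_mem _ fun m hm => ?_
  have := mono m (coeff m p)
  rwa [hp (mem_support_iff.1 hm)] at this

/-- The centre of an enveloping algebra is polynomial when the invariants of the symmetric
algebra are freely generated by homogeneous elements. -/
theorem nonempty_center_equiv (had : Function.Injective (LieAlgebra.ad ℂ q))
    (F : κ → MvPolynomial J ℂ) (d : κ → ℕ) (hF : ∀ i, (F i).IsHomogeneous (d i))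
    (hinv : ∀ i z, act b z (F i) = 0) (hind : AlgebraicIndependent ℂ F)
    (hgen : ∀ f, (∀ z, act b z f = 0) → ∃ p : MvPolynomial κ ℂ, aeval F p = f) :
    Nonempty (Subalgebra.center ℂ (UniversalEnvelopingAlgebra ℂ q) ≃ₐ[ℂ] MvPolynomial κ ℂ) := by
  classical
  set Ψ := centerHom b F d hinv with hΨ
  have sum_comp : ∀ p : MvPolynomial κ ℂ, ∃ N : ℕ,
      p = ∑ w ∈ Finset.range N, weightedHomogeneousComponent d w p := by
    intro p
    refine ⟨weightedTotalDegree d p + 1, ?_⟩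
    conv_lhs => rw [← sum_weightedHomogeneousComponent d p]
    refine finsum_eq_sum_of_support_subset _ fun w hw => ?_
    by_contra h
    refine hw (weightedHomogeneousComponent_eq_zero _ _ ?_)
    simpa [Nat.lt_succ_iff] using h
  have comp_hom : ∀ (w : ℕ) (p : MvPolynomial κ ℂ),
      (weightedHomogeneousComponent d w p).IsWeightedHomogeneous d w :=
    fun w p => weightedHomogeneousComponent_isWeightedHomogeneous _ _
  have zero_of : ∀ (w : ℕ) (p : MvPolynomial κ ℂ), p.IsWeightedHomogeneous d w →
      (Ψ p : UniversalEnvelopingAlgebra ℂ q) ∈ filt q w → p = 0 := by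
    intro w p hp h
    have h1 := centerHom_sub_mem b F d hF hinv hp
    have h2 := (Submodule.sub_mem_iff_right _ h).1 h1
    have h3 := eq_zero_of_symm_mem b had (isHomogeneous_aeval_of_weighted hF hp) h2
    exact hind (by rw [h3, map_zero])
  have inj : Function.Injective Ψ := by
    rw [injective_iff_map_eq_zero]
    intro p hp
    obtain ⟨N, hN⟩ := sum_comp p
    have key : ∀ N, Ψ (∑ w ∈ Finset.range N, weightedHomogeneousComponent d w p) = 0 →
        ∑ w ∈ Finset.range N, weightedHomogeneousComponent d w p = 0 := by
      intro N
      induction N with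
      | zero => simp
      | succ N ih =>
        intro h
        rw [Finset.sum_range_succ, map_add] at h
        have h1 : weightedHomogeneousComponent d N p = 0 := by
          refine zero_of N _ (comp_hom _ _) ?_
          have h2 : Ψ (weightedHomogeneousComponent d N p) =
              -Ψ (∑ w ∈ Finset.range N, weightedHomogeneousComponent d w p) := by
            rw [eq_neg_iff_add_eq_zero, add_comm, h]
          rw [h2, map_sum]
          simp only [NegMemClass.coe_neg, AddSubmonoidClass.coe_finsetSum]
          refine neg_mem (Submodule.sum_mem _ fun w hw => ?_)
          have h3 := centerHom_sub_mem b F d hF hinv (comp_hom w p)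
          have h4 := add_mem (filt_mono (Nat.le_succ _) h3) (symm_mem_filt b w
            (aeval F (weightedHomogeneousComponent d w p)))
          rw [sub_add_cancel] at h4
          exact filt_mono (Finset.mem_range.1 hw) h4
        rw [h1, map_zero, add_zero] at h
        rw [Finset.sum_range_succ, h1, add_zero, ih h]
    rw [hN]
    exact key N (by rw [← hN, hp])
  have surj : Function.Surjective Ψ := by
    have key : ∀ k (z : Subalgebra.center ℂ (UniversalEnvelopingAlgebra ℂ q)),
        (z : UniversalEnvelopingAlgebra ℂ q) ∈ filt q k → ∃ p, Ψ p = z := by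
      intro k
      induction k with
      | zero =>
        intro z hz
        exact ⟨0, by rw [map_zero]; exact Subtype.ext ((Submodule.mem_bot ℂ).1 hz).symm⟩
      | succ k ih =>
        intro z hz
        obtain ⟨f, hf, hzf⟩ := exists_symm_sub_mem b k _ hz
        have hact : ∀ y, act b y f = 0 := by
          intro y
          have h1 := commutator_mem_filt y k hzf
          have h2 := (Subalgebra.mem_center_iff.1 z.2) (ι ℂ y)
          have h3 : ι ℂ y * ((z : UniversalEnvelopingAlgebra ℂ q) - symm b k f) -
              ((z : UniversalEnvelopingAlgebra ℂ q) - symm b k f) * ι ℂ y =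
              -symm b k (act b y f) := by
            rw [← ι_mul_symm, mul_sub, sub_mul, h2]
            abel
          rw [h3, neg_mem_iff] at h1
          refine eq_zero_of_symm_mem b had ?_ h1
          rw [derivation_eq_sum]
          refine IsHomogeneous.sum _ _ _ fun j _ => ?_
          have hl : (act b y (X j)).IsHomogeneous 1 := by
            rw [act_X, lin_eq_sum]
            exact IsHomogeneous.sum _ _ _ fun j _ => isHomogeneous_C_mul_X _ _
          obtain _ | k := k
          · have : pderiv j f = 0 := by
              rw [totalDegree_eq_zero_iff_eq_C.1 (Nat.le_zero.1 hf.totalDegree_le), pderiv_C]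
            rw [this, mul_zero]
            exact isHomogeneous_zero _ _ _
          · rw [add_comm k 1]
            exact hl.mul (hf.pderiv (i := j))
        obtain ⟨p, hp⟩ := hgen f hact
        have hpk : aeval F (weightedHomogeneousComponent d k p) = f := by
          obtain ⟨N, hN⟩ := sum_comp p
          have h1 : ∀ w, homogeneousComponent k (aeval F (weightedHomogeneousComponent d w p)) =
              if w = k then aeval F (weightedHomogeneousComponent d k p) else 0 := by
            intro w
            rw [homogeneousComponent_of_mem (isHomogeneous_aeval_of_weighted hF (comp_hom w p))]
            by_cases h : k = w
            · simp [h]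
            · simp [h, Ne.symm h]
          have h2 := congrArg (fun r => homogeneousComponent k (aeval F r)) hN
          simp only [map_sum, h1] at h2
          rw [hp, homogeneousComponent_eq_self hf, Finset.sum_ite_eq'] at h2
          by_cases hk : k < N
          · rw [h2, if_pos (Finset.mem_range.2 hk)]
          · have h3 := congrArg (weightedHomogeneousComponent d k) hN
            rw [map_sum, Finset.sum_eq_zero] at h3
            · rw [h3, map_zero, h2, if_neg (by simpa using hk)]
            · intro w hw
              rw [weightedHomogeneousComponent_of_mem (comp_hom w p), if_neg]
              have := Finset.mem_range.1 hw
              omega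
        have h5 := centerHom_sub_mem b F d hF hinv (comp_hom k p)
        rw [hpk] at h5
        obtain ⟨p', hp'⟩ := ih (z - Ψ (weightedHomogeneousComponent d k p)) (by
          have := sub_mem hzf h5
          rw [sub_sub_sub_cancel_right] at this
          exact this)
        exact ⟨p' + weightedHomogeneousComponent d k p, by rw [map_add, hp', sub_add_cancel]⟩
    intro z
    obtain ⟨k, hk⟩ := exists_mem_filt (z : UniversalEnvelopingAlgebra ℂ q)
    exact key k z hk
  exact ⟨(AlgEquiv.ofBijective Ψ ⟨inj, surj⟩).symm⟩

end Center

end TakiffCenter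

namespace TakiffCenter

open MvPolynomial

section Slice

variable {R κ ι : Type} [CommRing R] [Algebra ℂ R] [Fintype κ] [Fintype ι]
  [DecidableEq κ] [DecidableEq ι]
  (v : κ → R) (u : ι → Derivation ℂ R R) (Y : κ → ι → R) (d : R)

/-- The Euler derivation transverse to the slice `v = 0`, along the vector fields `u`. -/
def euler : Derivation ℂ R R := ∑ i, (∑ k, v k * Y k i) • u i

omit [DecidableEq κ] [DecidableEq ι] in
lemma euler_apply (r : R) : euler v u Y r = ∑ i, (∑ k, v k * Y k i) * u i r := by
  simp [euler, derivation_sum_apply]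

omit [Algebra ℂ R] [Fintype κ] [DecidableEq κ] in
lemma mem_sliceIdeal (k : κ) : v k ∈ Ideal.span (Set.range v) := Ideal.subset_span ⟨k, rfl⟩

omit [Algebra ℂ R] [Fintype ι] [DecidableEq κ] [DecidableEq ι] in
lemma coeff_mem_sliceIdeal (i : ι) : ∑ k, v k * Y k i ∈ Ideal.span (Set.range v) :=
  Submodule.sum_mem _ fun k _ => Ideal.mul_mem_right _ _ (mem_sliceIdeal v k)

omit [DecidableEq κ] [DecidableEq ι] in
lemma euler_mem (r : R) : euler v u Y r ∈ Ideal.span (Set.range v) := by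
  rw [euler_apply]
  exact Submodule.sum_mem _ fun i _ => Ideal.mul_mem_right _ _ (coeff_mem_sliceIdeal v Y i)

variable (hYN : ∀ k' k, ∑ i, Y k' i * u i (v k) - (if k' = k then d else 0) ∈
  Ideal.span (Set.range v))

include hYN in
omit [DecidableEq ι] in
lemma euler_sub_mem {x : R} (hx : x ∈ Ideal.span (Set.range v)) :
    euler v u Y x - d * x ∈ Ideal.span (Set.range v) ^ 2 := by
  rw [pow_two]
  refine Submodule.span_induction (p := fun x _ => euler v u Y x - d * x ∈
    Ideal.span (Set.range v) * Ideal.span (Set.range v)) ?_ (by simp) ?_ ?_ hx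
  · rintro _ ⟨k, rfl⟩
    have : euler v u Y (v k) - d * v k =
        ∑ k', v k' * (∑ i, Y k' i * u i (v k) - (if k' = k then d else 0)) := by
      simp only [mul_sub, Finset.sum_sub_distrib, mul_ite, mul_zero, Finset.sum_ite_eq',
        Finset.mem_univ, if_true, euler_apply, Finset.sum_mul, Finset.mul_sum]
      rw [Finset.sum_comm, mul_comm d]
      simp only [mul_assoc]
    rw [this]
    exact Submodule.sum_mem _ fun k' _ => Ideal.mul_mem_mul (mem_sliceIdeal v k') (hYN _ _)
  · intro x y _ _ hx hy
    rw [map_add, mul_add, add_sub_add_comm]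
    exact add_mem hx hy
  · intro a x hx h
    have : euler v u Y (a • x) - d * a • x =
        a * (euler v u Y x - d * x) + x * euler v u Y a := by
      simp only [Derivation.leibniz, smul_eq_mul]
      ring
    rw [this]
    exact add_mem (Ideal.mul_mem_left _ _ h) (Ideal.mul_mem_mul hx (euler_mem v u Y a))

include hYN in
omit [DecidableEq ι] in
lemma euler_sub_mem_pow (k : ℕ) {x : R} (hx : x ∈ Ideal.span (Set.range v) ^ k) :
    euler v u Y x - k * (d * x) ∈ Ideal.span (Set.range v) ^ (k + 1) := by
  induction k generalizing x with
  | zero => simpa using euler_mem v u Y x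
  | succ k ih =>
    rw [pow_succ'] at hx
    refine Submodule.mul_induction_on hx ?_ fun a c ha hc => ?_
    · intro a ha c hc
      have h1 := Ideal.mul_mem_mul ha (ih hc)
      have h2 := Ideal.mul_mem_mul (euler_sub_mem v u Y d hYN ha) hc
      rw [← pow_succ'] at h1
      rw [← pow_add, show 2 + k = k + 1 + 1 by ring] at h2
      convert add_mem h1 h2 using 1
      simp only [Derivation.leibniz, smul_eq_mul]
      push_cast
      ring
    · rw [map_add, mul_add, mul_add, add_sub_add_comm]
      exact add_mem ha hc

lemma natCast_mul_mem_iff {I : Ideal R} {k : ℕ} (hk : k ≠ 0) {x : R} :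
    (k : R) * x ∈ I ↔ x ∈ I := by
  refine ⟨fun h => ?_, fun h => Ideal.mul_mem_left _ _ h⟩
  have h1 := Submodule.smul_of_tower_mem I ((k : ℂ)⁻¹) h
  have h2 : (k : R) * x = (k : ℂ) • x := by simp [Algebra.smul_def]
  rwa [h2, smul_smul, inv_mul_cancel₀ (by exact_mod_cast hk), one_smul] at h1

include hYN in
omit [DecidableEq ι] in
/-- A function vanishing on the slice and killed by the Euler derivation vanishes. -/
lemma mem_pow_of_euler_mem
    (hd : ∀ k x, d * x ∈ Ideal.span (Set.range v) ^ k → x ∈ Ideal.span (Set.range v) ^ k)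
    {K : ℕ} {r : R} (hr : r ∈ Ideal.span (Set.range v))
    (hE : euler v u Y r ∈ Ideal.span (Set.range v) ^ K) : r ∈ Ideal.span (Set.range v) ^ K := by
  have key : ∀ k, k + 1 ≤ K → r ∈ Ideal.span (Set.range v) ^ (k + 1) := by
    intro k
    induction k with
    | zero => intro _; simpa using hr
    | succ k ih =>
      intro hk
      have h1 := euler_sub_mem_pow v u Y d hYN (k + 1) (ih (by omega))
      have h2 := (Submodule.sub_mem_iff_right _ (Ideal.pow_le_pow_right hk hE)).1 h1
      exact hd _ _ ((natCast_mul_mem_iff (Nat.succ_ne_zero k)).1 h2)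
  obtain _ | K := K
  · simp
  · exact key K le_rfl

omit [DecidableEq ι] in
/-- A function on the slice extends to a function killed by the Euler derivation. -/
lemma exists_euler_mem
    (hYN : ∀ k' k, ∑ i, Y k' i * u i (v k) - (if k' = k then 1 else 0) ∈
      Ideal.span (Set.range v))
    (A : Submodule ℂ R) (hA : ∀ x ∈ A, euler v u Y x ∈ A) (f : R) (hf : f ∈ A) (K : ℕ) :
    ∃ F ∈ A, F - f ∈ Ideal.span (Set.range v) ∧
      euler v u Y F ∈ Ideal.span (Set.range v) ^ K := by
  induction K with
  | zero => exact ⟨f, hf, by simp, by simp⟩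
  | succ K ih =>
    obtain ⟨F, hF, hFf, hE⟩ := ih
    obtain _ | K := K
    · exact ⟨F, hF, hFf, by simpa using euler_mem v u Y F⟩
    · have hK : ((K + 1 : ℕ) : ℂ) ≠ 0 := by exact_mod_cast Nat.succ_ne_zero K
      refine ⟨F - ((K + 1 : ℕ) : ℂ)⁻¹ • euler v u Y F,
        sub_mem hF (Submodule.smul_mem _ _ (hA F hF)), ?_, ?_⟩
      · rw [sub_right_comm]
        exact sub_mem hFf (Submodule.smul_of_tower_mem _ _ (euler_mem v u Y F))
      · have h1 := euler_sub_mem_pow v u Y 1 hYN (K + 1) hE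
        have h2 := Submodule.smul_of_tower_mem _ (-((K + 1 : ℕ) : ℂ)⁻¹) h1
        convert h2 using 1
        have h3 : ((K + 1 : ℕ) : R) * (1 * euler v u Y F) =
            ((K + 1 : ℕ) : ℂ) • euler v u Y F := by simp [Algebra.smul_def]
        rw [h3, map_sub, Derivation.map_smul, smul_sub, neg_smul, neg_smul, smul_smul,
          inv_mul_cancel₀ hK, one_smul]
        abel

/-- A function killed by the Euler derivation is invariant under the Lie algebra generated by the
transverse vector fields and by vector fields under which its restriction is invariant. -/
lemma derivation_mem_of_euler_mem
    (hYN : ∀ k' k, ∑ i, Y k' i * u i (v k) - (if k' = k then 1 else 0) ∈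
      Ideal.span (Set.range v))
    (hNY : ∀ j i, ∑ k, u j (v k) * Y k i - (if j = i then 1 else 0) ∈ Ideal.span (Set.range v))
    (S T : Submodule ℂ (Derivation ℂ R R)) (hS : ∀ D ∈ S, ∀ D' ∈ S, ⁅D, D'⁆ ∈ S)
    (hu : ∀ i, u i ∈ S) (hT : ∀ D ∈ T, ∀ k, D (v k) ∈ Ideal.span (Set.range v)) (hTS : T ≤ S)
    (hST : ∀ D ∈ S, ∃ D' ∈ T, ∃ c : ι → ℂ, D = D' + ∑ i, c i • u i)
    {F : R} {K : ℕ} (hF : ∀ D ∈ T, D F ∈ Ideal.span (Set.range v))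
    (hE : euler v u Y F ∈ Ideal.span (Set.range v) ^ (K + 1)) :
    ∀ D ∈ S, D F ∈ Ideal.span (Set.range v) ^ K := by
  set I := Ideal.span (Set.range v) with hI
  have hTI : ∀ D ∈ T, ∀ x ∈ I, D x ∈ I := by
    intro D hD x hx
    refine Submodule.span_induction (p := fun x _ => D x ∈ I) ?_ (by simp) ?_ ?_ hx
    · rintro _ ⟨k, rfl⟩
      exact hT D hD k
    · intro x y _ _ hx hy
      rw [map_add]
      exact add_mem hx hy
    · intro a x hx h
      rw [smul_eq_mul, Derivation.leibniz, smul_eq_mul, smul_eq_mul]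
      exact add_mem (Ideal.mul_mem_left _ _ h) (Ideal.mul_mem_right _ _ hx)
  have comm : ∀ D : Derivation ℂ R R, euler v u Y (D F) = D (euler v u Y F) -
      ∑ i, D (∑ k, v k * Y k i) * u i F - ∑ i, (∑ k, v k * Y k i) * ⁅D, u i⁆ F := by
    intro D
    rw [euler_apply, euler_apply, map_sum, ← Finset.sum_sub_distrib, ← Finset.sum_sub_distrib]
    refine Finset.sum_congr rfl fun i _ => ?_
    rw [Derivation.leibniz, Derivation.commutator_apply]
    simp only [smul_eq_mul]
    ring
  have key : ∀ m, m ≤ K → ∀ D ∈ S, D F ∈ I ^ m := by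
    intro m
    induction m with
    | zero => intros; simp
    | succ m ih =>
      intro hm
      have ih := ih (by omega)
      have hmod : ∀ D ∈ S, euler v u Y (D F) + ∑ i, D (∑ k, v k * Y k i) * u i F ∈
          I ^ (m + 1) := by
        intro D hD
        have h1 : D (euler v u Y F) ∈ I ^ (m + 1) :=
          Ideal.pow_le_pow_right (by omega) (derivation_mem_pow D I hE)
        have h2 : ∑ i, (∑ k, v k * Y k i) * ⁅D, u i⁆ F ∈ I ^ (m + 1) := by
          refine Submodule.sum_mem _ fun i _ => ?_
          rw [pow_succ']
          exact Ideal.mul_mem_mul (coeff_mem_sliceIdeal v Y i) (ih _ (hS _ hD _ (hu i)))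
        rw [comm]
        convert sub_mem h1 h2 using 1
        ring
      have hu' : ∀ j, u j F ∈ I ^ (m + 1) := by
        intro j
        have h1 : ∑ i, u j (∑ k, v k * Y k i) * u i F - u j F ∈ I ^ (m + 1) := by
          have : ∑ i, u j (∑ k, v k * Y k i) * u i F - u j F =
              ∑ i, (∑ k, v k * u j (Y k i) + (∑ k, u j (v k) * Y k i - if j = i then 1 else 0)) *
                u i F := by
            simp only [add_mul, sub_mul, Finset.sum_add_distrib, Finset.sum_sub_distrib, ite_mul,
              one_mul, zero_mul, Finset.sum_ite_eq, Finset.mem_univ, if_true, map_sum,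
              Derivation.leibniz, smul_eq_mul]
            rw [add_sub_assoc]
            simp only [mul_comm]
          rw [this]
          refine Submodule.sum_mem _ fun i _ => ?_
          rw [pow_succ']
          refine Ideal.mul_mem_mul (add_mem ?_ (hNY j i)) (ih _ (hu i))
          exact Submodule.sum_mem _ fun k _ => Ideal.mul_mem_right _ _ (mem_sliceIdeal v k)
        have h2 := euler_sub_mem_pow v u Y 1 hYN m (ih _ (hu j))
        have h3 := sub_mem (sub_mem (hmod _ (hu j)) h1) h2
        rw [← natCast_mul_mem_iff (Nat.succ_ne_zero m)]
        convert h3 using 1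
        push_cast
        ring
      have hT' : ∀ D ∈ T, D F ∈ I ^ (m + 1) := by
        intro D hD
        obtain _ | m := m
        · simpa using hF D hD
        have h1 : ∑ i, D (∑ k, v k * Y k i) * u i F ∈ I ^ (m + 1 + 1) := by
          refine Submodule.sum_mem _ fun i _ => ?_
          rw [pow_succ' I (m + 1)]
          exact Ideal.mul_mem_mul (hTI D hD _ (coeff_mem_sliceIdeal v Y i)) (ih _ (hu i))
        have h2 := euler_sub_mem_pow v u Y 1 hYN (m + 1) (ih _ (hTS hD))
        have h3 := sub_mem (sub_mem (hmod _ (hTS hD)) h1) h2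
        rw [← natCast_mul_mem_iff (Nat.succ_ne_zero m)]
        convert h3 using 1
        ring
      intro D hD
      obtain ⟨D', hD', c, rfl⟩ := hST D hD
      rw [Derivation.add_apply, derivation_sum_apply]
      refine add_mem (hT' D' hD') (Submodule.sum_mem _ fun i _ => ?_)
      exact Submodule.smul_of_tower_mem _ _ (hu' i)
  exact key K le_rfl

end Slice

section LocalizedDerivation

variable {P R : Type} [CommRing P] [CommRing R] [Algebra ℂ P] [Algebra ℂ R] [Algebra P R]
  [IsScalarTower ℂ P R] (M : Submonoid P) [IsLocalization M R]

include M in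
lemma exists_derivation_localization (D : Derivation ℂ P P) :
    ∃ D' : Derivation ℂ R R, ∀ p, D' (algebraMap P R p) = algebraMap P R (D p) := by
  have : Algebra.FormallyEtale P R := Algebra.FormallyEtale.of_isLocalization M
  have hb := KaehlerDifferential.isBaseChange_of_formallyEtale ℂ P R
  let D₁ : Derivation ℂ P R := (Algebra.linearMap P R).compDer D
  refine ⟨(hb.lift D₁.liftKaehlerDifferential).compDer (KaehlerDifferential.D ℂ R), fun p => ?_⟩
  have h := hb.lift_eq D₁.liftKaehlerDifferential (KaehlerDifferential.D ℂ P p)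
  rw [KaehlerDifferential.map_D] at h
  exact h.trans (Derivation.liftKaehlerDifferential_comp_D _ _)

/-- The extension of a derivation to a localization. -/
def locDer (D : Derivation ℂ P P) : Derivation ℂ R R :=
  (exists_derivation_localization (R := R) M D).choose

lemma locDer_algebraMap (D : Derivation ℂ P P) (p : P) :
    locDer (R := R) M D (algebraMap P R p) = algebraMap P R (D p) :=
  (exists_derivation_localization (R := R) M D).choose_spec p

include M in
omit [Algebra ℂ P] [IsScalarTower ℂ P R] in
lemma derivation_ext_localization {D D' : Derivation ℂ R R}
    (h : ∀ p, D (algebraMap P R p) = D' (algebraMap P R p)) : D = D' := by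
  ext x
  obtain ⟨⟨a, s⟩, hx⟩ := IsLocalization.surj M x
  have h1 := congrArg D hx
  have h2 := congrArg D' hx
  rw [Derivation.leibniz] at h1 h2
  have hu := IsLocalization.map_units R s
  simp only [smul_eq_mul, h] at h1 h2
  have : algebraMap P R s * (D x - D' x) = 0 := by linear_combination h1 - h2
  rw [hu.mul_right_eq_zero] at this
  exact sub_eq_zero.1 this

/-- The extension of derivations to a localization as a linear map. -/
def locDerₗ : Derivation ℂ P P →ₗ[ℂ] Derivation ℂ R R where
  toFun := locDer M
  map_add' D D' := derivation_ext_localization M fun p => by simp [locDer_algebraMap]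
  map_smul' c D := derivation_ext_localization M fun p => by
    simp [locDer_algebraMap, Algebra.smul_def, ← IsScalarTower.algebraMap_apply ℂ P R]

lemma locDerₗ_algebraMap (D : Derivation ℂ P P) (p : P) :
    locDerₗ (R := R) M D (algebraMap P R p) = algebraMap P R (D p) := locDer_algebraMap M D p

lemma locDerₗ_lie (D D' : Derivation ℂ P P) :
    locDerₗ (R := R) M ⁅D, D'⁆ = ⁅locDerₗ (R := R) M D, locDerₗ (R := R) M D'⁆ :=
  derivation_ext_localization M fun p => by
    simp [locDerₗ_algebraMap, Derivation.commutator_apply]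

end LocalizedDerivation

section Coefficients

variable {Φ B : Type} [CommRing B]

lemma dvd_coeff_of_dvd_coeff_mul {c : B} (hc : ∀ x y, c ∣ x * y → c ∣ x ∨ c ∣ y)
    {t a : MvPolynomial Φ B} (ht : ¬ c ∣ constantCoeff t) {K : ℕ}
    (h : ∀ s, s.degree < K → c ∣ coeff s (t * a)) : ∀ s, s.degree < K → c ∣ coeff s a := by
  classical
  intro s
  induction hs : s.degree using Nat.strong_induction_on generalizing s with
  | _ n ih =>
    subst hs
    intro hK
    have h1 := h s hK
    rw [coeff_mul, Finset.sum_eq_add_sum_sdiff_singleton_of_mem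
      (i := (0, s)) (by simp)] at h1
    have h2 : c ∣ ∑ x ∈ Finset.HasAntidiagonal.antidiagonal s \ {(0, s)},
        coeff x.1 t * coeff x.2 a := by
      refine Finset.dvd_sum fun x hx => Dvd.dvd.mul_left ?_ _
      simp only [Finset.mem_sdiff, Finset.HasAntidiagonal.mem_antidiagonal,
        Finset.mem_singleton] at hx
      obtain ⟨hx, hne⟩ := hx
      have hlt : x.2.degree < s.degree := by
        rw [← hx, map_add]
        have : x.1.degree ≠ 0 := by
          intro h0
          rw [Finsupp.degree_eq_zero_iff] at h0
          apply hne
          rw [h0, zero_add] at hx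
          exact Prod.ext h0 hx
        omega
      exact ih _ hlt _ rfl (hlt.trans hK)
    exact (hc _ _ ((dvd_add_left h2).1 h1)).resolve_left ht

lemma exists_coeff_eq_mul {c : B} {a : MvPolynomial Φ B} {K : ℕ}
    (h : ∀ s, s.degree < K → c ∣ coeff s a) :
    ∃ a' : MvPolynomial Φ B, ∀ s, s.degree < K → coeff s a = c * coeff s a' := by
  classical
  have h' : ∀ s, ∃ x : B, s.degree < K → coeff s a = c * x := by
    intro s
    by_cases hs : s.degree < K
    · obtain ⟨x, hx⟩ := h s hs
      exact ⟨x, fun _ => hx⟩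
    · exact ⟨0, fun h => absurd h hs⟩
  choose x hx using h'
  refine ⟨∑ s ∈ a.support, monomial s (x s), fun s hs => ?_⟩
  simp only [coeff_sum, coeff_monomial, Finset.sum_ite_eq', mem_support_iff]
  split_ifs with h0
  · exact hx s hs
  · simpa using h0

lemma coeff_mul_congr {a a' t : MvPolynomial Φ B} {c : B} {K : ℕ}
    (h : ∀ s, s.degree < K → coeff s a = c * coeff s a') :
    ∀ s, s.degree < K → coeff s (t * a) = c * coeff s (t * a') := by
  classical
  intro s hs
  rw [coeff_mul, coeff_mul, Finset.mul_sum]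
  refine Finset.sum_congr rfl fun x hx => ?_
  rw [Finset.HasAntidiagonal.mem_antidiagonal] at hx
  have : x.2.degree ≤ s.degree := by rw [← hx, map_add]; omega
  rw [h _ (this.trans_lt hs)]
  ring

lemma prod_dvd_coeff [IsDomain B] {K : ℕ} (l : List B) (hl : ∀ c ∈ l, Prime c)
    (a : MvPolynomial Φ B) (h : ∀ c ∈ l, ∃ t : MvPolynomial Φ B, ¬ c ∣ constantCoeff t ∧
      ∀ s, s.degree < K → l.prod ∣ coeff s (t * a)) :
    ∀ s, s.degree < K → l.prod ∣ coeff s a := by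
  induction l generalizing a with
  | nil => simp
  | cons c l ih =>
    obtain ⟨t, ht, hta⟩ := h c (by simp)
    have hc := hl c (by simp)
    have h1 := dvd_coeff_of_dvd_coeff_mul (fun x y => hc.dvd_or_dvd) ht
      fun s hs => (List.dvd_prod (by simp)).trans (hta s hs)
    obtain ⟨a', ha'⟩ := exists_coeff_eq_mul h1
    have h2 := ih (fun c hc => hl c (by simp [hc])) a' fun c' hc' => by
      obtain ⟨t, ht, hta⟩ := h c' (by simp [hc'])
      refine ⟨t, ht, fun s hs => ?_⟩
      have := hta s hs
      rw [coeff_mul_congr ha' s hs, List.prod_cons] at this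
      exact (mul_dvd_mul_iff_left hc.ne_zero).1 this
    intro s hs
    rw [ha' s hs, List.prod_cons]
    exact mul_dvd_mul_left c (h2 s hs)

end Coefficients

section Restriction

variable (Φ Λ : Type)

/-- Restriction of polynomial functions to the Cartan subalgebra. -/
def res : MvPolynomial (Φ ⊕ Λ) ℂ →ₐ[ℂ] MvPolynomial Λ ℂ := aeval (Sum.elim 0 X)

/-- The ideal of the Cartan subalgebra. -/
def rootIdeal : Ideal (MvPolynomial (Φ ⊕ Λ) ℂ) :=
  Ideal.span (Set.range fun α : Φ => X (Sum.inl α))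

variable {Φ Λ}

@[simp] lemma res_X_inl (α : Φ) : res Φ Λ (X (Sum.inl α)) = 0 := by simp [res]

@[simp] lemma res_X_inr (i : Λ) : res Φ Λ (X (Sum.inr i)) = X i := by simp [res]

lemma res_rename (f : MvPolynomial Λ ℂ) : res Φ Λ (rename Sum.inr f) = f := by
  rw [res, aeval_rename]
  exact aeval_X_left_apply f

lemma constantCoeff_sumAlgEquiv (x : MvPolynomial (Φ ⊕ Λ) ℂ) :
    constantCoeff (sumAlgEquiv ℂ Φ Λ x) = res Φ Λ x := by
  have : ((constantCoeff : MvPolynomial Φ (MvPolynomial Λ ℂ) →+* _)).comp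
      (sumAlgEquiv ℂ Φ Λ : MvPolynomial (Φ ⊕ Λ) ℂ →+* _) = (res Φ Λ : _ →+* _) := by
    refine MvPolynomial.ringHom_ext (fun c => ?_) fun j => ?_
    · simp [res, algebraMap_eq]
    · rcases j with α | i <;> simp
  exact DFunLike.congr_fun this x

lemma mem_rootIdeal_pow_iff {K : ℕ} {x : MvPolynomial (Φ ⊕ Λ) ℂ} :
    x ∈ rootIdeal Φ Λ ^ K ↔ ∀ s, s.degree < K → coeff s (sumAlgEquiv ℂ Φ Λ x) = 0 := by
  rw [← mem_pow_idealOfVars_iff']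
  have h : idealOfVars Φ (MvPolynomial Λ ℂ) = (rootIdeal Φ Λ).map (sumAlgEquiv ℂ Φ Λ) := by
    rw [rootIdeal, Ideal.map_span, ← Set.range_comp, idealOfVars]
    congr 2
    ext α
    simp
  rw [h, ← Ideal.map_pow]
  constructor
  · exact Ideal.mem_map_of_mem _
  · intro hx
    obtain ⟨y, hy, hxy⟩ := (Ideal.mem_map_iff_of_surjective _
      (sumAlgEquiv ℂ Φ Λ).surjective).1 hx
    rwa [← (sumAlgEquiv ℂ Φ Λ).injective hxy]

lemma mem_rootIdeal_iff {x : MvPolynomial (Φ ⊕ Λ) ℂ} : x ∈ rootIdeal Φ Λ ↔ res Φ Λ x = 0 := by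
  rw [← pow_one (rootIdeal Φ Λ), mem_rootIdeal_pow_iff, ← constantCoeff_sumAlgEquiv]
  constructor
  · intro h
    exact h 0 (by simp)
  · intro h s hs
    rw [Nat.lt_one_iff, Finsupp.degree_eq_zero_iff] at hs
    rw [hs]
    exact h

instance : (rootIdeal Φ Λ).IsPrime := by
  have : rootIdeal Φ Λ = RingHom.ker (res Φ Λ) := by
    ext x
    rw [mem_rootIdeal_iff, RingHom.mem_ker]
  rw [this]
  exact RingHom.ker_isPrime _

lemma mem_rootIdeal_pow_of_mul_mem {t x : MvPolynomial (Φ ⊕ Λ) ℂ} {K : ℕ}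
    (ht : t ∉ rootIdeal Φ Λ) (h : t * x ∈ rootIdeal Φ Λ ^ K) : x ∈ rootIdeal Φ Λ ^ K := by
  rw [mem_rootIdeal_pow_iff] at h ⊢
  rw [mem_rootIdeal_iff, ← constantCoeff_sumAlgEquiv] at ht
  have := dvd_coeff_of_dvd_coeff_mul (c := (0 : MvPolynomial Λ ℂ))
    (t := sumAlgEquiv ℂ Φ Λ t) (a := sumAlgEquiv ℂ Φ Λ x) (K := K) (by simp)
    (by simpa using ht)
  simp only [zero_dvd_iff, ← map_mul] at this
  exact this h

variable (Φ Λ)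

/-- The local ring of the Cartan subalgebra. -/
abbrev LocRing : Type := Localization.AtPrime (rootIdeal Φ Λ)

/-- The maximal ideal of the local ring of the Cartan subalgebra. -/
abbrev locIdeal : Ideal (LocRing Φ Λ) :=
  (rootIdeal Φ Λ).map (algebraMap (MvPolynomial (Φ ⊕ Λ) ℂ) (LocRing Φ Λ))

variable {Φ Λ}

lemma algebraMap_mem_locIdeal_pow_iff {K : ℕ} {x : MvPolynomial (Φ ⊕ Λ) ℂ} :
    algebraMap _ (LocRing Φ Λ) x ∈ locIdeal Φ Λ ^ K ↔ x ∈ rootIdeal Φ Λ ^ K := by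
  rw [← Ideal.map_pow]
  refine ⟨fun h => ?_, Ideal.mem_map_of_mem _⟩
  rw [IsLocalization.algebraMap_mem_map_algebraMap_iff (rootIdeal Φ Λ).primeCompl] at h
  obtain ⟨t, ht, h⟩ := h
  exact mem_rootIdeal_pow_of_mul_mem ht h

lemma isUnit_algebraMap_of_res_ne_zero {x : MvPolynomial (Φ ⊕ Λ) ℂ} (hx : res Φ Λ x ≠ 0) :
    IsUnit (algebraMap _ (LocRing Φ Λ) x) :=
  IsLocalization.map_units (LocRing Φ Λ)
    (⟨x, fun h => hx (mem_rootIdeal_iff.1 h)⟩ : (rootIdeal Φ Λ).primeCompl)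

end Restriction

/-- The linear form with given coefficients. -/
def linForm {Λ : Type} [Fintype Λ] (c : Λ → ℂ) : MvPolynomial Λ ℂ := ∑ i, C (c i) * X i

/-- The pairing of a weight with an element of the Cartan subalgebra, both in coordinates. -/
def pair {Λ : Type} [Fintype Λ] (c w : Λ → ℂ) : ℂ := ∑ i, c i * w i

/-- The reflection attached to a coroot direction `c` and a root `w`. -/
def reflHom {Λ : Type} [Fintype Λ] (c w : Λ → ℂ) : MvPolynomial Λ ℂ →ₐ[ℂ] MvPolynomial Λ ℂ :=
  aeval fun i => X i - C (2 * w i / pair c w) * linForm c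

/-- A root space decomposition of a Lie algebra, together with the regular nilpotent character. -/
structure RootData (g Φ Λ : Type) [LieRing g] [LieAlgebra ℂ g] [Fintype Φ] [Fintype Λ] where
  b : Module.Basis (Φ ⊕ Λ) ℂ g
  neg : Φ → Φ
  wt : Φ → Λ → ℂ
  cr : Φ → Λ → ℂ
  ht : Φ → ℤ
  χ : g →ₗ[ℂ] ℂ
  h0 : Λ → ℂ
  neg_neg : ∀ α, neg (neg α) = α
  wt_neg : ∀ α, wt (neg α) = -wt α
  ht_neg : ∀ α, ht (neg α) = -ht α
  ht_ne_zero : ∀ α, ht α ≠ 0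
  wt_ne_two : ∀ α γ, wt γ ≠ wt α + wt α
  lie_hh : ∀ i j, ⁅b (Sum.inr i), b (Sum.inr j)⁆ = 0
  lie_hx : ∀ i α, ⁅b (Sum.inr i), b (Sum.inl α)⁆ = wt α i • b (Sum.inl α)
  lie_xx_neg : ∀ α, ⁅b (Sum.inl α), b (Sum.inl (neg α))⁆ = ∑ i, cr α i • b (Sum.inr i)
  lie_xx : ∀ α β, β ≠ neg α → ⁅b (Sum.inl α), b (Sum.inl β)⁆ = 0 ∨
    ∃ γ, ∃ c : ℂ, ⁅b (Sum.inl α), b (Sum.inl β)⁆ = c • b (Sum.inl γ) ∧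
      wt γ = wt α + wt β ∧ ht γ = ht α + ht β
  pair_ne_zero : ∀ α, pair (cr α) (wt α) ≠ 0
  cr_indep : ∀ α β, β ≠ α → β ≠ neg α → ∀ c : ℂ, cr β ≠ c • cr α
  refl_closed : ∀ f : MvPolynomial Λ ℂ, (∀ α, ht α = 1 → reflHom (cr α) (wt α) f = f) →
    ∀ α, reflHom (cr α) (wt α) f = f
  h0_wt : ∀ α, pair h0 (wt α) = ht α
  χ_inr : ∀ i, χ (b (Sum.inr i)) = 0
  χ_inl : ∀ α, χ (b (Sum.inl α)) ≠ 0 ↔ ht α = -1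
  χ_nondeg : ∀ u ∈ Submodule.span ℂ {x | ∃ α, ht α < 0 ∧ x = b (Sum.inl α)},
    (∀ i, χ ⁅u, b (Sum.inr i)⁆ = 0) → (∀ α, 0 < ht α → χ ⁅u, b (Sum.inl α)⁆ = 0) → u = 0

namespace RootData

variable {g Φ Λ : Type} [LieRing g] [LieAlgebra ℂ g] [Fintype Φ] [Fintype Λ]
  (D : RootData g Φ Λ)

/-- Root vectors. -/
def x (α : Φ) : g := D.b (Sum.inl α)

/-- The basis of the Cartan subalgebra. -/
def h (i : Λ) : g := D.b (Sum.inr i)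

/-- The coroot direction attached to a root. -/
def t (α : Φ) : g := ∑ i, D.cr α i • D.h i

lemma lie_t_x (α β : Φ) : ⁅D.t α, D.x β⁆ = pair (D.cr α) (D.wt β) • D.x β := by
  simp only [t, x, h, pair, sum_lie, smul_lie, D.lie_hx, smul_smul, Finset.sum_smul]

lemma lie_x_t (α β : Φ) : ⁅D.x β, D.t α⁆ = -pair (D.cr α) (D.wt β) • D.x β := by
  rw [← lie_skew, lie_t_x, neg_smul]

lemma lie_h_t (i : Λ) (α : Φ) : ⁅D.h i, D.t α⁆ = 0 := by
  simp [t, h, lie_sum, D.lie_hh]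

lemma lie_x_x_neg (α : Φ) : ⁅D.x α, D.x (D.neg α)⁆ = D.t α := D.lie_xx_neg α

lemma wt_ne_zero (α : Φ) : D.wt α ≠ 0 := by
  intro h
  have := D.h0_wt α
  rw [h] at this
  simp [pair] at this
  exact D.ht_ne_zero α (by exact_mod_cast this.symm)

/-- The restriction to the Cartan subalgebra. -/
lemma res_lin_x (α : Φ) : res Φ Λ (lin D.b (D.x α)) = 0 := by simp [x]

lemma res_lin_t (α : Φ) : res Φ Λ (lin D.b (D.t α)) = linForm (D.cr α) := by
  simp [t, h, linForm, smul_eq_C_mul]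

lemma linForm_cr_ne_zero (α : Φ) : linForm (D.cr α) ≠ 0 := by
  intro h
  apply D.pair_ne_zero α
  have := congrArg (aeval (D.wt α)) h
  simpa [linForm, pair] using this

/-- The set of roots `S` defines a Levi subalgebra. -/
structure IsLevi (S : Finset Φ) : Prop where
  neg_mem : ∀ α ∈ S, D.neg α ∈ S
  wt_ne : ∀ α ∈ S, ∀ β, β ∉ S → ∀ γ ∈ S, D.wt γ ≠ D.wt α + D.wt β

lemma isLevi_empty : D.IsLevi ∅ := ⟨by simp, by simp⟩

lemma isLevi_pair [DecidableEq Φ] (α : Φ) : D.IsLevi {α, D.neg α} := by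
  refine ⟨by simp [D.neg_neg, or_comm], ?_⟩
  intro α' hα' β hβ γ hγ h
  simp only [Finset.mem_insert, Finset.mem_singleton] at hα' hγ
  have hpm : ∀ δ, δ = α ∨ δ = D.neg α → D.wt δ = D.wt α ∨ D.wt δ = -D.wt α := by
    rintro δ (rfl | rfl)
    · exact Or.inl rfl
    · exact Or.inr (D.wt_neg α)
  have h1 : D.wt β = D.wt γ - D.wt α' := by rw [h]; abel
  rcases hpm _ hα' with h2 | h2 <;> rcases hpm _ hγ with h3 | h3
  · exact D.wt_ne_zero β (by rw [h1, h2, h3, sub_self])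
  · refine D.wt_ne_two (D.neg α) β ?_
    rw [h1, h2, h3, D.wt_neg]; abel
  · refine D.wt_ne_two α β ?_
    rw [h1, h2, h3]; abel
  · exact D.wt_ne_zero β (by rw [h1, h2, h3, sub_self])

variable (S : Finset Φ)

/-- The matrix of the transverse vector fields of a Levi subalgebra. -/
def leviMatrix : Matrix {β // β ∉ S} {β // β ∉ S} (MvPolynomial (Φ ⊕ Λ) ℂ) :=
  fun i k => lin D.b ⁅D.x (D.neg i), D.x k⁆

variable [DecidableEq Φ]

/-- The discriminant of a Levi subalgebra. -/
def leviDet : MvPolynomial (Φ ⊕ Λ) ℂ := (D.leviMatrix S).det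

lemma res_leviMatrix (i k : {β // β ∉ S}) : res Φ Λ (D.leviMatrix S i k) =
    Matrix.diagonal (fun i : {β // β ∉ S} => linForm (D.cr (D.neg i))) i k := by
  rw [leviMatrix, Matrix.diagonal_apply]
  split_ifs with h
  · subst h
    have := D.lie_x_x_neg (D.neg i)
    rw [D.neg_neg] at this
    rw [this, res_lin_t]
  · have hne : (k : Φ) ≠ D.neg (D.neg i) := by
      rw [D.neg_neg]
      exact fun h' => h (Subtype.ext h'.symm)
    rcases D.lie_xx _ _ hne with h0 | ⟨γ, c, h0, -⟩
    · rw [x, x, h0, map_zero, map_zero]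
    · rw [x, x, h0, map_smul, map_smul, lin_basis, res_X_inl, smul_zero]

lemma res_leviDet : res Φ Λ (D.leviDet S) =
    ∏ i : {β // β ∉ S}, linForm (D.cr (D.neg i)) := by
  rw [leviDet, ← Matrix.det_diagonal]
  refine (AlgHom.map_det (res Φ Λ) (D.leviMatrix S)).trans ?_
  congr 1
  ext1 i k
  exact D.res_leviMatrix S i k

lemma res_leviDet_ne_zero : res Φ Λ (D.leviDet S) ≠ 0 := by
  rw [res_leviDet]
  exact Finset.prod_ne_zero_iff.2 fun i _ => D.linForm_cr_ne_zero _

end RootData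

/-- The map to the local ring of the Cartan subalgebra. -/
def toLoc {Φ Λ : Type} : MvPolynomial (Φ ⊕ Λ) ℂ →+* LocRing Φ Λ := algebraMap _ _

lemma toLoc_C {Φ Λ : Type} (c : ℂ) :
    toLoc (C c : MvPolynomial (Φ ⊕ Λ) ℂ) = algebraMap ℂ (LocRing Φ Λ) c := by
  rw [IsScalarTower.algebraMap_apply ℂ (MvPolynomial (Φ ⊕ Λ) ℂ) (LocRing Φ Λ)]
  rfl

lemma toLoc_smul {Φ Λ : Type} (c : ℂ) (p : MvPolynomial (Φ ⊕ Λ) ℂ) :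
    toLoc (c • p) = c • toLoc p := by
  rw [smul_eq_C_mul, map_mul, toLoc_C, Algebra.smul_def]

namespace RootData

variable {g Φ Λ : Type} [LieRing g] [LieAlgebra ℂ g] [Fintype Φ] [Fintype Λ]
  (D : RootData g Φ Λ)

/-- The action on the local ring of the Cartan subalgebra. -/
def locAct : g →ₗ[ℂ] Derivation ℂ (LocRing Φ Λ) (LocRing Φ Λ) :=
  locDerₗ (P := MvPolynomial (Φ ⊕ Λ) ℂ) (R := LocRing Φ Λ) (rootIdeal Φ Λ).primeCompl ∘ₗ
    (act D.b : g →ₗ[ℂ] _)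

lemma locAct_toLoc (z : g) (p : MvPolynomial (Φ ⊕ Λ) ℂ) :
    D.locAct z (toLoc p) = toLoc (act D.b z p) :=
  locDerₗ_algebraMap (rootIdeal Φ Λ).primeCompl _ _

lemma locAct_lie (z w : g) : D.locAct ⁅z, w⁆ = ⁅D.locAct z, D.locAct w⁆ := by
  rw [locAct, LinearMap.comp_apply, LinearMap.comp_apply, LinearMap.comp_apply, ← locDerₗ_lie]
  congr 1
  exact LieHom.map_lie _ _ _

/-- The fractions whose denominator is a power of a given polynomial. -/
def fractions (δ : MvPolynomial (Φ ⊕ Λ) ℂ) : Subalgebra ℂ (LocRing Φ Λ) where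
  carrier := {y | ∃ m p, toLoc δ ^ m * y = toLoc p}
  mul_mem' := by
    rintro y z ⟨m, p, hp⟩ ⟨k, r, hr⟩
    refine ⟨m + k, p * r, ?_⟩
    rw [map_mul, ← hp, ← hr]
    ring
  add_mem' := by
    rintro y z ⟨m, p, hp⟩ ⟨k, r, hr⟩
    refine ⟨m + k, δ ^ k * p + δ ^ m * r, ?_⟩
    rw [map_add, map_mul, map_mul, ← hp, ← hr, map_pow, map_pow]
    ring
  algebraMap_mem' c := ⟨0, C c, by rw [pow_zero, one_mul, toLoc_C]⟩

omit [Fintype Φ] [Fintype Λ] in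
lemma toLoc_mem_fractions (δ p : MvPolynomial (Φ ⊕ Λ) ℂ) :
    toLoc p ∈ fractions δ := ⟨0, p, by simp⟩

lemma locAct_mem_fractions (δ : MvPolynomial (Φ ⊕ Λ) ℂ) (z : g) {y : LocRing Φ Λ}
    (hy : y ∈ fractions δ) : D.locAct z y ∈ fractions δ := by
  obtain ⟨m, p, hp⟩ := hy
  refine ⟨m + 1, δ * act D.b z p - (m : MvPolynomial (Φ ⊕ Λ) ℂ) * act D.b z δ * p, ?_⟩
  have h := congrArg (D.locAct z) hp
  rw [Derivation.leibniz, Derivation.leibniz_pow, locAct_toLoc, locAct_toLoc] at h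
  simp only [smul_eq_mul, nsmul_eq_mul] at h
  rw [map_sub, map_mul, map_mul, map_mul, map_natCast, ← h, ← hp]
  obtain _ | m := m
  · simp
  · simp only [Nat.add_sub_cancel]
    push_cast
    ring

variable [DecidableEq Φ] (S : Finset Φ)

lemma exists_levi_extension (hS : D.IsLevi S) (f : MvPolynomial (Φ ⊕ Λ) ℂ)
    (hfh : ∀ i, act D.b (D.h i) f = 0) (hfx : ∀ α ∈ S, act D.b (D.x α) f = 0) (K : ℕ) :
    ∃ F ∈ fractions (D.leviDet S), F - toLoc f ∈ locIdeal Φ Λ ∧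
      ∀ z, D.locAct z F ∈ locIdeal Φ Λ ^ K := by
  classical
  let v : {β // β ∉ S} → LocRing Φ Λ := fun β => toLoc (X (Sum.inl β.1))
  let u : {β // β ∉ S} → Derivation ℂ (LocRing Φ Λ) (LocRing Φ Λ) :=
    fun β => D.locAct (D.x (D.neg β))
  let N : Matrix {β // β ∉ S} {β // β ∉ S} (LocRing Φ Λ) := (D.leviMatrix S).map (toLoc)
  have huv : ∀ i k, u i (v k) = N i k := by
    intro i k
    simp only [u, v, locAct_toLoc, act_X]
    rfl
  have hdet : N.det = toLoc (D.leviDet S) :=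
    (RingHom.map_det (toLoc) (D.leviMatrix S)).symm
  have hunit : IsUnit N.det := by
    rw [hdet]
    exact isUnit_algebraMap_of_res_ne_zero (D.res_leviDet_ne_zero S)
  let Y' : Matrix {β // β ∉ S} {β // β ∉ S} (LocRing Φ Λ) := N⁻¹
  let Y : {β // β ∉ S} → {β // β ∉ S} → LocRing Φ Λ := fun k i => Y' k i
  have hYN : ∀ k' k, ∑ i, Y k' i * u i (v k) - (if k' = k then 1 else 0) ∈
      Ideal.span (Set.range v) := by
    intro k' k
    have : (Y' * N) k' k = (1 : Matrix _ _ (LocRing Φ Λ)) k' k := by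
      rw [Matrix.nonsing_inv_mul _ hunit]
    rw [Matrix.mul_apply, Matrix.one_apply] at this
    simp only [huv]
    rw [sub_eq_zero.2 (by exact this)]
    exact zero_mem _
  have hNY : ∀ j i, ∑ k, u j (v k) * Y k i - (if j = i then 1 else 0) ∈
      Ideal.span (Set.range v) := by
    intro j i
    have : (N * Y') j i = (1 : Matrix _ _ (LocRing Φ Λ)) j i := by
      rw [Matrix.mul_nonsing_inv _ hunit]
    rw [Matrix.mul_apply, Matrix.one_apply] at this
    simp only [huv]
    rw [sub_eq_zero.2 (by exact this)]
    exact zero_mem _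
  have hI : Ideal.span (Set.range v) ≤ locIdeal Φ Λ := by
    rw [Ideal.span_le]
    rintro _ ⟨β, rfl⟩
    exact Ideal.mem_map_of_mem _ (Ideal.subset_span ⟨β.1, rfl⟩)
  have hv : ∀ k, v k ∈ fractions (D.leviDet S) := fun k => toLoc_mem_fractions _ _
  have hY : ∀ k i, Y k i ∈ fractions (D.leviDet S) := by
    intro k i
    refine ⟨1, (D.leviMatrix S).adjugate k i, ?_⟩
    have h2 : N.det • Y' = N.adjugate := by
      rw [show Y' = N⁻¹ from rfl, Matrix.inv_def, smul_smul, Ring.mul_inverse_cancel _ hunit,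
        one_smul]
    have h3 := congrFun (congrFun h2 k) i
    rw [Matrix.smul_apply, smul_eq_mul, hdet] at h3
    rw [pow_one]
    refine Eq.trans h3 ?_
    have h4 := (RingHom.map_adjugate (toLoc) (D.leviMatrix S))
    exact (congrFun (congrFun h4 k) i).symm
  have hA : ∀ y ∈ Subalgebra.toSubmodule (fractions (D.leviDet S)),
      euler v u Y y ∈ Subalgebra.toSubmodule (fractions (D.leviDet S)) := by
    intro y hy
    rw [euler_apply]
    refine Submodule.sum_mem _ fun i _ => ?_
    refine (fractions (D.leviDet S)).mul_mem ?_ (D.locAct_mem_fractions _ _ hy)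
    exact Subalgebra.sum_mem _ fun k _ => Subalgebra.mul_mem _ (hv k) (hY k i)
  obtain ⟨F, hF, hFf, hE⟩ := exists_euler_mem v u Y hYN _ hA (toLoc f)
    (toLoc_mem_fractions _ _) (K + 1)
  refine ⟨F, hF, hI hFf, ?_⟩
  let T : Submodule ℂ (Derivation ℂ (LocRing Φ Λ) (LocRing Φ Λ)) := (Submodule.span ℂ
    (Set.range D.h ∪ D.x '' S)).map D.locAct
  have hgen : ∀ p : Derivation ℂ (LocRing Φ Λ) (LocRing Φ Λ) → Prop, (∀ i, p (D.locAct (D.h i))) →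
      (∀ α ∈ S, p (D.locAct (D.x α))) → (∀ a c, p a → p c → p (a + c)) →
      (∀ (r : ℂ) a, p a → p (r • a)) → p 0 → ∀ a ∈ T, p a := by
    rintro p h1 h2 h3 h4 h5 _ ⟨z, hz, rfl⟩
    refine Submodule.span_induction (p := fun z _ => p (D.locAct z)) ?_ ?_ ?_ ?_ hz
    · rintro _ (⟨i, rfl⟩ | ⟨α, hα, rfl⟩)
      · exact h1 i
      · exact h2 α hα
    · rwa [map_zero]
    · intro a c _ _ ha hc
      rw [map_add]
      exact h3 _ _ ha hc
    · intro r a _ ha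
      rw [map_smul]
      exact h4 _ _ ha
  have hvI := mem_sliceIdeal v
  have hTv : ∀ a ∈ T, ∀ k, a (v k) ∈ Ideal.span (Set.range v) := by
    refine hgen _ ?_ ?_ ?_ ?_ ?_
    · intro i k
      simp only [v, locAct_toLoc, act_X, h, D.lie_hx, map_smul, lin_basis]
      rw [toLoc_smul]
      exact Submodule.smul_of_tower_mem _ _ (hvI k)
    · intro α hα k
      have hk : D.b (Sum.inl k.1) = D.x k.1 := rfl
      simp only [v, locAct_toLoc, act_X, hk]
      have hne : k.1 ≠ D.neg α := fun h => k.2 (h ▸ hS.neg_mem α hα)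
      rcases D.lie_xx _ _ hne with h0 | ⟨γ, c, h0, h1, -⟩
      · rw [x, x, h0, map_zero, map_zero]
        exact zero_mem _
      · have hγ : γ ∉ S := fun h => hS.wt_ne α hα k k.2 γ h h1
        rw [x, x, h0, map_smul, lin_basis, toLoc_smul]
        exact Submodule.smul_of_tower_mem _ _ (hvI ⟨γ, hγ⟩)
    · intro a c ha hc k
      exact add_mem (ha k) (hc k)
    · intro r a ha k
      exact Submodule.smul_of_tower_mem _ r (ha k)
    · simp
  have hTI : ∀ a ∈ T, ∀ y ∈ Ideal.span (Set.range v), a y ∈ Ideal.span (Set.range v) := by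
    intro a ha y hy
    refine Submodule.span_induction (p := fun y _ => a y ∈ Ideal.span (Set.range v))
      ?_ (by simp) ?_ ?_ hy
    · rintro _ ⟨k, rfl⟩
      exact hTv a ha k
    · intro y z _ _ hy hz
      rw [map_add]
      exact add_mem hy hz
    · intro c y hy h
      rw [smul_eq_mul, Derivation.leibniz, smul_eq_mul, smul_eq_mul]
      exact add_mem (Ideal.mul_mem_left _ _ h) (Ideal.mul_mem_right _ _ hy)
  have hTf : ∀ a ∈ T, a (toLoc f) = 0 := by
    refine hgen _ ?_ ?_ ?_ ?_ ?_
    · intro i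
      rw [locAct_toLoc, hfh, map_zero]
    · intro α hα
      rw [locAct_toLoc, hfx α hα, map_zero]
    · intro a c ha hc
      rw [Derivation.add_apply, ha, hc, add_zero]
    · intro r a ha
      rw [Derivation.smul_apply, ha, smul_zero]
    · simp
  have hTF : ∀ a ∈ T, a F ∈ Ideal.span (Set.range v) := by
    intro a ha
    have := hTI a ha _ hFf
    rwa [map_sub, hTf a ha, sub_zero] at this
  have hST : ∀ a ∈ LinearMap.range D.locAct, ∃ a' ∈ T, ∃ c : {β // β ∉ S} → ℂ,
      a = a' + ∑ i, c i • u i := by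
    rintro _ ⟨z, rfl⟩
    have hz : z ∈ Submodule.span ℂ (Set.range D.b) := by rw [D.b.span_eq]; trivial
    refine Submodule.span_induction (p := fun z _ => ∃ a' ∈ T, ∃ c : {β // β ∉ S} → ℂ,
      D.locAct z = a' + ∑ i, c i • u i) ?_ ?_ ?_ ?_ hz
    · rintro _ ⟨α | i, rfl⟩
      · by_cases hα : α ∈ S
        · exact ⟨_, ⟨D.x α, Submodule.subset_span (Or.inr ⟨α, hα, rfl⟩), rfl⟩, 0, by simp [x]⟩
        · have hnα : D.neg α ∉ S := fun h => hα (D.neg_neg α ▸ hS.neg_mem _ h)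
          refine ⟨0, zero_mem _, Pi.single ⟨D.neg α, hnα⟩ 1, ?_⟩
          simp [Pi.single_apply, u, D.neg_neg, x]
      · exact ⟨_, ⟨D.h i, Submodule.subset_span (Or.inl ⟨i, rfl⟩), rfl⟩, 0, by simp [h]⟩
    · exact ⟨0, zero_mem _, 0, by simp⟩
    · rintro a c _ _ ⟨a', ha', r, ha⟩ ⟨c', hc', s, hc⟩
      refine ⟨a' + c', add_mem ha' hc', r + s, ?_⟩
      simp only [map_add, ha, hc, Pi.add_apply, add_smul, Finset.sum_add_distrib]
      abel
    · rintro r a _ ⟨a', ha', s, ha⟩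
      refine ⟨r • a', Submodule.smul_mem _ _ ha', r • s, ?_⟩
      simp only [map_smul, ha, smul_add, Finset.smul_sum, Pi.smul_apply, smul_eq_mul, mul_smul]
  have := derivation_mem_of_euler_mem v u Y hYN hNY (LinearMap.range D.locAct) T
    (by
      rintro _ ⟨z, rfl⟩ _ ⟨w, rfl⟩
      exact ⟨⁅z, w⁆, D.locAct_lie z w⟩) (fun i => ⟨_, rfl⟩) hTv
    (by rintro _ ⟨z, -, rfl⟩; exact ⟨z, rfl⟩) hST hTF hE
  intro z
  exact Ideal.pow_right_mono hI _ (this _ ⟨z, rfl⟩)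

end RootData

section Components

lemma map_weightedHomogeneousComponent {σ τ M M' : Type} [AddCommMonoid M] [AddCommMonoid M']
    (w : σ → M) (w' : τ → M') (T : MvPolynomial σ ℂ →ₗ[ℂ] MvPolynomial τ ℂ) (φ : M → M')
    (hφ : Function.Injective φ)
    (hT : ∀ n p, IsWeightedHomogeneous w p n → IsWeightedHomogeneous w' (T p) (φ n))
    (n : M) (p : MvPolynomial σ ℂ) : T (weightedHomogeneousComponent w n p) =
      weightedHomogeneousComponent w' (φ n) (T p) := by
  have : T ∘ₗ weightedHomogeneousComponent w n =
      weightedHomogeneousComponent w' (φ n) ∘ₗ T := by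
    refine (basisMonomials σ ℂ).ext fun s => ?_
    have h1 : IsWeightedHomogeneous w (monomial s (1 : ℂ)) (Finsupp.weight w s) :=
      isWeightedHomogeneous_monomial _ _ _ rfl
    simp only [LinearMap.comp_apply, coe_basisMonomials]
    by_cases h : Finsupp.weight w s = n
    · rw [h] at h1
      rw [h1.weightedHomogeneousComponent_same, (hT _ _ h1).weightedHomogeneousComponent_same]
    · rw [h1.weightedHomogeneousComponent_ne n (Ne.symm h), map_zero,
        (hT _ _ h1).weightedHomogeneousComponent_ne _ fun h' => h (hφ h'.symm)]
  exact LinearMap.congr_fun this p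

end Components

section Pair

variable {Λ : Type} [Fintype Λ] (c w : Λ → ℂ)

lemma reflHom_linForm_apply (c' : Λ → ℂ) : reflHom c w (linForm c') =
    linForm c' - C (2 * pair c' w / pair c w) * linForm c := by
  have h1 : reflHom c w (linForm c') =
      ∑ i, C (c' i) * (X i - C (2 * w i / pair c w) * linForm c) := by
    rw [linForm, map_sum]
    refine Finset.sum_congr rfl fun i _ => ?_
    rw [map_mul, algHom_C, algebraMap_eq, reflHom, aeval_X]
  have h2 : 2 * pair c' w / pair c w = ∑ i, c' i * (2 * w i / pair c w) := by
    rw [pair, Finset.mul_sum, Finset.sum_div]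
    exact Finset.sum_congr rfl fun i _ => by ring
  rw [h1, h2, map_sum, Finset.sum_mul]
  simp only [mul_sub, Finset.sum_sub_distrib, C_mul, mul_assoc]
  rfl

lemma reflHom_linForm (hp : pair c w ≠ 0) : reflHom c w (linForm c) = -linForm c := by
  rw [reflHom_linForm_apply, mul_div_assoc, div_self hp, mul_one, map_ofNat]
  ring

end Pair

namespace RootData

variable {g Φ Λ : Type} [LieRing g] [LieAlgebra ℂ g] [Fintype Φ] [Fintype Λ]
  (D : RootData g Φ Λ)

/-- The invariants of the subalgebra spanned by the Cartan subalgebra and a pair of opposite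
roots. -/
def pairInv (α : Φ) : Subalgebra ℂ (MvPolynomial (Φ ⊕ Λ) ℂ) where
  carrier := {F | (∀ i, act D.b (D.h i) F = 0) ∧ act D.b (D.x α) F = 0 ∧
    act D.b (D.x (D.neg α)) F = 0}
  mul_mem' := by
    rintro a c ⟨h1, h2, h3⟩ ⟨h1', h2', h3'⟩
    simp [h1, h2, h3, h1', h2', h3']
  add_mem' := by
    rintro a c ⟨h1, h2, h3⟩ ⟨h1', h2', h3'⟩
    simp [h1, h2, h3, h1', h2', h3']
  algebraMap_mem' c := by simp

lemma lin_mem_pairInv (α : Φ) (i : Λ) :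
    lin D.b (D.h i - (D.wt α i / pair (D.cr α) (D.wt α)) • D.t α) ∈ D.pairInv α := by
  have hp := D.pair_ne_zero α
  have hn : pair (D.cr α) (D.wt (D.neg α)) = - pair (D.cr α) (D.wt α) := by
    simp [pair, D.wt_neg]
  have hx : ∀ β, ⁅D.x β, D.h i⁆ = -D.wt β i • D.x β := fun β => by
    rw [← lie_skew, h, x, D.lie_hx, neg_smul]
  refine ⟨fun j => ?_, ?_, ?_⟩
  · rw [act_lin, lie_sub, lie_smul, lie_h_t, h, h, D.lie_hh]
    simp
  · rw [act_lin, lie_sub, lie_smul, lie_x_t, hx, smul_smul, ← sub_smul]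
    have : -D.wt α i - D.wt α i / pair (D.cr α) (D.wt α) * -pair (D.cr α) (D.wt α) = 0 := by
      field_simp; ring
    rw [this, zero_smul, map_zero]
  · rw [act_lin, lie_sub, lie_smul, lie_x_t, hx, smul_smul, ← sub_smul, hn, D.wt_neg]
    have : -(-D.wt α) i - D.wt α i / pair (D.cr α) (D.wt α) * -(-pair (D.cr α) (D.wt α)) = 0 := by
      simp only [Pi.neg_apply]
      field_simp; ring
    rw [this, zero_smul, map_zero]

lemma casimir_mem_pairInv (α : Φ) : lin D.b (D.t α) * lin D.b (D.t α) +
    C (2 * pair (D.cr α) (D.wt α)) * (lin D.b (D.x α) * lin D.b (D.x (D.neg α)))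
      ∈ D.pairInv α := by
  have hn : pair (D.cr α) (D.wt (D.neg α)) = - pair (D.cr α) (D.wt α) := by
    simp [pair, D.wt_neg]
  have hxn : ⁅D.x (D.neg α), D.x α⁆ = - D.t α := by rw [← lie_skew, lie_x_x_neg]
  refine ⟨fun j => ?_, ?_, ?_⟩
  · have h1 : ∀ β, ⁅D.h j, D.x β⁆ = D.wt β j • D.x β := fun β => D.lie_hx j β
    simp only [map_add, Derivation.leibniz, act_lin, lie_h_t, h1, D.wt_neg, map_smul, map_zero,
      derivation_C, smul_eq_mul, smul_eq_C_mul, Pi.neg_apply, C_neg]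
    ring
  · simp only [map_add, Derivation.leibniz, act_lin, lie_x_t, lie_x_x_neg, lie_self, map_smul,
      map_zero, derivation_C, smul_eq_mul, smul_eq_C_mul, C_neg]
    rw [C_mul, show (C (2 : ℂ) : MvPolynomial (Φ ⊕ Λ) ℂ) = 2 from map_ofNat C 2]
    ring
  · simp only [map_add, Derivation.leibniz, act_lin, lie_x_t, hxn, lie_self, map_smul, hn,
      map_zero, map_neg, derivation_C, smul_eq_mul, smul_eq_C_mul]
    rw [C_mul, show (C (2 : ℂ) : MvPolynomial (Φ ⊕ Λ) ℂ) = 2 from map_ofNat C 2]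
    ring

/-- A polynomial fixed by one reflection extends to an invariant of the corresponding
subalgebra. -/
lemma exists_pair_extension (α : Φ) (f : MvPolynomial Λ ℂ)
    (hf : reflHom (D.cr α) (D.wt α) f = f) : ∃ F ∈ D.pairInv α, res Φ Λ F = f := by
  have hp := D.pair_ne_zero α
  set p := pair (D.cr α) (D.wt α) with hpdef
  set t := linForm (D.cr α) with ht
  set s := reflHom (D.cr α) (D.wt α) with hs
  have hst : s t = -t := reflHom_linForm _ _ hp
  set y : Λ → MvPolynomial Λ ℂ := fun i => X i - C (D.wt α i / p) * t with hy
  let A : Subalgebra ℂ (MvPolynomial Λ ℂ) := ((D.pairInv α).map (res Φ Λ)) ⊓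
    AlgHom.equalizer s (AlgHom.id ℂ _)
  have hyA : ∀ i, y i ∈ A := by
    intro i
    refine ⟨⟨_, D.lin_mem_pairInv α i, ?_⟩, ?_⟩
    · change res Φ Λ (lin D.b _) = _
      rw [map_sub, map_sub, map_smul, map_smul, res_lin_t, h, lin_basis, res_X_inr, smul_eq_C_mul]
    · change s (y i) = y i
      rw [hy]
      simp only [map_sub, map_mul, hst, algHom_C, algebraMap_eq]
      have h2 : s (X i) = X i - C (2 * D.wt α i / p) * t := by
        simp [hs, reflHom, hpdef, ht]
      rw [h2, mul_div_assoc, C_mul, show (C (2 : ℂ) : MvPolynomial Λ ℂ) = 2 from map_ofNat C 2]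
      ring
  have htA : t * t ∈ A := by
    refine ⟨⟨_, D.casimir_mem_pairInv α, ?_⟩, ?_⟩
    · change res Φ Λ _ = _
      simp [res_lin_t, res_lin_x, ht]
    · change s (t * t) = t * t
      rw [map_mul, hst]; ring
  have key : ∀ f, ∃ a ∈ A, ∃ c ∈ A, f = a + t * c := by
    intro f
    induction f using MvPolynomial.induction_on with
    | C k => exact ⟨C k, A.algebraMap_mem k, 0, A.zero_mem, by simp⟩
    | add f f' h h' =>
      obtain ⟨a, ha, c, hc, rfl⟩ := h
      obtain ⟨a', ha', c', hc', rfl⟩ := h'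
      exact ⟨_, A.add_mem ha ha', _, A.add_mem hc hc', by ring⟩
    | mul_X f i h =>
      obtain ⟨a, ha, c, hc, rfl⟩ := h
      have hk : ∀ k, C k ∈ A := A.algebraMap_mem
      refine ⟨_, A.add_mem (A.mul_mem ha (hyA i)) (A.mul_mem (hk (D.wt α i / p))
        (A.mul_mem htA hc)), _, A.add_mem (A.mul_mem (hk (D.wt α i / p)) ha)
        (A.mul_mem hc (hyA i)), ?_⟩
      simp only [hy]
      ring
  obtain ⟨a, ha, c, hc, rfl⟩ := key f
  have h1 : s a = a := ha.2
  have h2 : s c = c := hc.2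
  rw [map_add, map_mul, h1, h2, hst] at hf
  have h3 : (2 : ℂ) • (t * c) = 0 := by
    rw [two_smul]; linear_combination -hf
  have h4 : t * c = 0 := by simpa using h3
  obtain ⟨F, hF, hFa⟩ := ha.1
  exact ⟨F, hF, by rw [h4, add_zero]; exact hFa⟩

end RootData

lemma sub_aeval_mem {σ : Type} (y : σ → MvPolynomial σ ℂ) {I : Ideal (MvPolynomial σ ℂ)}
    (h : ∀ i, X i - y i ∈ I) (p : MvPolynomial σ ℂ) : p - aeval y p ∈ I := by
  have h1 : (Ideal.Quotient.mkₐ ℂ I).comp (aeval y) = Ideal.Quotient.mkₐ ℂ I := by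
    refine MvPolynomial.algHom_ext fun i => ?_
    rw [AlgHom.comp_apply, aeval_X]
    exact (Ideal.Quotient.eq.2 (h i)).symm
  exact Ideal.Quotient.eq.1 (DFunLike.congr_fun h1 p).symm

section LinForm

variable {Λ : Type} [Fintype Λ]

lemma linForm_eq_zero_iff {c : Λ → ℂ} : linForm c = 0 ↔ c = 0 := by
  classical
  refine ⟨fun h => funext fun i => ?_, fun h => by simp [linForm, h]⟩
  have := congrArg (aeval (Pi.single i (1 : ℂ))) h
  simpa [linForm, Pi.single_apply] using this

lemma exists_linForm_dvd_iff {c : Λ → ℂ} (hc : linForm c ≠ 0) :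
    ∃ φ : MvPolynomial Λ ℂ →ₐ[ℂ] MvPolynomial Λ ℂ, (∀ p, linForm c ∣ p ↔ φ p = 0) ∧
      ∀ c', ∃ k : ℂ, φ (linForm c') = linForm (c' - k • c) := by
  classical
  obtain ⟨i₀, h0⟩ : ∃ i, c i ≠ 0 := by
    by_contra! h
    exact hc (linForm_eq_zero_iff.2 (funext h))
  let y : Λ → MvPolynomial Λ ℂ := fun i => X i - C (if i = i₀ then (c i₀)⁻¹ else 0) * linForm c
  have hy : ∀ c', aeval y (linForm c') = linForm (c' - (c' i₀ * (c i₀)⁻¹) • c) := by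
    intro c'
    have h1 : aeval y (linForm c') = linForm c' - C (c' i₀ * (c i₀)⁻¹) * linForm c := by
      conv_lhs => rw [linForm]
      simp only [map_sum, map_mul, aeval_X, algHom_C, algebraMap_eq, y, mul_sub,
        Finset.sum_sub_distrib]
      congr 1
      rw [Finset.sum_eq_single i₀]
      · simp [mul_assoc]
      · intro i _ hi
        simp [hi]
      · simp
    rw [h1]
    simp only [linForm, Finset.mul_sum, ← Finset.sum_sub_distrib, Pi.sub_apply, Pi.smul_apply,
      smul_eq_mul, C_sub, C_mul, sub_mul, mul_assoc]
  refine ⟨aeval y, fun p => ⟨?_, fun h => ?_⟩, fun c' => ⟨_, hy c'⟩⟩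
  · rintro ⟨r, rfl⟩
    rw [map_mul, hy, mul_inv_cancel₀ h0, one_smul, sub_self, linForm_eq_zero_iff.2 rfl, zero_mul]
  · have := sub_aeval_mem y (I := Ideal.span {linForm c}) (fun i => ?_) p
    · rwa [h, sub_zero, Ideal.mem_span_singleton] at this
    · simp only [y, sub_sub_cancel]
      exact Ideal.mul_mem_left _ _ (Ideal.mem_span_singleton_self _)

lemma prime_linForm {c : Λ → ℂ} (hc : linForm c ≠ 0) : Prime (linForm c) := by
  obtain ⟨φ, hφ, -⟩ := exists_linForm_dvd_iff hc
  refine ⟨hc, fun h => ?_, fun a b h => ?_⟩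
  · have := (hφ 1).1 (h.dvd)
    rw [map_one] at this
    exact one_ne_zero this
  · rw [hφ, map_mul, mul_eq_zero] at h
    rwa [hφ, hφ]

lemma eq_smul_of_linForm_dvd {c c' : Λ → ℂ} (hc : linForm c ≠ 0) (h : linForm c ∣ linForm c') :
    ∃ k : ℂ, c' = k • c := by
  obtain ⟨φ, hφ, h1⟩ := exists_linForm_dvd_iff hc
  obtain ⟨k, hk⟩ := h1 c'
  refine ⟨k, sub_eq_zero.1 ?_⟩
  rw [← linForm_eq_zero_iff, ← hk, ← hφ]
  exact h

end LinForm

lemma sumAlgEquiv_rename_inr {Φ Λ : Type} (p : MvPolynomial Λ ℂ) :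
    sumAlgEquiv ℂ Φ Λ (rename Sum.inr p) = C p := by
  have : ((sumAlgEquiv ℂ Φ Λ).toAlgHom).comp (rename Sum.inr) =
      (IsScalarTower.toAlgHom ℂ (MvPolynomial Λ ℂ) (MvPolynomial Φ (MvPolynomial Λ ℂ))) := by
    refine MvPolynomial.algHom_ext fun i => ?_
    simp [algebraMap_eq]
  exact DFunLike.congr_fun this p

lemma toLoc_mem_iff {Φ Λ : Type} {K : ℕ} {x : MvPolynomial (Φ ⊕ Λ) ℂ} :
    toLoc x ∈ locIdeal Φ Λ ^ K ↔ x ∈ rootIdeal Φ Λ ^ K := algebraMap_mem_locIdeal_pow_iff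

lemma isUnit_toLoc {Φ Λ : Type} {x : MvPolynomial (Φ ⊕ Λ) ℂ} (hx : res Φ Λ x ≠ 0) :
    IsUnit (toLoc x) := isUnit_algebraMap_of_res_ne_zero hx

lemma locIdeal_eq_span {Φ Λ : Type} :
    locIdeal Φ Λ = Ideal.span (Set.range fun β : Φ => (toLoc (X (Sum.inl β)) : LocRing Φ Λ)) := by
  refine (Ideal.map_span _ _).trans ?_
  rw [← Set.range_comp]
  rfl

namespace RootData

variable {g Φ Λ : Type} [LieRing g] [LieAlgebra ℂ g] [Fintype Φ] [Fintype Λ]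
  (D : RootData g Φ Λ)

lemma mem_locIdeal_pow {G : LocRing Φ Λ} {K : ℕ} (hG : G ∈ locIdeal Φ Λ)
    (h : ∀ z, D.locAct z G ∈ locIdeal Φ Λ ^ K) : G ∈ locIdeal Φ Λ ^ K := by
  classical
  let v : Φ → LocRing Φ Λ := fun β => toLoc (X (Sum.inl β))
  let u : Φ → Derivation ℂ (LocRing Φ Λ) (LocRing Φ Λ) := fun β => D.locAct (D.x (D.neg β))
  let d : Φ → LocRing Φ Λ := fun β => toLoc (lin D.b (D.t (D.neg β)))
  have hd : ∀ β, IsUnit (d β) := fun β => isUnit_toLoc (by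
    rw [res_lin_t]
    exact D.linForm_cr_ne_zero _)
  let Y : Φ → Φ → LocRing Φ Λ := fun k i => if k = i then Ring.inverse (d i) else 0
  have hI : locIdeal Φ Λ = Ideal.span (Set.range v) := locIdeal_eq_span
  rw [hI] at hG h ⊢
  refine mem_pow_of_euler_mem v u Y 1 ?_ ?_ hG ?_
  · intro k' k
    have h1 : ∑ i, Y k' i * u i (v k) = Ring.inverse (d k') * u k' (v k) := by
      simp [Y]
    have h2 : u k' (v k) = toLoc (lin D.b ⁅D.x (D.neg k'), D.x k⁆) := by
      simp only [u, v, locAct_toLoc, act_X]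
      rfl
    rw [h1, h2]
    split_ifs with hk
    · subst hk
      have h3 := D.lie_x_x_neg (D.neg k')
      rw [D.neg_neg] at h3
      rw [h3, Ring.inverse_mul_cancel _ (hd k'), sub_self]
      exact zero_mem _
    · rw [sub_zero]
      refine Ideal.mul_mem_left _ _ ?_
      have hne : k ≠ D.neg (D.neg k') := by rw [D.neg_neg]; exact fun h => hk h.symm
      rcases D.lie_xx _ _ hne with h0 | ⟨γ, c, h0, -⟩
      · rw [x, x, h0, map_zero, map_zero]
        exact zero_mem _
      · rw [x, x, h0, map_smul, lin_basis, toLoc_smul]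
        exact Submodule.smul_of_tower_mem _ _ (mem_sliceIdeal v γ)
  · intro k x hx
    rwa [one_mul] at hx
  · rw [euler_apply]
    exact Submodule.sum_mem _ fun i _ => Ideal.mul_mem_left _ _ (h _)

/-- Polynomials fixed by all reflections extend to invariants of arbitrarily high order along the
Cartan subalgebra. -/
lemma exists_approx_extension (f : MvPolynomial Λ ℂ)
    (hf : ∀ α, reflHom (D.cr α) (D.wt α) f = f) (K : ℕ) :
    ∃ F, res Φ Λ F = f ∧ ∀ z, act D.b z F ∈ rootIdeal Φ Λ ^ K := by
  classical
  set I := rootIdeal Φ Λ with hI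
  set J := locIdeal Φ Λ with hJ
  set φ : MvPolynomial (Φ ⊕ Λ) ℂ := rename Sum.inr f with hφ
  obtain ⟨F₀, ⟨m, a, hma⟩, hF₀, hF₀'⟩ := D.exists_levi_extension ∅ D.isLevi_empty φ (by
    intro i
    rw [derivation_eq_sum]
    refine Finset.sum_eq_zero fun j _ => ?_
    rw [act_X]
    obtain α | j := j
    · rw [hφ, pderiv_eq_zero_of_notMem_vars, mul_zero]
      intro h
      have := vars_rename Sum.inr f h
      simp at this
    · rw [h, D.lie_hh, map_zero, zero_mul]) (by simp) (K + 1)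
  set δ := D.leviDet ∅ with hδ
  have hFα : ∀ α, ∃ (F : LocRing Φ Λ) (m : ℕ) (p : MvPolynomial (Φ ⊕ Λ) ℂ),
      toLoc (D.leviDet {α, D.neg α}) ^ m * F = toLoc p ∧ F - F₀ ∈ J ^ (K + 1) := by
    intro α
    obtain ⟨f', ⟨h1, h2, h3⟩, hf'⟩ := D.exists_pair_extension α f (hf α)
    obtain ⟨F, ⟨m, p, hp⟩, hF, hF'⟩ := D.exists_levi_extension _ (D.isLevi_pair α) f' h1
      (by simp [h2, h3]) (K + 1)
    refine ⟨F, m, p, hp, D.mem_locIdeal_pow ?_ fun z => ?_⟩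
    · have h4 : toLoc (f' - φ) ∈ J := by
        rw [← pow_one J, toLoc_mem_iff, pow_one, mem_rootIdeal_iff, map_sub, hf', hφ, res_rename,
          sub_self]
      rw [map_sub] at h4
      have := sub_mem (add_mem hF h4) hF₀
      convert this using 1
      ring
    · rw [map_sub]
      exact sub_mem (hF' z) (hF₀' z)
  set πB := res Φ Λ δ with hπB
  set π : MvPolynomial (Φ ⊕ Λ) ℂ := rename Sum.inr πB with hπ
  have hπδ : π - δ ∈ I := by
    rw [hI, mem_rootIdeal_iff, map_sub, hπ, res_rename, sub_self]
  obtain ⟨θ, hθ⟩ : δ ∣ π ^ (K + 1) - (π - δ) ^ (K + 1) := by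
    have := sub_dvd_pow_sub_pow π (π - δ) (K + 1)
    rwa [sub_sub_cancel] at this
  set M := (K + 1) * m with hM
  have h1 : (δ * θ) ^ m - π ^ M ∈ I ^ (K + 1) := by
    rw [hM, pow_mul]
    refine Ideal.mem_of_dvd _ (sub_dvd_pow_sub_pow _ _ _) ?_
    rw [← hθ, sub_sub_cancel_left]
    exact neg_mem (Ideal.pow_mem_pow hπδ _)
  have h2 : toLoc (θ ^ m * a) - toLoc (π ^ M) * F₀ ∈ J ^ (K + 1) := by
    have : toLoc (θ ^ m * a) - toLoc (π ^ M) * F₀ = toLoc ((δ * θ) ^ m - π ^ M) * F₀ := by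
      rw [map_mul, ← hma, map_sub, mul_pow, map_mul, map_pow toLoc δ]
      ring
    rw [this]
    exact Ideal.mul_mem_right _ _ (toLoc_mem_iff.2 h1)
  set Ψ := sumAlgEquiv ℂ Φ Λ
  have hπΨ : ∀ b s, coeff s (Ψ (π ^ M * b)) = πB ^ M * coeff s (Ψ b) := by
    intro b s
    rw [map_mul, map_pow, hπ, sumAlgEquiv_rename_inr, ← C_pow, coeff_C_mul]
  let l : List (MvPolynomial Λ ℂ) := (List.replicate M
    ((Finset.univ : Finset {β : Φ // β ∉ (∅ : Finset Φ)}).toList.map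
      fun β : {β : Φ // β ∉ (∅ : Finset Φ)} => linForm (D.cr (D.neg β)))).flatten
  have hl : l.prod = πB ^ M := by
    rw [hπB, hδ, res_leviDet, List.prod_flatten, List.map_replicate, List.prod_replicate,
      Finset.prod_map_toList]
  have hlmem : ∀ c ∈ l, ∃ β, c = linForm (D.cr (D.neg β)) := by
    intro c hc
    simp only [l, List.mem_flatten, List.mem_replicate] at hc
    obtain ⟨l', ⟨-, rfl⟩, hc⟩ := hc
    obtain ⟨β, -, rfl⟩ := List.mem_map.1 hc
    exact ⟨β, rfl⟩
  have hcoeff : ∀ s : Φ →₀ ℕ, s.degree < K + 1 → l.prod ∣ coeff s (Ψ (θ ^ m * a)) := by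
    refine prod_dvd_coeff l ?_ _ ?_
    · intro c hc
      obtain ⟨β, rfl⟩ := hlmem c hc
      exact prime_linForm (D.linForm_cr_ne_zero _)
    · intro c hc
      obtain ⟨β, rfl⟩ := hlmem c hc
      obtain ⟨F, k, p, hp, hF⟩ := hFα β
      refine ⟨Ψ (D.leviDet {β, D.neg β} ^ k), ?_, ?_⟩
      · rw [constantCoeff_sumAlgEquiv, map_pow, res_leviDet]
        intro hdvd
        have hpr := prime_linForm (D.linForm_cr_ne_zero (D.neg β))
        obtain ⟨γ, -, hγ⟩ := (hpr.dvd_finsetProd_iff _).1 (hpr.dvd_of_dvd_pow hdvd)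
        obtain ⟨r, hr⟩ := eq_smul_of_linForm_dvd (D.linForm_cr_ne_zero (D.neg β)) hγ
        have hγ' := γ.2
        simp only [Finset.mem_insert, Finset.mem_singleton, not_or] at hγ'
        refine D.cr_indep (D.neg β) (D.neg γ) ?_ ?_ r hr
        · intro h
          apply hγ'.1
          rw [← D.neg_neg γ, h, D.neg_neg]
        · intro h
          rw [D.neg_neg] at h
          apply hγ'.2
          exact (D.neg_neg _).symm.trans (congrArg D.neg h)
      · have h3 : D.leviDet {β, D.neg β} ^ k * (θ ^ m * a) - π ^ M * p ∈ I ^ (K + 1) := by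
          rw [hI, ← toLoc_mem_iff]
          have h4 := add_mem (Ideal.mul_mem_left _ (toLoc (D.leviDet {β, D.neg β} ^ k)) h2)
            (Ideal.mul_mem_left _ (-toLoc (D.leviDet {β, D.neg β} ^ k) * toLoc (π ^ M)) hF)
          convert h4 using 1
          rw [map_sub, map_mul toLoc (π ^ M), ← hp, map_mul toLoc, map_pow toLoc]
          ring
        intro s hs
        have h5 := mem_rootIdeal_pow_iff.1 h3 s hs
        rw [map_sub, coeff_sub, hπΨ, sub_eq_zero, map_mul] at h5
        rw [h5, hl]
        exact dvd_mul_right _ _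
  obtain ⟨a', ha'⟩ := exists_coeff_eq_mul hcoeff
  have h3 : θ ^ m * a - π ^ M * Ψ.symm a' ∈ I ^ (K + 1) := by
    rw [hI, mem_rootIdeal_pow_iff]
    intro s hs
    rw [map_sub, coeff_sub, hπΨ, ← hl, AlgEquiv.apply_symm_apply, ha' s hs, sub_self]
  have hu : IsUnit (toLoc (π ^ M)) := by
    refine isUnit_toLoc ?_
    rw [map_pow, hπ, res_rename]
    exact pow_ne_zero _ (D.res_leviDet_ne_zero ∅)
  have h4 : toLoc (Ψ.symm a') - F₀ ∈ J ^ (K + 1) := by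
    have h5 := sub_mem h2 (toLoc_mem_iff.2 h3)
    rw [map_sub, map_mul toLoc (π ^ M)] at h5
    rw [← Ideal.unit_mul_mem_iff_mem _ hu]
    convert h5 using 1
    ring
  refine ⟨Ψ.symm a', ?_, fun z => ?_⟩
  · have h5 := add_mem (Ideal.pow_le_self (Nat.succ_ne_zero K) h4) hF₀
    rw [sub_add_sub_cancel, ← map_sub, ← pow_one J, toLoc_mem_iff, pow_one,
      mem_rootIdeal_iff, map_sub, hφ, res_rename, sub_eq_zero] at h5
    exact h5
  · have h5 := derivation_mem_pow (D.locAct z) J h4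
    rw [map_sub] at h5
    have h6 := add_mem h5 (Ideal.pow_le_pow_right (Nat.le_succ K) (hF₀' z))
    rwa [sub_add_cancel, locAct_toLoc, toLoc_mem_iff] at h6

lemma act_isHomogeneous (z : g) {n : ℕ} {p : MvPolynomial (Φ ⊕ Λ) ℂ} (hp : p.IsHomogeneous n) :
    (act D.b z p).IsHomogeneous n := by
  rw [derivation_eq_sum]
  refine IsHomogeneous.sum _ _ _ fun j _ => ?_
  have hl : (act D.b z (X j)).IsHomogeneous 1 := by
    rw [act_X, lin_eq_sum]
    exact IsHomogeneous.sum _ _ _ fun j _ => isHomogeneous_C_mul_X _ _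
  obtain _ | k := n
  · have : pderiv j p = 0 := by
      rw [totalDegree_eq_zero_iff_eq_C.1 (Nat.le_zero.1 hp.totalDegree_le), pderiv_C]
    rw [this, mul_zero]
    exact isHomogeneous_zero _ _ _
  · rw [add_comm k 1]
    exact hl.mul (hp.pderiv (i := j))

omit [Fintype Φ] [Fintype Λ] in
lemma res_isHomogeneous {n : ℕ} {p : MvPolynomial (Φ ⊕ Λ) ℂ} (hp : p.IsHomogeneous n) :
    (res Φ Λ p).IsHomogeneous n := by
  rw [← one_mul n]
  refine hp.aeval (R := ℂ) _ fun j => ?_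
  obtain α | i := j
  · exact isHomogeneous_zero _ _ _
  · exact isHomogeneous_X _ _

omit [Fintype Φ] [Fintype Λ] in
lemma rootIdeal_le_idealOfVars : rootIdeal Φ Λ ≤ idealOfVars (Φ ⊕ Λ) ℂ := by
  rw [rootIdeal, Ideal.span_le]
  rintro _ ⟨α, rfl⟩
  exact Ideal.subset_span ⟨_, rfl⟩

/-- The Chevalley restriction theorem, extension part. -/
theorem exists_invariant_extension {d : ℕ} (f : MvPolynomial Λ ℂ) (hfd : f.IsHomogeneous d)
    (hf : ∀ α, reflHom (D.cr α) (D.wt α) f = f) :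
    ∃ F, F.IsHomogeneous d ∧ res Φ Λ F = f ∧ ∀ z, act D.b z F = 0 := by
  obtain ⟨F, hF, hF'⟩ := D.exists_approx_extension f hf (d + 1)
  refine ⟨homogeneousComponent d F, homogeneousComponent_isHomogeneous _ _, ?_, fun z => ?_⟩
  · have := map_weightedHomogeneousComponent 1 1 (res Φ Λ).toLinearMap id Function.injective_id
      (fun n p hp => res_isHomogeneous hp) d F
    refine this.trans ?_
    rw [AlgHom.toLinearMap_apply, hF]
    exact homogeneousComponent_eq_self hfd
  · have := map_weightedHomogeneousComponent 1 1 (act D.b z).toLinearMap id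
      Function.injective_id (fun n p hp => D.act_isHomogeneous z hp) d F
    refine this.trans ?_
    have h := Ideal.pow_right_mono rootIdeal_le_idealOfVars _ (hF' z)
    rw [mem_pow_idealOfVars_iff'] at h
    change homogeneousComponent d (act D.b z F) = 0
    ext s
    rw [coeff_homogeneousComponent, coeff_zero]
    split_ifs with hs
    · exact h s (by omega)
    · rfl

end RootData

lemma derivation_isWeightedHomogeneous {σ : Type} [Fintype σ] {w : σ → ℤ} {k : ℤ}
    {D : Derivation ℂ (MvPolynomial σ ℂ) (MvPolynomial σ ℂ)}
    (h : ∀ i, IsWeightedHomogeneous w (D (X i)) (w i + k))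
    {n : ℤ} {p : MvPolynomial σ ℂ} (hp : IsWeightedHomogeneous w p n) :
    IsWeightedHomogeneous w (D p) (n + k) := by
  rw [derivation_eq_sum]
  refine Submodule.sum_mem (weightedHomogeneousSubmodule ℂ w (n + k)) fun i _ => ?_
  rw [mem_weightedHomogeneousSubmodule]
  have h1 : IsWeightedHomogeneous w (pderiv i p) (n - w i) := hp.pderiv (by ring)
  convert (h i).mul h1 using 1
  ring

lemma det_eq_of_blockTriangular {ι A : Type} [Fintype ι] [DecidableEq ι] [CommRing A]
    (M Ω : Matrix ι ι A) (b : ι → ℤ) (hM : ∀ i j, b j < b i → M i j = 0)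
    (hMΩ : ∀ i j, b i = b j → M i j = Ω i j) (hΩ : ∀ i j, b i ≠ b j → Ω i j = 0) :
    M.det = Ω.det := by
  rw [Matrix.BlockTriangular.det (b := b) (fun i j h => hM i j h),
    Matrix.BlockTriangular.det (M := Ω) (b := b) (fun i j h => hΩ i j (ne_of_gt h))]
  refine Finset.prod_congr rfl fun k _ => ?_
  congr 1
  ext i j
  exact hMΩ _ _ (i.2.trans j.2.symm)

namespace RootData

variable {g Φ Λ : Type} [LieRing g] [LieAlgebra ℂ g] [Fintype Φ] [Fintype Λ]
  (D : RootData g Φ Λ)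

/-- The height of a basis vector. -/
def hgt : Φ ⊕ Λ → ℤ := Sum.elim D.ht 0

@[simp] lemma hgt_inl (α : Φ) : D.hgt (Sum.inl α) = D.ht α := rfl

@[simp] lemma hgt_inr (i : Λ) : D.hgt (Sum.inr i) = 0 := rfl

/-- The principal grading. -/
def gr (n : ℤ) : Submodule ℂ g := Submodule.span ℂ {y | ∃ j, D.hgt j = n ∧ y = D.b j}

lemma basis_mem_gr (j : Φ ⊕ Λ) : D.b j ∈ D.gr (D.hgt j) := Submodule.subset_span ⟨j, rfl, rfl⟩

lemma x_mem_gr (α : Φ) : D.x α ∈ D.gr (D.ht α) := D.basis_mem_gr (Sum.inl α)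

lemma t_mem_gr (α : Φ) : D.t α ∈ D.gr 0 :=
  Submodule.sum_mem _ fun i _ => Submodule.smul_mem _ _ (D.basis_mem_gr (Sum.inr i))

lemma lie_basis_mem_gr (i j : Φ ⊕ Λ) : ⁅D.b i, D.b j⁆ ∈ D.gr (D.hgt i + D.hgt j) := by
  rcases i with α | i <;> rcases j with β | j
  · by_cases h : β = D.neg α
    · subst h
      rw [hgt_inl, hgt_inl, D.ht_neg, add_neg_cancel]
      have := D.lie_x_x_neg α
      rw [x, x] at this
      rw [this]
      exact D.t_mem_gr α
    · rcases D.lie_xx α β h with h0 | ⟨γ, c, h0, -, h1⟩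
      · rw [h0]
        exact zero_mem _
      · rw [h0, hgt_inl, hgt_inl, ← h1]
        exact Submodule.smul_mem _ _ (D.x_mem_gr γ)
  · rw [← lie_skew, D.lie_hx]
    refine neg_mem (Submodule.smul_mem _ _ ?_)
    have := D.basis_mem_gr (Sum.inl α)
    simpa using this
  · rw [D.lie_hx]
    refine Submodule.smul_mem _ _ ?_
    have := D.basis_mem_gr (Sum.inl β)
    simpa using this
  · rw [D.lie_hh]
    exact zero_mem _

lemma lie_mem_gr {m n : ℤ} {y z : g} (hy : y ∈ D.gr m) (hz : z ∈ D.gr n) :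
    ⁅y, z⁆ ∈ D.gr (m + n) := by
  refine Submodule.span_induction (p := fun y _ => ⁅y, z⁆ ∈ D.gr (m + n)) ?_ (by simp) ?_ ?_ hy
  · rintro _ ⟨i, rfl, rfl⟩
    refine Submodule.span_induction (p := fun z _ => ⁅D.b i, z⁆ ∈ D.gr (D.hgt i + n))
      ?_ (by simp) ?_ ?_ hz
    · rintro _ ⟨j, rfl, rfl⟩
      exact D.lie_basis_mem_gr i j
    · intro a c _ _ ha hc
      rw [lie_add]
      exact add_mem ha hc
    · intro r a _ ha
      rw [lie_smul]
      exact Submodule.smul_mem _ _ ha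
  · intro a c _ _ ha hc
    rw [add_lie]
    exact add_mem ha hc
  · intro r a _ ha
    rw [smul_lie]
    exact Submodule.smul_mem _ _ ha

lemma χ_eq_zero {n : ℤ} (hn : n ≠ -1) {y : g} (hy : y ∈ D.gr n) : D.χ y = 0 := by
  refine Submodule.span_induction (p := fun y _ => D.χ y = 0) ?_ (by simp) ?_ ?_ hy
  · rintro _ ⟨j, rfl, rfl⟩
    rcases j with α | i
    · by_contra h
      exact hn ((D.χ_inl α).1 h)
    · exact D.χ_inr i
  · intro a c _ _ ha hc
    rw [map_add, ha, hc, add_zero]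
  · intro r a _ ha
    rw [map_smul, ha, smul_zero]

/-- The positive roots. -/
abbrev Pos : Type := {α : Φ // 0 < D.ht α}

/-- The inclusion of the indices of a basis of the positive Borel subalgebra. -/
def posIncl : D.Pos ⊕ Λ → Φ ⊕ Λ := Sum.map Subtype.val id

@[simp] lemma posIncl_inl (α : D.Pos) : D.posIncl (Sum.inl α) = Sum.inl α.1 := rfl

@[simp] lemma posIncl_inr (i : Λ) : D.posIncl (Sum.inr i) = Sum.inr i := rfl

lemma hgt_posIncl_nonneg (j : D.Pos ⊕ Λ) : 0 ≤ D.hgt (D.posIncl j) := by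
  rcases j with α | i
  · exact α.2.le
  · exact le_rfl

open Classical in
/-- Restriction of polynomial functions to the shifted Borel subspace. -/
def cut : MvPolynomial (Φ ⊕ Λ) ℂ →ₐ[ℂ] MvPolynomial (D.Pos ⊕ Λ) ℂ :=
  aeval (Sum.elim (fun α => if h : 0 < D.ht α then X (Sum.inl ⟨α, h⟩) else C (D.χ (D.x α)))
    fun i => X (Sum.inr i))

@[simp] lemma cut_X_posIncl (j : D.Pos ⊕ Λ) : D.cut (X (D.posIncl j)) = X j := by
  rcases j with α | i
  · simp [cut, α.2]
  · simp [cut]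

lemma cut_X_of_neg {α : Φ} (h : D.ht α < 0) : D.cut (X (Sum.inl α)) = C (D.χ (D.x α)) := by
  simp [cut, h.not_gt]

lemma exists_posIncl_or (j : Φ ⊕ Λ) :
    (∃ j', j = D.posIncl j') ∨ ∃ α, D.ht α < 0 ∧ j = Sum.inl α := by
  rcases j with α | i
  · rcases lt_or_gt_of_ne (D.ht_ne_zero α) with h | h
    · exact Or.inr ⟨α, h, rfl⟩
    · exact Or.inl ⟨Sum.inl ⟨α, h⟩, rfl⟩
  · exact Or.inl ⟨Sum.inr i, rfl⟩

lemma cut_lin_of_neg {n : ℤ} (hn : n < 0) {y : g} (hy : y ∈ D.gr n) :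
    D.cut (lin D.b y) = C (D.χ y) := by
  refine Submodule.span_induction (p := fun y _ => D.cut (lin D.b y) = C (D.χ y))
    ?_ (by simp) ?_ ?_ hy
  · rintro _ ⟨j, rfl, rfl⟩
    rw [lin_basis]
    rcases j with α | i
    · exact D.cut_X_of_neg hn
    · exact absurd hn (lt_irrefl 0)
  · intro a c _ _ ha hc
    simp only [map_add, ha, hc]
  · intro r a _ ha
    rw [map_smul, map_smul, ha, map_smul, smul_eq_C_mul, smul_eq_mul, C_mul]

/-- The weights of the Kazhdan grading. -/
def kwt (j : D.Pos ⊕ Λ) : ℤ := D.hgt (D.posIncl j) + 1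

lemma kwt_pos (j : D.Pos ⊕ Λ) : 0 < D.kwt j := by
  have := D.hgt_posIncl_nonneg j
  rw [kwt]; omega

lemma cut_lin_isWeightedHomogeneous {n : ℤ} {y : g} (hy : y ∈ D.gr n) :
    IsWeightedHomogeneous D.kwt (D.cut (lin D.b y)) (n + 1) := by
  refine Submodule.span_induction (p := fun y _ => D.cut (lin D.b y) ∈
    weightedHomogeneousSubmodule ℂ D.kwt (n + 1)) ?_ (by simp) ?_ ?_ hy
  · rintro _ ⟨j, rfl, rfl⟩
    rw [lin_basis, mem_weightedHomogeneousSubmodule]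
    rcases D.exists_posIncl_or j with ⟨j, rfl⟩ | ⟨α, h, rfl⟩
    · rw [cut_X_posIncl]
      exact isWeightedHomogeneous_X _ _ _
    · rw [D.cut_X_of_neg h]
      by_cases h1 : D.ht α = -1
      · rw [hgt_inl, h1, neg_add_cancel]
        exact isWeightedHomogeneous_C _ _
      · rw [D.χ_eq_zero h1 (D.x_mem_gr α), C_0]
        exact isWeightedHomogeneous_zero _ _ _
  · intro a c _ _ ha hc
    rw [map_add, map_add]
    exact add_mem ha hc
  · intro r a _ ha
    rw [map_smul, map_smul]
    exact Submodule.smul_mem _ _ ha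

/-- The action of the negative nilpotent subalgebra on functions on the shifted Borel subspace. -/
def cutAct : g →ₗ[ℂ] Derivation ℂ (MvPolynomial (D.Pos ⊕ Λ) ℂ) (MvPolynomial (D.Pos ⊕ Λ) ℂ) where
  toFun u := mkDerivation ℂ fun j => D.cut (lin D.b ⁅u, D.b (D.posIncl j)⁆)
  map_add' u v := MvPolynomial.derivation_ext fun j => by simp
  map_smul' c u := MvPolynomial.derivation_ext fun j => by simp

lemma cutAct_X (u : g) (j : D.Pos ⊕ Λ) :
    D.cutAct u (X j) = D.cut (lin D.b ⁅u, D.b (D.posIncl j)⁆) := mkDerivation_X _ _ _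

/-- The negative nilpotent subalgebra. -/
def nilNeg : Submodule ℂ g := Submodule.span ℂ {y | ∃ α, D.ht α < 0 ∧ y = D.b (Sum.inl α)}

lemma x_neg_mem_nilNeg (α : D.Pos) : D.x (D.neg α) ∈ D.nilNeg :=
  Submodule.subset_span ⟨D.neg α, by rw [D.ht_neg]; exact neg_neg_of_pos α.2, rfl⟩

lemma cut_act {u : g} (hu : u ∈ D.nilNeg) (p : MvPolynomial (Φ ⊕ Λ) ℂ) :
    D.cut (act D.b u p) = D.cutAct u (D.cut p) := by
  induction p using MvPolynomial.induction_on with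
  | C c => simp
  | add p q hp hq => simp [hp, hq]
  | mul_X p j hp =>
    have h : D.cut (act D.b u (X j)) = D.cutAct u (D.cut (X j)) := by
      rw [act_X]
      rcases D.exists_posIncl_or j with ⟨j, rfl⟩ | ⟨β, hβ, rfl⟩
      · rw [cut_X_posIncl, cutAct_X]
      · rw [D.cut_X_of_neg hβ, derivation_C]
        refine Submodule.span_induction (p := fun u _ => D.cut (lin D.b ⁅u, D.b (Sum.inl β)⁆) = 0)
          ?_ (by simp) ?_ ?_ hu
        · rintro _ ⟨α, hα, rfl⟩
          have h1 := D.lie_basis_mem_gr (Sum.inl α) (Sum.inl β)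
          rw [hgt_inl, hgt_inl] at h1
          rw [D.cut_lin_of_neg (by omega) h1, D.χ_eq_zero (by omega) h1, C_0]
        · intro a c _ _ ha hc
          simp only [add_lie, map_add, ha, hc, add_zero]
        · intro r a _ ha
          simp only [smul_lie, map_smul, ha, smul_zero]
    simp only [Derivation.leibniz, smul_eq_mul, map_add, map_mul, hp, h]

lemma cut_surjective : Function.Surjective D.cut := by
  intro p
  refine ⟨rename D.posIncl p, ?_⟩
  have : D.cut.comp (rename D.posIncl) = AlgHom.id ℂ _ :=
    MvPolynomial.algHom_ext fun j => by simp
  exact DFunLike.congr_fun this p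

lemma lie_mem_nilNeg {u v : g} (hu : u ∈ D.nilNeg) (hv : v ∈ D.nilNeg) : ⁅u, v⁆ ∈ D.nilNeg := by
  refine Submodule.span_induction (p := fun u _ => ⁅u, v⁆ ∈ D.nilNeg) ?_ (by simp) ?_ ?_ hu
  · rintro _ ⟨α, hα, rfl⟩
    refine Submodule.span_induction (p := fun v _ => ⁅D.b (Sum.inl α), v⁆ ∈ D.nilNeg)
      ?_ (by simp) ?_ ?_ hv
    · rintro _ ⟨β, hβ, rfl⟩
      have hne : β ≠ D.neg α := by
        rintro rfl
        rw [D.ht_neg] at hβ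
        omega
      rcases D.lie_xx α β hne with h0 | ⟨γ, c, h0, -, h1⟩
      · rw [h0]
        exact zero_mem _
      · rw [h0]
        exact Submodule.smul_mem _ _ (Submodule.subset_span ⟨γ, by omega, rfl⟩)
    · intro a c _ _ ha hc
      rw [lie_add]
      exact add_mem ha hc
    · intro r a _ ha
      rw [lie_smul]
      exact Submodule.smul_mem _ _ ha
  · intro a c _ _ ha hc
    rw [add_lie]
    exact add_mem ha hc
  · intro r a _ ha
    rw [smul_lie]
    exact Submodule.smul_mem _ _ ha

lemma cutAct_lie {u v : g} (hu : u ∈ D.nilNeg) (hv : v ∈ D.nilNeg) :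
    D.cutAct ⁅u, v⁆ = ⁅D.cutAct u, D.cutAct v⁆ := by
  refine Derivation.ext fun p => ?_
  obtain ⟨p, rfl⟩ := D.cut_surjective p
  rw [← D.cut_act (D.lie_mem_nilNeg hu hv), LieHom.map_lie, Derivation.commutator_apply,
    Derivation.commutator_apply, map_sub, D.cut_act hu, D.cut_act hv, D.cut_act hv, D.cut_act hu]

end RootData

namespace RootData

variable {g Φ Λ : Type} [LieRing g] [LieAlgebra ℂ g] [Fintype Φ] [Fintype Λ]
  (D : RootData g Φ Λ)

/-- The pairing of the negative nilpotent subalgebra with the Borel subalgebra given by `χ`. -/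
def omega (α : D.Pos) (j : D.Pos ⊕ Λ) : ℂ := D.χ ⁅D.x (D.neg α), D.b (D.posIncl j)⁆

lemma hgt_of_omega_ne_zero {α : D.Pos} {j : D.Pos ⊕ Λ} (h : D.omega α j ≠ 0) :
    D.hgt (D.posIncl j) = D.ht α - 1 := by
  by_contra hne
  refine h (D.χ_eq_zero ?_ (D.lie_mem_gr (D.x_mem_gr (D.neg α)) (D.basis_mem_gr _)))
  rw [D.ht_neg]
  omega

lemma neg_injective : Function.Injective D.neg := fun α β h => by
  rw [← D.neg_neg α, h, D.neg_neg]

lemma span_omega : Submodule.span ℂ (Set.range fun j α => D.omega α j) = ⊤ := by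
  classical
  by_contra hlt
  obtain ⟨f, hf0, hf⟩ := Submodule.exists_le_ker_of_lt_top _ (lt_top_iff_ne_top.2 hlt)
  apply hf0
  have hfe : ∀ w, f w = ∑ α, w α * f (Pi.single α 1) := by
    intro w
    conv_lhs => rw [← Finset.univ_sum_single w]
    rw [map_sum]
    refine Finset.sum_congr rfl fun α _ => ?_
    rw [← smul_eq_mul, ← map_smul, ← Pi.single_smul, smul_eq_mul, mul_one]
  set c : D.Pos → ℂ := fun α => f (Pi.single α 1) with hc
  have hχ : ∀ j, D.χ ⁅∑ α, c α • D.x (D.neg α), D.b (D.posIncl j)⁆ = 0 := by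
    intro j
    have h1 : (fun α => D.omega α j) ∈ LinearMap.ker f := hf (Submodule.subset_span ⟨j, rfl⟩)
    rw [LinearMap.mem_ker, hfe] at h1
    rw [sum_lie, map_sum, ← h1]
    refine Finset.sum_congr rfl fun α _ => ?_
    rw [smul_lie, map_smul, smul_eq_mul, mul_comm]
    rfl
  have hu := D.χ_nondeg (∑ α, c α • D.x (D.neg α))
    (Submodule.sum_mem _ fun α _ => Submodule.smul_mem _ _ (D.x_neg_mem_nilNeg α))
    (fun i => hχ (Sum.inr i)) (fun α hα => hχ (Sum.inl ⟨α, hα⟩))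
  have hinj : Function.Injective fun α : D.Pos => (Sum.inl (D.neg α) : Φ ⊕ Λ) :=
    fun α β h => Subtype.ext (D.neg_injective (Sum.inl_injective h))
  have hli := Fintype.linearIndependent_iff.1 (D.b.linearIndependent.comp _ hinj) c hu
  refine LinearMap.ext fun w => ?_
  rw [hfe, LinearMap.zero_apply]
  refine Finset.sum_eq_zero fun α _ => ?_
  rw [show f (Pi.single α 1) = 0 from hli α, mul_zero]

lemma exists_transversal [DecidableEq Φ] : ∃ a : D.Pos → D.Pos ⊕ Λ, Function.Injective a ∧
    (∀ α, D.hgt (D.posIncl (a α)) = D.ht α - 1) ∧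
    (Matrix.of fun α β => D.omega α (a β)).det ≠ 0 := by
  obtain ⟨κ, a, ha, hspan, hli⟩ := exists_linearIndependent' ℂ (fun j α => D.omega α j)
  rw [span_omega] at hspan
  let e := (Pi.basisFun ℂ D.Pos).indexEquiv (Module.Basis.mk hli hspan.ge)
  have hdet : (Matrix.of fun α β => D.omega α (a (e β))).det ≠ 0 := by
    rw [← isUnit_iff_ne_zero, ← Matrix.isUnit_iff_isUnit_det,
      ← Matrix.linearIndependent_cols_iff_isUnit]
    exact hli.comp e e.injective
  obtain ⟨σ, -, hσ⟩ := Finset.exists_ne_zero_of_sum_ne_zero (by rwa [Matrix.det_apply] at hdet)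
  have hσ' : ∀ α, D.omega (σ α) (a (e α)) ≠ 0 := by
    have h1 : ∏ i, (Matrix.of fun α β => D.omega α (a (e β))) (σ i) i ≠ 0 := by
      intro h
      rw [h, smul_zero] at hσ
      exact hσ rfl
    exact fun α => Finset.prod_ne_zero_iff.1 h1 α (Finset.mem_univ _)
  refine ⟨fun α => a (e (σ.symm α)), ha.comp (e.injective.comp σ.symm.injective), fun α => ?_, ?_⟩
  · have := D.hgt_of_omega_ne_zero (hσ' (σ.symm α))
    rwa [σ.apply_symm_apply] at this
  · have h1 : (Matrix.of fun α β => D.omega α (a (e (σ.symm β)))) =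
      (Matrix.of fun α β => D.omega α (a (e β))).submatrix id σ.symm := rfl
    rw [h1, Matrix.det_permute']
    refine mul_ne_zero ?_ hdet
    exact_mod_cast (Equiv.Perm.sign σ.symm).ne_zero

end RootData

lemma algHom_isWeightedHomogeneous {σ τ : Type} {w : σ → ℤ} {w' : τ → ℤ}
    (φ : MvPolynomial σ ℂ →ₐ[ℂ] MvPolynomial τ ℂ)
    (h : ∀ j, IsWeightedHomogeneous w' (φ (X j)) (w j)) {n : ℤ} {p : MvPolynomial σ ℂ}
    (hp : IsWeightedHomogeneous w p n) : IsWeightedHomogeneous w' (φ p) n := by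
  rw [p.as_sum, map_sum]
  refine IsWeightedHomogeneous.sum _ _ _ fun s hs => ?_
  rw [monomial_eq, map_mul, Finsupp.prod, map_prod]
  have h2 := hp (mem_support_iff.1 hs)
  rw [← zero_add n, ← h2, Finsupp.weight_apply, Finsupp.sum]
  refine IsWeightedHomogeneous.mul ?_ (IsWeightedHomogeneous.prod _ _ _ fun j _ => ?_)
  · rw [← algebraMap_eq, AlgHom.commutes]
    exact isWeightedHomogeneous_C _ _
  · rw [map_pow]
    exact (h j).pow _

namespace RootData

variable {g Φ Λ : Type} [LieRing g] [LieAlgebra ℂ g] [Fintype Φ] [Fintype Λ]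
  (D : RootData g Φ Λ)

open Classical in
/-- Coordinates transverse to a Kostant slice. -/
structure Transversal where
  a : D.Pos → D.Pos ⊕ Λ
  inj : Function.Injective a
  hgt_a : ∀ α, D.hgt (D.posIncl (a α)) = D.ht α - 1
  det_ne_zero : (Matrix.of fun α β => D.omega α (a β)).det ≠ 0

lemma nonempty_transversal : Nonempty D.Transversal := by
  classical
  obtain ⟨a, h1, h2, h3⟩ := D.exists_transversal
  exact ⟨⟨a, h1, h2, by convert h3⟩⟩

namespace Transversal

variable {D} (A : D.Transversal)

/-- The coordinates on the Kostant slice. -/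
abbrev Z : Type := {j : D.Pos ⊕ Λ // j ∉ Set.range A.a}

open Classical in
/-- Restriction to the Kostant slice. -/
def sliceRes : MvPolynomial (D.Pos ⊕ Λ) ℂ →ₐ[ℂ] MvPolynomial A.Z ℂ :=
  aeval fun j => if h : j ∈ Set.range A.a then 0 else X ⟨j, h⟩

lemma sliceRes_X_a (α : D.Pos) : A.sliceRes (X (A.a α)) = 0 := by simp [sliceRes]

lemma sliceRes_X (i : A.Z) : A.sliceRes (X i.1) = X i := by
  have := i.2
  simp only [sliceRes, aeval_X, this, dif_neg, not_false_iff]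

/-- The ideal of the Kostant slice. -/
def sliceIdeal : Ideal (MvPolynomial (D.Pos ⊕ Λ) ℂ) :=
  Ideal.span (Set.range fun α => X (A.a α))

lemma sliceRes_eq_zero {x : MvPolynomial (D.Pos ⊕ Λ) ℂ} (hx : x ∈ A.sliceIdeal) :
    A.sliceRes x = 0 := by
  rw [← RingHom.mem_ker]
  refine (Ideal.span_le.2 ?_) hx
  rintro _ ⟨α, rfl⟩
  exact A.sliceRes_X_a α

lemma sliceRes_isWeightedHomogeneous {n : ℤ} {p : MvPolynomial (D.Pos ⊕ Λ) ℂ}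
    (hp : IsWeightedHomogeneous D.kwt p n) :
    IsWeightedHomogeneous (fun i : A.Z => D.kwt i.1) (A.sliceRes p) n := by
  classical
  have h1 : ∀ j, IsWeightedHomogeneous (fun i : A.Z => D.kwt i.1) (A.sliceRes (X j)) (D.kwt j) := by
    intro j
    by_cases h : j ∈ Set.range A.a
    · obtain ⟨α, rfl⟩ := h
      rw [sliceRes_X_a]
      exact isWeightedHomogeneous_zero _ _ _
    · rw [A.sliceRes_X ⟨j, h⟩]
      exact isWeightedHomogeneous_X _ _ _
  exact algHom_isWeightedHomogeneous _ h1 hp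

lemma weightedHomogeneousComponent_eq_zero {n : ℤ} {K : ℕ} (hn : n < K)
    {x : MvPolynomial (D.Pos ⊕ Λ) ℂ} (hx : x ∈ A.sliceIdeal ^ K) :
    weightedHomogeneousComponent D.kwt n x = 0 := by
  classical
  have h1 : x ∈ idealOfVars (D.Pos ⊕ Λ) ℂ ^ K := by
    refine Ideal.pow_right_mono ?_ K hx
    rw [sliceIdeal, Ideal.span_le]
    rintro _ ⟨α, rfl⟩
    exact Ideal.subset_span ⟨_, rfl⟩
  rw [mem_pow_idealOfVars_iff] at h1
  ext s
  rw [coeff_weightedHomogeneousComponent, coeff_zero]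
  split_ifs with h
  · by_contra h2
    have h3 := h1 s (mem_support_iff.2 h2)
    have h4 : (s.degree : ℤ) ≤ Finsupp.weight D.kwt s := by
      rw [Finsupp.weight_apply, Finsupp.sum, Finsupp.degree_apply]
      push_cast
      refine Finset.sum_le_sum fun j _ => ?_
      have := D.kwt_pos j
      rw [nsmul_eq_mul]
      nlinarith [Int.natCast_nonneg (s j)]
    omega
  · rfl

open Classical in
/-- The matrix of the vector fields transverse to the slice. -/
def mat : Matrix D.Pos D.Pos (MvPolynomial (D.Pos ⊕ Λ) ℂ) :=
  Matrix.of fun α β => D.cutAct (D.x (D.neg α)) (X (A.a β))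

lemma mat_mem_gr (α β : D.Pos) : ⁅D.x (D.neg α), D.b (D.posIncl (A.a β))⁆ ∈
    D.gr (-D.ht α + (D.ht β - 1)) := by
  have := D.lie_mem_gr (D.x_mem_gr (D.neg α)) (D.basis_mem_gr (D.posIncl (A.a β)))
  rwa [D.ht_neg, A.hgt_a] at this

open Classical in
lemma det_mat : A.mat.det = C (Matrix.of fun α β => D.omega α (A.a β)).det := by
  rw [RingHom.map_det]
  refine det_eq_of_blockTriangular _ _ (fun α => D.ht α) (fun α β h => ?_) (fun α β h => ?_)
    fun α β h => ?_
  · rw [mat, Matrix.of_apply, cutAct_X, D.cut_lin_of_neg (by omega) (A.mat_mem_gr α β),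
      D.χ_eq_zero (by omega) (A.mat_mem_gr α β), C_0]
  · rw [mat, Matrix.of_apply, cutAct_X, D.cut_lin_of_neg (by omega) (A.mat_mem_gr α β)]
    rfl
  · rw [RingHom.mapMatrix_apply, Matrix.map_apply, Matrix.of_apply]
    by_contra h0
    have h1 := D.hgt_of_omega_ne_zero (α := α) (j := A.a β) (fun h => h0 (by rw [h, C_0]))
    rw [A.hgt_a] at h1
    omega

open Classical in
lemma isUnit_det_mat : IsUnit A.mat.det := by
  rw [det_mat]
  exact (isUnit_iff_ne_zero.2 A.det_ne_zero).map C

lemma _root_.TakiffCenter.RootData.cutAct_isWeightedHomogeneous {n m : ℤ} {u : g} (hu : u ∈ D.gr n)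
    {p : MvPolynomial (D.Pos ⊕ Λ) ℂ}
    (hp : IsWeightedHomogeneous D.kwt p m) :
    IsWeightedHomogeneous D.kwt (D.cutAct u p) (m + n) := by
  refine derivation_isWeightedHomogeneous (fun j => ?_) hp
  rw [cutAct_X]
  have := D.cut_lin_isWeightedHomogeneous (D.lie_mem_gr hu (D.basis_mem_gr (D.posIncl j)))
  rw [kwt]
  convert this using 1
  ring

/-- Functions on the Kostant slice extend to functions invariant under the nilpotent subalgebra. -/
lemma exists_nil_invariant_extension (i : A.Z) : ∃ ψ : MvPolynomial (D.Pos ⊕ Λ) ℂ,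
    IsWeightedHomogeneous D.kwt ψ (D.kwt i.1) ∧ (∀ u ∈ D.nilNeg, D.cutAct u ψ = 0) ∧
      A.sliceRes ψ = X i := by
  classical
  have hU := A.isUnit_det_mat
  let v : D.Pos → MvPolynomial (D.Pos ⊕ Λ) ℂ := fun β => X (A.a β)
  let u : D.Pos → Derivation ℂ (MvPolynomial (D.Pos ⊕ Λ) ℂ) (MvPolynomial (D.Pos ⊕ Λ) ℂ) :=
    fun α => D.cutAct (D.x (D.neg α))
  let Y : D.Pos → D.Pos → MvPolynomial (D.Pos ⊕ Λ) ℂ := fun k i => A.mat⁻¹ k i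
  have hYN : ∀ k' k, ∑ i, Y k' i * u i (v k) - (if k' = k then 1 else 0) ∈
      Ideal.span (Set.range v) := by
    intro k' k
    have := congrFun (congrFun (Matrix.nonsing_inv_mul A.mat hU) k') k
    rw [Matrix.mul_apply, Matrix.one_apply] at this
    rw [show ∑ i, Y k' i * u i (v k) = if k' = k then 1 else 0 from this, sub_self]
    exact zero_mem _
  have hNY : ∀ j i, ∑ k, u j (v k) * Y k i - (if j = i then 1 else 0) ∈
      Ideal.span (Set.range v) := by
    intro k' k
    have := congrFun (congrFun (Matrix.mul_nonsing_inv A.mat hU) k') k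
    rw [Matrix.mul_apply, Matrix.one_apply] at this
    rw [show ∑ k_1, u k' (v k_1) * Y k_1 k = if k' = k then 1 else 0 from this, sub_self]
    exact zero_mem _
  obtain ⟨K, hK⟩ : ∃ K : ℕ, D.kwt i.1 < K := ⟨(D.kwt i.1).toNat + 1, by omega⟩
  obtain ⟨F, -, hFf, hE⟩ :=
    exists_euler_mem v u Y hYN ⊤ (fun _ _ => trivial) (X i.1) trivial (K + 1)
  have hS : ∀ D₁ ∈ D.nilNeg.map D.cutAct, ∀ D₂ ∈ D.nilNeg.map D.cutAct,
      ⁅D₁, D₂⁆ ∈ D.nilNeg.map D.cutAct := by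
    rintro _ ⟨y, hy, rfl⟩ _ ⟨z, hz, rfl⟩
    exact ⟨⁅y, z⁆, D.lie_mem_nilNeg hy hz, D.cutAct_lie hy hz⟩
  have hinv : ∀ D' ∈ D.nilNeg.map D.cutAct, D' F ∈ Ideal.span (Set.range v) ^ K := by
    refine derivation_mem_of_euler_mem v u Y hYN hNY _ ⊥ hS
      (fun α => ⟨_, D.x_neg_mem_nilNeg α, rfl⟩) ?_ bot_le ?_ ?_ hE
    · rintro _ rfl k
      simp
    · rintro _ ⟨y, hy, rfl⟩
      refine ⟨0, zero_mem _, ?_⟩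
      simp only [zero_add]
      refine Submodule.span_induction (p := fun y _ => ∃ c : D.Pos → ℂ, D.cutAct y = ∑ i, c i • u i)
        ?_ ⟨0, by simp⟩ ?_ ?_ hy
      · rintro _ ⟨α, hα, rfl⟩
        refine ⟨Pi.single ⟨D.neg α, by rw [D.ht_neg]; omega⟩ 1, ?_⟩
        simp [Pi.single_apply, u, D.neg_neg, x]
      · rintro a b _ _ ⟨c, hc⟩ ⟨c', hc'⟩
        exact ⟨c + c', by simp [hc, hc', add_smul, Finset.sum_add_distrib]⟩
      · rintro r a _ ⟨c, hc⟩
        exact ⟨r • c, by simp [hc, Finset.smul_sum, smul_smul]⟩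
    · rintro _ rfl
      simp
  refine ⟨weightedHomogeneousComponent D.kwt (D.kwt i.1) F,
    weightedHomogeneousComponent_isWeightedHomogeneous _ _, fun y hy => ?_, ?_⟩
  · refine Submodule.span_induction (p := fun y _ => D.cutAct y
      (weightedHomogeneousComponent D.kwt (D.kwt i.1) F) = 0) ?_ (by simp) ?_ ?_ hy
    · rintro _ ⟨α, hα, rfl⟩
      have h1 := map_weightedHomogeneousComponent D.kwt D.kwt
        (D.cutAct (D.b (Sum.inl α))).toLinearMap (fun n => n + D.ht α) (add_left_injective _)
        (fun n p hp => D.cutAct_isWeightedHomogeneous (D.x_mem_gr α) hp) (D.kwt i.1) F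
      refine h1.trans (A.weightedHomogeneousComponent_eq_zero (K := K) ?_ ?_)
      · show D.kwt i.1 + D.ht α < K
        omega
      · exact hinv _ ⟨_, Submodule.subset_span ⟨α, hα, rfl⟩, rfl⟩
    · intro a b _ _ ha hb
      rw [map_add, Derivation.add_apply, ha, hb, add_zero]
    · intro r a _ ha
      rw [map_smul, Derivation.smul_apply, ha, smul_zero]
  · have h1 := map_weightedHomogeneousComponent D.kwt (fun i : A.Z => D.kwt i.1)
      A.sliceRes.toLinearMap id Function.injective_id
      (fun n p hp => A.sliceRes_isWeightedHomogeneous hp) (D.kwt i.1) F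
    refine h1.trans ?_
    have h2 : A.sliceRes F = X i := by
      have := A.sliceRes_eq_zero hFf
      rwa [map_sub, sliceRes_X, sub_eq_zero] at this
    rw [AlgHom.toLinearMap_apply, h2]
    exact (isWeightedHomogeneous_X ℂ (fun i : A.Z => D.kwt i.1) i).weightedHomogeneousComponent_same

end Transversal

end RootData

lemma isHomogeneous_of_isWeightedHomogeneous_one {σ : Type} {p : MvPolynomial σ ℂ} {n : ℕ}
    (hp : IsWeightedHomogeneous (fun _ => (1 : ℤ)) p n) : p.IsHomogeneous n := by
  intro s hs
  have := hp hs
  rw [Finsupp.weight_apply, Finsupp.sum] at this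
  rw [Finsupp.weight_apply, Finsupp.sum]
  simp at this ⊢
  exact_mod_cast this

namespace RootData

variable {g Φ Λ : Type} [LieRing g] [LieAlgebra ℂ g] [Fintype Φ] [Fintype Λ]
  (D : RootData g Φ Λ)

lemma res_pos_isHomogeneous {n : ℕ} {p : MvPolynomial (D.Pos ⊕ Λ) ℂ}
    (hp : IsWeightedHomogeneous D.kwt p n) : (res D.Pos Λ p).IsHomogeneous n := by
  refine isHomogeneous_of_isWeightedHomogeneous_one (algHom_isWeightedHomogeneous _ ?_ hp)
  rintro (α | i)
  · rw [res_X_inl]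
    exact isWeightedHomogeneous_zero _ _ _
  · rw [res_X_inr]
    exact isWeightedHomogeneous_X _ _ _

open Classical in
/-- The one-parameter group of a simple negative root vector, on the shifted Borel subspace. -/
def flow (α : D.Pos) : MvPolynomial (D.Pos ⊕ Λ) ℂ →ₐ[ℂ] Polynomial (MvPolynomial Λ ℂ) :=
  aeval (Sum.elim
    (fun β => if β = α then -(Polynomial.X * Polynomial.C (linForm (D.cr α))) - Polynomial.X ^ 2 *
      Polynomial.C (C (pair (D.cr α) (D.wt α) * D.χ (D.x (D.neg α)) / 2)) else 0)
    (fun i => Polynomial.C (X i) +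
      Polynomial.C (C (D.wt α i * D.χ (D.x (D.neg α)))) * Polynomial.X))

lemma flow_C (α : D.Pos) (c : ℂ) : D.flow α (C c) = Polynomial.C (C c) := by
  rw [← algebraMap_eq, AlgHom.commutes, IsScalarTower.algebraMap_apply ℂ (MvPolynomial Λ ℂ),
    Polynomial.algebraMap_eq, algebraMap_eq]

lemma flow_inr (α : D.Pos) (i : Λ) : D.flow α (X (Sum.inr i)) = Polynomial.C (X i) +
      Polynomial.C (C (D.wt α i * D.χ (D.x (D.neg α)))) * Polynomial.X := by
  simp [flow]

lemma flow_self (α : D.Pos) : D.flow α (X (Sum.inl α)) =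
    -(Polynomial.X * Polynomial.C (linForm (D.cr α))) - Polynomial.X ^ 2 *
      Polynomial.C (C (pair (D.cr α) (D.wt α) * D.χ (D.x (D.neg α)) / 2)) := by
  rw [flow, aeval_X, Sum.elim_inl, if_pos rfl]

lemma flow_of_ne {α β : D.Pos} (h : β ≠ α) : D.flow α (X (Sum.inl β)) = 0 := by
  simp [flow, h]

lemma cutAct_x_neg_inr (α : D.Pos) (i : Λ) : D.cutAct (D.x (D.neg α)) (X (Sum.inr i)) =
    C (D.wt α i * D.χ (D.x (D.neg α))) := by
  have hn : D.ht (D.neg α) < 0 := by rw [D.ht_neg]; exact neg_neg_of_pos α.2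
  rw [cutAct_X, posIncl_inr, ← lie_skew, x, D.lie_hx, D.wt_neg, map_neg, map_neg, map_smul,
    map_smul, lin_basis, D.cut_X_of_neg hn, smul_eq_C_mul, ← C_mul, ← C_neg]
  simp [x]

lemma cutAct_x_neg_self (α : D.Pos) : D.cutAct (D.x (D.neg α)) (X (Sum.inl α)) =
    -∑ i, C (D.cr α i) * X (Sum.inr i) := by
  rw [cutAct_X, posIncl_inl, ← lie_skew]
  have := D.lie_x_x_neg α.1
  rw [show D.b (Sum.inl α.1) = D.x α.1 from rfl, this, map_neg, map_neg, t, map_sum, map_sum]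
  congr 1
  refine Finset.sum_congr rfl fun i _ => ?_
  rw [map_smul, map_smul, h, lin_basis, smul_eq_C_mul]
  congr 1
  exact D.cut_X_posIncl (Sum.inr i)

lemma flow_cutAct_of_ne {α β : D.Pos} (hα : D.ht α = 1) (h : β ≠ α) :
    D.flow α (D.cutAct (D.x (D.neg α)) (X (Sum.inl β))) = 0 := by
  rw [cutAct_X, posIncl_inl]
  have hne : β.1 ≠ D.neg (D.neg α) := by
    rw [D.neg_neg]
    exact fun h' => h (Subtype.ext h')
  rcases D.lie_xx _ _ hne with h0 | ⟨γ, c, h0, h1, h2⟩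
  · rw [x, h0, map_zero, map_zero, map_zero]
  · rw [D.ht_neg, hα] at h2
    have hb := β.2
    have hγ0 := D.ht_ne_zero γ
    have hγ : 0 < D.ht γ := by omega
    have hγα : (⟨γ, hγ⟩ : D.Pos) ≠ α := by
      rintro rfl
      rw [D.wt_neg] at h1
      refine D.wt_ne_two γ β ?_
      rw [eq_neg_add_iff_add_eq] at h1
      exact h1.symm
    have h3 := D.cut_X_posIncl (Sum.inl ⟨γ, hγ⟩)
    rw [posIncl_inl] at h3
    rw [x, h0, map_smul, map_smul, map_smul, lin_basis, h3, D.flow_of_ne hγα, smul_zero]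

lemma derivative_flow {α : D.Pos} (hα : D.ht α = 1) (p : MvPolynomial (D.Pos ⊕ Λ) ℂ) :
    Polynomial.derivative (D.flow α p) = D.flow α (D.cutAct (D.x (D.neg α)) p) := by
  induction p using MvPolynomial.induction_on with
  | C c =>
    rw [flow_C, derivation_C, map_zero, Polynomial.derivative_C]
  | add p q hp hq => simp only [map_add, hp, hq]
  | mul_X p j hp =>
    have h : Polynomial.derivative (D.flow α (X j)) =
        D.flow α (D.cutAct (D.x (D.neg α)) (X j)) := by
      rcases j with β | i
      · by_cases hβ : β = α
        · subst hβ
          rw [flow_self, cutAct_x_neg_self, map_neg, map_sum]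
          have h1 : ∀ i, D.flow β (C (D.cr β i) * X (Sum.inr i)) =
              Polynomial.C (C (D.cr β i) * X i) + Polynomial.C (C (D.cr β i * D.wt β i)) *
                (Polynomial.C (C (D.χ (D.x (D.neg β)))) * Polynomial.X) := by
            intro i
            rw [map_mul, flow_inr, flow_C]
            simp only [map_mul]
            ring
          rw [Finset.sum_congr rfl fun i _ => h1 i, Finset.sum_add_distrib, ← Finset.sum_mul,
            ← map_sum, ← map_sum, ← map_sum]
          have h2 : (Polynomial.C (C (pair (D.cr β) (D.wt β) * D.χ (D.x (D.neg β)))) :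
              Polynomial (MvPolynomial Λ ℂ)) = Polynomial.C 2 *
              Polynomial.C (C (pair (D.cr β) (D.wt β) * D.χ (D.x (D.neg β)) / 2)) := by
            rw [show (2 : MvPolynomial Λ ℂ) = C 2 from (map_ofNat C 2).symm,
              ← Polynomial.C_mul, ← C_mul]
            congr 2
            ring
          simp only [Polynomial.derivative_sub, Polynomial.derivative_neg,
            Polynomial.derivative_mul,
            Polynomial.derivative_X, Polynomial.derivative_C, Polynomial.derivative_X_pow]
          rw [← mul_assoc, ← Polynomial.C_mul, ← C_mul]
          change _ = -(Polynomial.C (linForm (D.cr β)) +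
            Polynomial.C (C (pair (D.cr β) (D.wt β) * D.χ (D.x (D.neg β)))) * Polynomial.X)
          rw [h2]
          simp
          ring
        · rw [D.flow_of_ne hβ, D.flow_cutAct_of_ne hα hβ, Polynomial.derivative_zero]
      · rw [flow_inr, cutAct_x_neg_inr, flow_C]
        simp
    simp only [map_mul, Polynomial.derivative_mul, Derivation.leibniz, smul_eq_mul, map_add, hp, h]
    ring

/-- Restrictions of nilpotent invariants are invariant under simple reflections. -/
lemma reflHom_res_of_invariant {α : Φ} (hα : D.ht α = 1) {p : MvPolynomial (D.Pos ⊕ Λ) ℂ}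
    (hp : ∀ u ∈ D.nilNeg, D.cutAct u p = 0) :
    reflHom (D.cr α) (D.wt α) (res D.Pos Λ p) = res D.Pos Λ p := by
  obtain ⟨α, rfl⟩ : ∃ α' : D.Pos, α = α'.1 := ⟨⟨α, by omega⟩, rfl⟩
  have h1 := D.derivative_flow hα p
  rw [hp _ (D.x_neg_mem_nilNeg α), map_zero] at h1
  obtain ⟨c, hc⟩ : ∃ c, D.flow α p = Polynomial.C c :=
    ⟨_, Polynomial.eq_C_of_derivative_eq_zero h1⟩
  have hpair := D.pair_ne_zero α
  have hk : D.χ (D.x (D.neg α)) ≠ 0 := (D.χ_inl _).2 (by rw [D.ht_neg, hα])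
  set k := D.χ (D.x (D.neg α)) with hkd
  set q := pair (D.cr α) (D.wt α) with hqd
  have e0 : ((Polynomial.aeval (0 : MvPolynomial Λ ℂ)).restrictScalars ℂ).comp (D.flow α) =
      res D.Pos Λ := by
    refine MvPolynomial.algHom_ext fun j => ?_
    rcases j with β | i
    · by_cases hβ : β = α
      · subst hβ
        simp [flow_self]
      · simp [D.flow_of_ne hβ]
    · simp [flow_inr]
  have e1 : ((Polynomial.aeval (C (-2 / (q * k)) * linForm (D.cr α))).restrictScalars ℂ).comp
      (D.flow α) = (reflHom (D.cr α) (D.wt α)).comp (res D.Pos Λ) := by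
    refine MvPolynomial.algHom_ext fun j => ?_
    rcases j with β | i
    · by_cases hβ : β = α
      · subst hβ
        simp only [AlgHom.comp_apply, flow_self, res_X_inl, map_zero, ← hkd, ← hqd,
          AlgHom.restrictScalars_apply, map_sub, map_neg, map_mul, map_pow, Polynomial.aeval_X,
          Polynomial.aeval_C, Algebra.algebraMap_self, RingHom.id_apply]
        have : C (-2 / (q * k)) + C (-2 / (q * k)) ^ 2 * C (q * k / 2) =
            (0 : MvPolynomial Λ ℂ) := by
          rw [← C_pow, ← C_mul, ← C_add, ← C_0]
          congr 1
          field_simp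
          ring
        linear_combination (-linForm (D.cr β) ^ 2) * this
      · simp [D.flow_of_ne hβ]
    · simp only [AlgHom.comp_apply, flow_inr, res_X_inr, ← hkd, ← hqd,
          AlgHom.restrictScalars_apply, map_add, map_mul, Polynomial.aeval_X,
          Polynomial.aeval_C, Algebra.algebraMap_self, RingHom.id_apply, reflHom, aeval_X]
      have : C (D.wt α i * k) * C (-2 / (q * k)) = -C (2 * D.wt α i / q) (σ := Λ) := by
        rw [← C_mul, ← C_neg]
        congr 1
        field_simp
      rw [C_mul] at this
      linear_combination (linForm (D.cr α)) * this
  have h2 := DFunLike.congr_fun e0 p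
  have h3 := DFunLike.congr_fun e1 p
  rw [AlgHom.comp_apply, hc] at h2 h3
  simp only [AlgHom.restrictScalars_apply, Polynomial.aeval_C] at h2 h3
  rw [← AlgHom.comp_apply, ← h3, h2]

end RootData

lemma isWeightedHomogeneous_zero_of_derivation {σ : Type} [Fintype σ] {w : σ → ℤ}
    (D : Derivation ℂ (MvPolynomial σ ℂ) (MvPolynomial σ ℂ))
    (hD : ∀ i, D (X i) = (w i : ℂ) • X i) {p : MvPolynomial σ ℂ} (hp : D p = 0) :
    IsWeightedHomogeneous w p 0 := by
  classical
  have h1 : ∀ s : σ →₀ ℕ, ∀ c : ℂ, D (monomial s c) =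
      ((Finsupp.weight w s : ℤ) : ℂ) • monomial s c := by
    intro s c
    rw [derivation_eq_sum, Finsupp.weight_apply, Finsupp.sum_fintype _ _ (by simp), Int.cast_sum,
      Finset.sum_smul]
    refine Finset.sum_congr rfl fun i _ => ?_
    rw [hD, smul_mul_assoc, X_mul_pderiv_monomial, ← Nat.cast_smul_eq_nsmul ℂ, smul_smul]
    congr 1
    push_cast [nsmul_eq_mul]
    ring
  intro s hs
  by_contra h
  have h2 : ∀ q, coeff s (D q) = ((Finsupp.weight w s : ℤ) : ℂ) * coeff s q := by
    intro q
    induction q using MvPolynomial.induction_on' with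
    | monomial t c =>
      rw [h1, coeff_smul, coeff_monomial, smul_eq_mul]
      split_ifs with h
      · rw [h]
      · simp
    | add p q hp hq => simp only [map_add, coeff_add, hp, hq, mul_add]
  have h3 := h2 p
  rw [hp, coeff_zero] at h3
  rcases mul_eq_zero.1 h3.symm with h4 | h4
  · exact h (by exact_mod_cast h4)
  · exact hs h4

namespace RootData

variable {g Φ Λ : Type} [LieRing g] [LieAlgebra ℂ g] [Fintype Φ] [Fintype Λ]
  (D : RootData g Φ Λ)

lemma isWeightedHomogeneous_of_invariant {F : MvPolynomial (Φ ⊕ Λ) ℂ}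
    (hF : ∀ z, act D.b z F = 0) : IsWeightedHomogeneous D.hgt F 0 := by
  refine isWeightedHomogeneous_zero_of_derivation (act D.b (∑ i, D.h0 i • D.h i)) ?_ (hF _)
  rintro (α | i)
  · rw [act_X, sum_lie]
    simp only [smul_lie, h, D.lie_hx, smul_smul]
    rw [← Finset.sum_smul, map_smul, lin_basis, hgt_inl, ← D.h0_wt]
    rfl
  · rw [act_X, sum_lie]
    simp [smul_lie, h, D.lie_hh]

lemma res_cut_of_invariant {F : MvPolynomial (Φ ⊕ Λ) ℂ} (hF : ∀ z, act D.b z F = 0) :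
    res D.Pos Λ (D.cut F) = res Φ Λ F := by
  have hw := D.isWeightedHomogeneous_of_invariant hF
  rw [F.as_sum]
  simp only [map_sum]
  refine Finset.sum_congr rfl fun s hs => ?_
  have h0 := hw (mem_support_iff.1 hs)
  rw [monomial_eq]
  simp only [map_mul, Finsupp.prod, map_prod, map_pow]
  congr 1
  · simp [← algebraMap_eq]
  by_cases hpos : ∃ α, 0 < D.ht α ∧ s (Sum.inl α) ≠ 0
  · obtain ⟨α, hα, hs⟩ := hpos
    have hm : (Sum.inl α : Φ ⊕ Λ) ∈ s.support := Finsupp.mem_support_iff.2 hs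
    rw [Finset.prod_eq_zero hm, Finset.prod_eq_zero hm]
    · rw [res_X_inl, zero_pow hs]
    · have := D.cut_X_posIncl (Sum.inl ⟨α, hα⟩)
      rw [posIncl_inl] at this
      rw [this, res_X_inl, zero_pow hs]
  · push Not at hpos
    refine Finset.prod_congr rfl fun j hj => ?_
    rcases j with α | i
    · exfalso
      rw [Finsupp.weight_apply, Finsupp.sum] at h0
      have h1 : ∀ j ∈ s.support, s j • D.hgt j ≤ 0 := by
        rintro (β | i) _
        · rw [nsmul_eq_mul, hgt_inl]
          rcases lt_or_ge 0 (D.ht β) with h | h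
          · simp [hpos β h]
          · exact mul_nonpos_of_nonneg_of_nonpos (Int.natCast_nonneg _) h
        · simp
      have h2 := (Finset.sum_eq_zero_iff_of_nonpos h1).1 h0 _ hj
      rw [nsmul_eq_mul, hgt_inl, mul_eq_zero] at h2
      rcases h2 with h2 | h2
      · exact Finsupp.mem_support_iff.1 hj (by exact_mod_cast h2)
      · exact D.ht_ne_zero α h2
    · have := D.cut_X_posIncl (Sum.inr i)
      rw [posIncl_inr] at this
      rw [this, res_X_inr, res_X_inr]

open Classical in
/-- The vector fields of the negative nilpotent subalgebra, transverse to the Cartan subspace. -/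
def posMat : Matrix D.Pos D.Pos (MvPolynomial (D.Pos ⊕ Λ) ℂ) :=
  Matrix.of fun α β => D.cutAct (D.x (D.neg α)) (X (Sum.inl β))

lemma res_posMat_self (α : D.Pos) : res D.Pos Λ (D.posMat α α) = -linForm (D.cr α) := by
  rw [posMat, Matrix.of_apply, cutAct_x_neg_self, map_neg, map_sum, linForm]
  congr 1
  refine Finset.sum_congr rfl fun i _ => ?_
  rw [map_mul, res_X_inr, ← algebraMap_eq, AlgHom.commutes, algebraMap_eq]

lemma res_posMat_of_le {α β : D.Pos} (hne : β ≠ α) (h : D.ht α ≤ D.ht β) :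
    res D.Pos Λ (D.posMat α β) = 0 := by
  have hne : β.1 ≠ D.neg (D.neg α) := by
    rw [D.neg_neg]
    exact fun h' => hne (Subtype.ext h')
  rw [posMat, Matrix.of_apply, cutAct_X, posIncl_inl]
  rcases D.lie_xx _ _ hne with h0 | ⟨γ, c, h0, -, h2⟩
  · rw [x, h0, map_zero, map_zero, map_zero]
  · rw [D.ht_neg] at h2
    have hγ0 := D.ht_ne_zero γ
    have hγ : 0 < D.ht γ := by omega
    have h3 := D.cut_X_posIncl (Sum.inl ⟨γ, hγ⟩)
    rw [posIncl_inl] at h3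
    rw [x, h0, map_smul, map_smul, map_smul, lin_basis, h3, res_X_inl, smul_zero]

open Classical in
lemma res_det_posMat_ne_zero : res D.Pos Λ D.posMat.det ≠ 0 := by
  have h1 : res D.Pos Λ D.posMat.det =
      (Matrix.diagonal fun α : D.Pos => -linForm (D.cr α)).det := by
    refine (AlgHom.map_det (res D.Pos Λ) D.posMat).trans ?_
    refine det_eq_of_blockTriangular _ _ (fun α => -D.ht α) (fun α β h => ?_) (fun α β h => ?_)
      fun α β h => ?_
    · refine D.res_posMat_of_le ?_ (by omega)
      rintro rfl
      omega
    · by_cases hne : β = α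
      · subst hne
        rw [Matrix.diagonal_apply_eq]
        exact D.res_posMat_self β
      · rw [Matrix.diagonal_apply_ne' _ hne]
        exact D.res_posMat_of_le hne (by omega)
    · refine Matrix.diagonal_apply_ne _ ?_
      rintro rfl
      exact h rfl
  rw [h1, Matrix.det_diagonal]
  exact Finset.prod_ne_zero_iff.2 fun α _ => neg_ne_zero.2 (D.linForm_cr_ne_zero _)

omit [Fintype Λ] in
lemma eq_zero_of_mem_rootIdeal_pow {P : Type} {x : MvPolynomial (P ⊕ Λ) ℂ}
    (h : ∀ K, x ∈ rootIdeal P Λ ^ K) : x = 0 := by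
  apply (sumAlgEquiv ℂ P Λ).injective
  rw [map_zero]
  ext1 s
  rw [coeff_zero]
  exact mem_rootIdeal_pow_iff.1 (h (s.degree + 1)) s (Nat.lt_succ_self _)

/-- Nilpotent invariants are determined by their restriction to the Cartan subspace. -/
lemma eq_zero_of_res_eq_zero {G : MvPolynomial (D.Pos ⊕ Λ) ℂ}
    (hG : ∀ u ∈ D.nilNeg, D.cutAct u G = 0) (hres : res D.Pos Λ G = 0) : G = 0 := by
  classical
  refine eq_zero_of_mem_rootIdeal_pow fun K => ?_
  let v : D.Pos → MvPolynomial (D.Pos ⊕ Λ) ℂ := fun β => X (Sum.inl β)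
  let u : D.Pos → Derivation ℂ (MvPolynomial (D.Pos ⊕ Λ) ℂ) (MvPolynomial (D.Pos ⊕ Λ) ℂ) :=
    fun α => D.cutAct (D.x (D.neg α))
  let Y : D.Pos → D.Pos → MvPolynomial (D.Pos ⊕ Λ) ℂ := fun k i => D.posMat.adjugate k i
  have hYN : ∀ k' k, ∑ i, Y k' i * u i (v k) - (if k' = k then D.posMat.det else 0) ∈
      Ideal.span (Set.range v) := by
    intro k' k
    have := congrFun (congrFun (Matrix.adjugate_mul D.posMat) k') k
    rw [Matrix.mul_apply, Matrix.smul_apply, Matrix.one_apply, smul_eq_mul, mul_ite, mul_one,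
      mul_zero] at this
    rw [show ∑ i, Y k' i * u i (v k) = if k' = k then D.posMat.det else 0 from this, sub_self]
    exact zero_mem _
  refine mem_pow_of_euler_mem v u Y D.posMat.det hYN (fun k x hx => ?_)
    (mem_rootIdeal_iff.2 hres) ?_
  · refine mem_rootIdeal_pow_of_mul_mem ?_ hx
    rw [mem_rootIdeal_iff]
    exact D.res_det_posMat_ne_zero
  · rw [euler_apply, Finset.sum_eq_zero]
    · exact zero_mem _
    · intro α _
      rw [show u α G = 0 from hG _ (D.x_neg_mem_nilNeg α), mul_zero]

/-- The Kostant slice theorem: coordinates of the slice extend to homogeneous invariants. -/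
theorem Transversal.exists_invariant_extension {D : RootData g Φ Λ} (A : D.Transversal) (i : A.Z) :
    ∃ F, (∃ d, F.IsHomogeneous d) ∧ (∀ z, act D.b z F = 0) ∧ A.sliceRes (D.cut F) = X i := by
  obtain ⟨ψ, h1, h2, h3⟩ := A.exists_nil_invariant_extension i
  obtain ⟨d, hd⟩ := Int.eq_ofNat_of_zero_le (D.kwt_pos i.1).le
  rw [hd] at h1
  obtain ⟨F, hF, hres, hinv⟩ := D.exists_invariant_extension (res D.Pos Λ ψ)
    (D.res_pos_isHomogeneous h1)
    (D.refl_closed _ fun α hα => D.reflHom_res_of_invariant hα h2)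
  refine ⟨F, ⟨d, hF⟩, hinv, ?_⟩
  have : D.cut F - ψ = 0 := by
    refine D.eq_zero_of_res_eq_zero (fun u hu => ?_) ?_
    · rw [map_sub, h2 u hu, ← D.cut_act hu, hinv, map_zero, sub_zero]
    · rw [map_sub, D.res_cut_of_invariant hinv, hres, sub_self]
  rw [sub_eq_zero.1 this, h3]

end RootData

section Coeffwise

variable {R : Type} [CommRing R] [Algebra ℂ R]

/-- The extension of a derivation to power series, acting on the coefficients. -/
def coeffDeriv (D : Derivation ℂ R R) : Derivation ℂ (PowerSeries R) (PowerSeries R) :=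
  Derivation.mk'
    { toFun := fun p => PowerSeries.mk fun a => D (PowerSeries.coeff a p)
      map_add' := fun p q => by ext; simp
      map_smul' := fun c p => by
        ext a
        have h : ∀ r : PowerSeries R, PowerSeries.coeff a (c • r) = c • PowerSeries.coeff a r :=
          fun r => rfl
        simp [h] }
    fun p q => by
      ext a
      simp only [LinearMap.coe_mk, AddHom.coe_mk, PowerSeries.coeff_mk, smul_eq_mul, map_add,
        PowerSeries.coeff_mul, map_sum, Derivation.leibniz, Finset.sum_add_distrib]
      congr 1
      rw [← Finset.Nat.sum_antidiagonal_swap]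
      rfl

lemma coeff_coeffDeriv (D : Derivation ℂ R R) (p : PowerSeries R) (a : ℕ) :
    PowerSeries.coeff a (coeffDeriv D p) = D (PowerSeries.coeff a p) := by
  simp [coeffDeriv]

end Coeffwise

section Jet

variable (σ : Type) (n : ℕ)

/-- The universal jet. -/
def jet : MvPolynomial σ ℂ →ₐ[ℂ] PowerSeries (MvPolynomial (σ × Fin n) ℂ) :=
  aeval fun j => PowerSeries.mk fun a => if h : a < n then X (j, ⟨a, h⟩) else 0

variable {σ}

lemma coeff_jet_X (j : σ) (a : Fin n) : PowerSeries.coeff a.1 (jet σ n (X j)) = X (j, a) := by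
  simp [jet]

lemma coeff_jet_X_of_le (j : σ) {a : ℕ} (h : n ≤ a) :
    PowerSeries.coeff a (jet σ n (X j)) = 0 := by
  simp [jet, h.not_gt]

lemma jet_C (c : ℂ) : jet σ n (C c) = PowerSeries.C (C c) := by
  rw [← algebraMap_eq, AlgHom.commutes, PowerSeries.algebraMap_apply, algebraMap_eq]

variable {n}

lemma coeff_mul_isHomogeneous {τ : Type} {p q : PowerSeries (MvPolynomial τ ℂ)} {d e : ℕ}
    (hp : ∀ a, (PowerSeries.coeff a p).IsHomogeneous d)
    (hq : ∀ a, (PowerSeries.coeff a q).IsHomogeneous e) (a : ℕ) :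
    (PowerSeries.coeff a (p * q)).IsHomogeneous (d + e) := by
  rw [PowerSeries.coeff_mul]
  exact IsHomogeneous.sum _ _ _ fun x _ => (hp _).mul (hq _)

lemma coeff_one_isHomogeneous {τ : Type} (a : ℕ) :
    (PowerSeries.coeff a (1 : PowerSeries (MvPolynomial τ ℂ))).IsHomogeneous 0 := by
  rw [PowerSeries.coeff_one]
  split_ifs
  · exact isHomogeneous_one _ _
  · exact isHomogeneous_zero _ _ _

lemma coeff_jet_isHomogeneous {d : ℕ} {p : MvPolynomial σ ℂ} (hp : p.IsHomogeneous d) (a : ℕ) :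
    (PowerSeries.coeff a (jet σ n p)).IsHomogeneous d := by
  classical
  have hX : ∀ j a, (PowerSeries.coeff a (jet σ n (X j))).IsHomogeneous 1 := by
    intro j a
    by_cases h : a < n
    · rw [coeff_jet_X n j ⟨a, h⟩]
      exact isHomogeneous_X _ _
    · rw [coeff_jet_X_of_le n j (not_lt.1 h)]
      exact isHomogeneous_zero _ _ _
  have hpow : ∀ j k a, (PowerSeries.coeff a (jet σ n (X j) ^ k)).IsHomogeneous k := by
    intro j k
    induction k with
    | zero => simpa using coeff_one_isHomogeneous
    | succ k ih =>
      rw [pow_succ]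
      exact coeff_mul_isHomogeneous ih (hX j)
  have hprod : ∀ (s : Finset σ) (e : σ → ℕ) a,
      (PowerSeries.coeff a (∏ j ∈ s, jet σ n (X j) ^ e j)).IsHomogeneous (∑ j ∈ s, e j) := by
    intro s e
    induction s using Finset.induction_on with
    | empty => simpa using coeff_one_isHomogeneous
    | insert j s hj ih =>
      rw [Finset.prod_insert hj, Finset.sum_insert hj]
      exact coeff_mul_isHomogeneous (hpow _ _) ih
  rw [p.as_sum, map_sum, map_sum]
  refine IsHomogeneous.sum _ _ _ fun s hs => ?_
  rw [monomial_eq, map_mul, Finsupp.prod, map_prod, jet_C, PowerSeries.coeff_C_mul, ← zero_add d]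
  refine (isHomogeneous_C _ _).mul ?_
  simp only [map_pow]
  have h1 := hp (mem_support_iff.1 hs)
  rw [Finsupp.weight_apply, Finsupp.sum] at h1
  simp only [Pi.one_apply, smul_eq_mul, mul_one] at h1
  rw [← h1]
  exact hprod _ _ _

/-- The map induced on jets by a map sending variables to variables and constants. -/
def jetMap {τ : Type} (n : ℕ) (ρ : MvPolynomial σ ℂ →ₐ[ℂ] MvPolynomial τ ℂ) :
    MvPolynomial (σ × Fin n) ℂ →ₐ[ℂ] MvPolynomial (τ × Fin n) ℂ :=
  aeval fun j => PowerSeries.coeff j.2.1 (jet τ n (ρ (X j.1)))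

lemma jetMap_coeff_jet {τ : Type} {ρ : MvPolynomial σ ℂ →ₐ[ℂ] MvPolynomial τ ℂ}
    (hρ : ∀ j a, n ≤ a → PowerSeries.coeff a (jet τ n (ρ (X j))) = 0) (p : MvPolynomial σ ℂ)
    (a : ℕ) : jetMap n ρ (PowerSeries.coeff a (jet σ n p)) =
      PowerSeries.coeff a (jet τ n (ρ p)) := by
  have h : (PowerSeries.mapAlgHom (jetMap n ρ)).comp (jet σ n) = (jet τ n).comp ρ := by
    refine MvPolynomial.algHom_ext fun j => ?_
    ext1 a
    rw [AlgHom.comp_apply, AlgHom.comp_apply, PowerSeries.mapAlgHom_apply, PowerSeries.coeff_map]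
    by_cases h : a < n
    · rw [coeff_jet_X n j ⟨a, h⟩]
      simp [jetMap]
    · rw [coeff_jet_X_of_le n j (not_lt.1 h), hρ j a (not_lt.1 h), map_zero]
  rw [← AlgHom.comp_apply, ← h, AlgHom.comp_apply, PowerSeries.mapAlgHom_apply,
    PowerSeries.coeff_map]
  rfl

/-- The Toeplitz matrix of jets of a matrix. -/
def jetMatrix {τ ι : Type} (n : ℕ) (M : Matrix ι ι (MvPolynomial τ ℂ)) :
    Matrix (ι × Fin n) (ι × Fin n) (MvPolynomial (τ × Fin n) ℂ) :=
  Matrix.of fun r k => if r.2 ≤ k.2 then PowerSeries.coeff (k.2.1 - r.2.1) (jet τ n (M r.1 k.1))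
    else 0

lemma det_jetMatrix {τ ι : Type} [Fintype ι] [DecidableEq ι] (M : Matrix ι ι (MvPolynomial τ ℂ))
    (Ω : Matrix ι ι ℂ) (b : ι → ℤ) (hM : ∀ i j, b j < b i → M i j = 0)
    (hMΩ : ∀ i j, b i = b j → M i j = C (Ω i j)) (hΩ : ∀ i j, b i ≠ b j → Ω i j = 0) :
    (jetMatrix n M).det = C (Ω.det ^ n) := by
  have h1 : (jetMatrix n M).det =
      ((Matrix.kroneckerMap (· * ·) Ω (1 : Matrix (Fin n) (Fin n) ℂ)).map
        (C : ℂ →+* MvPolynomial (τ × Fin n) ℂ)).det := by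
    refine det_eq_of_blockTriangular _ _ (fun i => b i.1 + i.2.1) ?_ ?_ ?_
    · rintro ⟨i, c⟩ ⟨j, a⟩ h
      simp only at h
      rw [jetMatrix, Matrix.of_apply]
      simp only
      split_ifs with hca
      · have hca : c.1 ≤ a.1 := hca
        rw [hM i j (by omega), map_zero, map_zero]
      · rfl
    · rintro ⟨i, c⟩ ⟨j, a⟩ h
      simp only at h
      rw [jetMatrix, Matrix.of_apply, Matrix.map_apply, Matrix.kroneckerMap_apply,
        Matrix.one_apply]
      simp only
      by_cases hca : c = a
      · subst hca
        rw [if_pos le_rfl, if_pos rfl, hMΩ i j (by omega), jet_C, Nat.sub_self, mul_one,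
          PowerSeries.coeff_zero_C]
      · rw [if_neg hca, mul_zero, C_0]
        split_ifs with hle
        · have hlt : c.1 < a.1 := lt_of_le_of_ne hle fun h => hca (Fin.ext h)
          rw [hM i j (by omega), map_zero, map_zero]
        · rfl
    · rintro ⟨i, c⟩ ⟨j, a⟩ h
      simp only at h
      rw [Matrix.map_apply, Matrix.kroneckerMap_apply, Matrix.one_apply]
      simp only
      split_ifs with hca
      · subst hca
        rw [hΩ i j (by omega), zero_mul, C_0]
      · rw [mul_zero, C_0]
  rw [h1, ← RingHom.mapMatrix_apply, ← RingHom.map_det]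
  congr 1
  rw [Matrix.det_kronecker]
  simp

end Jet

/-- A Lie algebra of `n`-jets in a Lie algebra with given basis. -/
structure TakiffData {J g : Type} [LieRing g] [LieAlgebra ℂ g] (b : Module.Basis J ℂ g)
    (q : Type) [LieRing q] [LieAlgebra ℂ q] (n : ℕ) where
  τ : ℕ → g →ₗ[ℂ] q
  τ_eq_zero : ∀ a, n ≤ a → τ a = 0
  lie_τ : ∀ a c x y, ⁅τ a x, τ c y⁆ = τ (a + c) ⁅x, y⁆
  basis : Module.Basis (J × Fin n) ℂ q
  basis_apply : ∀ j a, basis (j, a) = τ (n - 1 - a.1) (b j)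

namespace TakiffData

variable {J g : Type} [Fintype J] [LieRing g] [LieAlgebra ℂ g] {b : Module.Basis J ℂ g}
    {q : Type} [LieRing q] [LieAlgebra ℂ q] {n : ℕ} (T : TakiffData b q n)

omit [Fintype J] in
lemma coeff_jet_X_eq (j : J) (a : Fin n) : PowerSeries.coeff a.1 (jet J n (X j)) =
    lin T.basis (T.τ (n - 1 - a.1) (b j)) := by
  rw [coeff_jet_X, ← T.basis_apply, lin_basis]

lemma coeff_jet_lin (y : g) (a : Fin n) : PowerSeries.coeff a.1 (jet J n (lin b y)) =
    lin T.basis (T.τ (n - 1 - a.1) y) := by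
  conv_rhs => rw [← b.sum_repr y]
  rw [lin_eq_sum]
  simp only [map_sum, map_mul, map_smul]
  refine Finset.sum_congr rfl fun j _ => ?_
  rw [jet_C, PowerSeries.coeff_C_mul, T.coeff_jet_X_eq, smul_eq_C_mul]

lemma act_coeff_jet (c : ℕ) (z : g) (p : MvPolynomial J ℂ) {a : ℕ} (ha : a < n) :
    act T.basis (T.τ c z) (PowerSeries.coeff a (jet J n p)) =
      PowerSeries.coeff a (PowerSeries.X ^ c * jet J n (act b z p)) := by
  have key : ∀ p, (PowerSeries.X ^ n : PowerSeries (MvPolynomial (J × Fin n) ℂ)) ∣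
      coeffDeriv (act T.basis (T.τ c z)) (jet J n p) -
        PowerSeries.X ^ c * jet J n (act b z p) := by
    intro p
    induction p using MvPolynomial.induction_on with
    | C r =>
      rw [← algebraMap_eq, AlgHom.commutes, Derivation.map_algebraMap, Derivation.map_algebraMap]
      simp
    | add p q hp hq =>
      simp only [map_add, mul_add]
      rw [add_sub_add_comm]
      exact dvd_add hp hq
    | mul_X p j hp =>
      have h : (PowerSeries.X ^ n : PowerSeries (MvPolynomial (J × Fin n) ℂ)) ∣
          coeffDeriv (act T.basis (T.τ c z)) (jet J n (X j)) -
            PowerSeries.X ^ c * jet J n (act b z (X j)) := by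
        rw [PowerSeries.X_pow_dvd_iff]
        intro a ha
        rw [map_sub, coeff_coeffDeriv, T.coeff_jet_X_eq j ⟨a, ha⟩, act_lin, T.lie_τ, act_X,
          PowerSeries.coeff_X_pow_mul']
        split_ifs with hca
        · have h1 := T.coeff_jet_lin ⁅z, b j⁆ ⟨a - c, by omega⟩
          simp only at h1
          rw [h1, sub_eq_zero]
          congr 3
          simp only
          omega
        · rw [T.τ_eq_zero _ (by simp only; omega)]
          simp
      have h2 : coeffDeriv (act T.basis (T.τ c z)) (jet J n (p * X j)) -
            PowerSeries.X ^ c * jet J n (act b z (p * X j)) =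
          jet J n p * (coeffDeriv (act T.basis (T.τ c z)) (jet J n (X j)) -
            PowerSeries.X ^ c * jet J n (act b z (X j))) +
          jet J n (X j) * (coeffDeriv (act T.basis (T.τ c z)) (jet J n p) -
            PowerSeries.X ^ c * jet J n (act b z p)) := by
        simp only [map_mul, map_add, Derivation.leibniz, smul_eq_mul]
        ring
      rw [h2]
      exact dvd_add (Dvd.dvd.mul_left h _) (Dvd.dvd.mul_left hp _)
  have := PowerSeries.X_pow_dvd_iff.1 (key p) a ha
  rwa [map_sub, coeff_coeffDeriv, sub_eq_zero] at this

lemma act_coeff_jet_of_invariant {p : MvPolynomial J ℂ} (hp : ∀ z, act b z p = 0) (a : Fin n)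
    (y : q) : act T.basis y (PowerSeries.coeff a.1 (jet J n p)) = 0 := by
  rw [← T.basis.sum_repr y, map_sum, derivation_sum_apply]
  refine Finset.sum_eq_zero fun j _ => ?_
  rw [map_smul, Derivation.smul_apply, T.basis_apply j.1 j.2, T.act_coeff_jet _ _ _ a.2, hp]
  simp

/-- The adjoint representation of a Lie algebra of jets is faithful when that of the base is. -/
lemma ad_injective (T : TakiffData b q n) (had : Function.Injective (LieAlgebra.ad ℂ g)) :
    Function.Injective (LieAlgebra.ad ℂ q) := by
  classical
  rw [injective_iff_map_eq_zero]
  intro y hy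
  have h1 : ∀ x, ⁅y, T.τ 0 x⁆ = 0 := fun x => by
    rw [← LieAlgebra.ad_apply ℂ, hy, LinearMap.zero_apply]
  have hcoef : ∀ a : Fin n, ∑ j, T.basis.repr y (j, a) • b j = 0 := by
    intro a
    apply had
    rw [map_zero]
    ext x
    rw [LieAlgebra.ad_apply, LinearMap.zero_apply]
    have h2 : ∀ w : g, ∀ c : Fin n, ∀ j, T.basis.repr (T.τ (n - 1 - c.1) w) (j, a) =
        if c = a then b.repr w j else 0 := by
      intro w c j
      conv_lhs => rw [← b.sum_repr w]
      simp only [map_sum, map_smul, ← T.basis_apply, Module.Basis.repr_self, Finsupp.coe_finsetSum,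
        Finset.sum_apply, Finsupp.smul_apply, Finsupp.single_apply, smul_eq_mul, mul_ite, mul_one,
        mul_zero, Prod.mk.injEq]
      by_cases h : c = a <;> simp [h]
    have h3 : ⁅y, T.τ 0 x⁆ = ∑ c : Fin n, T.τ (n - 1 - c.1)
        ⁅∑ j, T.basis.repr y (j, c) • b j, x⁆ := by
      conv_lhs => rw [← T.basis.sum_repr y]
      rw [Fintype.sum_prod_type_right, sum_lie]
      refine Finset.sum_congr rfl fun c _ => ?_
      rw [sum_lie, sum_lie, map_sum]
      refine Finset.sum_congr rfl fun j _ => ?_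
      rw [smul_lie, smul_lie, T.basis_apply, T.lie_τ, add_zero, map_smul]
    apply b.repr.injective
    ext j
    have h4 : T.basis.repr ⁅y, T.τ 0 x⁆ (j, a) = 0 := by rw [h1]; simp
    rw [h3, map_sum, Finsupp.coe_finsetSum, Finset.sum_apply] at h4
    simp only [h2] at h4
    rw [Finset.sum_ite_eq' Finset.univ a, if_pos (Finset.mem_univ _)] at h4
    rw [h4]
    simp
  apply T.basis.repr.injective
  ext ⟨j, a⟩
  have := Fintype.linearIndependent_iff.1 b.linearIndependent _ (hcoef a) j
  simpa using this

end TakiffData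

namespace RootData

namespace Transversal

variable {g Φ Λ : Type} [LieRing g] [LieAlgebra ℂ g] [Fintype Φ] [Fintype Λ]
  {D : RootData g Φ Λ} (A : D.Transversal)

lemma card_Z : Nat.card A.Z = Nat.card Λ := by
  classical
  have : Fintype A.Z := Fintype.ofFinite _
  have h1 : Fintype.card A.Z = Fintype.card (D.Pos ⊕ Λ) - Fintype.card (Set.range A.a) := by
    rw [← Fintype.card_subtype_compl]
  rw [Set.card_range_of_injective A.inj, Fintype.card_sum] at h1
  rw [Nat.card_eq_fintype_card, Nat.card_eq_fintype_card, h1]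
  omega

/-- Restriction of functions on the Lie algebra to the Kostant slice. -/
def rho : MvPolynomial (Φ ⊕ Λ) ℂ →ₐ[ℂ] MvPolynomial A.Z ℂ := A.sliceRes.comp D.cut

/-- Coordinates transverse to the Kostant slice. -/
def col : D.Pos ⊕ D.Pos → Φ ⊕ Λ := Sum.elim (fun α => Sum.inl (D.neg α)) fun α => D.posIncl (A.a α)

/-- Vector fields transverse to the Kostant slice. -/
def row : D.Pos ⊕ D.Pos → Φ ⊕ Λ := Sum.elim (fun α => D.posIncl (A.a α)) fun α => Sum.inl (D.neg α)

/-- A height function on transverse coordinates. -/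
def lev : D.Pos ⊕ D.Pos → ℤ := Sum.elim (fun α => -D.ht α) fun α => D.ht α - 1

lemma hgt_col (k : D.Pos ⊕ D.Pos) : D.hgt (A.col k) = lev k := by
  rcases k with α | α
  · exact D.ht_neg α
  · exact A.hgt_a α

lemma hgt_row (k : D.Pos ⊕ D.Pos) : D.hgt (A.row k) = -1 - lev k := by
  rcases k with α | α
  · have := A.hgt_a α
    simp only [row, lev, Sum.elim_inl, this]
    ring
  · have := D.ht_neg α
    simp only [row, lev, Sum.elim_inr, hgt_inl, this]
    ring

lemma rho_X_col (k : D.Pos ⊕ D.Pos) : ∃ c : ℂ, A.rho (X (A.col k)) = C c := by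
  rcases k with α | α
  · refine ⟨D.χ (D.x (D.neg α)), ?_⟩
    have hn : D.ht (D.neg α) < 0 := by rw [D.ht_neg]; exact neg_neg_of_pos α.2
    rw [rho, AlgHom.comp_apply, col, Sum.elim_inl, D.cut_X_of_neg hn, ← algebraMap_eq,
      AlgHom.commutes, algebraMap_eq]
  · exact ⟨0, by rw [rho, AlgHom.comp_apply, col, Sum.elim_inr, cut_X_posIncl, sliceRes_X_a, C_0]⟩

lemma rho_X (i : A.Z) : A.rho (X (D.posIncl i.1)) = X i := by
  rw [rho, AlgHom.comp_apply, cut_X_posIncl, sliceRes_X]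

lemma exists_col_or (j : Φ ⊕ Λ) : (∃ k, j = A.col k) ∨ ∃ i : A.Z, j = D.posIncl i.1 := by
  rcases D.exists_posIncl_or j with ⟨j, rfl⟩ | ⟨α, hα, rfl⟩
  · by_cases h : j ∈ Set.range A.a
    · obtain ⟨α, rfl⟩ := h
      exact Or.inl ⟨Sum.inr α, rfl⟩
    · exact Or.inr ⟨⟨j, h⟩, rfl⟩
  · refine Or.inl ⟨Sum.inl ⟨D.neg α, by rw [D.ht_neg]; omega⟩, ?_⟩
    simp [col, D.neg_neg]

lemma rho_lin {m : ℤ} (hm : m < 0) {y : g} (hy : y ∈ D.gr m) : A.rho (lin D.b y) = C (D.χ y) := by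
  rw [rho, AlgHom.comp_apply, D.cut_lin_of_neg hm hy, ← algebraMap_eq, AlgHom.commutes,
    algebraMap_eq]

/-- The matrix of the transverse vector fields on the Kostant slice. -/
def mat' : Matrix (D.Pos ⊕ D.Pos) (D.Pos ⊕ D.Pos) (MvPolynomial A.Z ℂ) :=
  Matrix.of fun r k => A.rho (lin D.b ⁅D.b (A.row r), D.b (A.col k)⁆)

/-- The constant part of the matrix of the transverse vector fields. -/
def omega' : Matrix (D.Pos ⊕ D.Pos) (D.Pos ⊕ D.Pos) ℂ :=
  Matrix.of fun r k => D.χ ⁅D.b (A.row r), D.b (A.col k)⁆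

lemma lie_mem (r k : D.Pos ⊕ D.Pos) :
    ⁅D.b (A.row r), D.b (A.col k)⁆ ∈ D.gr (-1 - lev r + lev k) := by
  rw [← A.hgt_row, ← A.hgt_col]
  exact D.lie_basis_mem_gr _ _

lemma omega'_eq_zero {r k : D.Pos ⊕ D.Pos} (h : lev r ≠ lev k) : A.omega' r k = 0 :=
  D.χ_eq_zero (by omega) (A.lie_mem r k)

lemma mat'_eq {r k : D.Pos ⊕ D.Pos} (h : lev r = lev k) : A.mat' r k = C (A.omega' r k) :=
  A.rho_lin (by omega) (A.lie_mem r k)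

lemma mat'_eq_zero {r k : D.Pos ⊕ D.Pos} (h : lev k < lev r) : A.mat' r k = 0 := by
  refine (A.rho_lin (by omega) (A.lie_mem r k)).trans ?_
  rw [D.χ_eq_zero (by omega) (A.lie_mem r k), C_0]

open Classical in
lemma det_omega'_ne_zero : A.omega'.det ≠ 0 := by
  have h : A.omega' = Matrix.fromBlocks (-(Matrix.of fun α β => D.omega α (A.a β)).transpose) 0 0
      (Matrix.of fun α β => D.omega α (A.a β)) := by
    ext1 r k
    rcases r with α | α <;> rcases k with β | β
    · rw [Matrix.fromBlocks_apply₁₁, Matrix.neg_apply, Matrix.transpose_apply, Matrix.of_apply,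
        omega, ← map_neg, lie_skew]
      rfl
    · refine A.omega'_eq_zero ?_
      have h1 := α.2
      have h2 := β.2
      simp only [lev, Sum.elim_inl, Sum.elim_inr]
      omega
    · refine A.omega'_eq_zero ?_
      have h1 := α.2
      have h2 := β.2
      simp only [lev, Sum.elim_inl, Sum.elim_inr]
      omega
    · rfl
  rw [h, Matrix.det_fromBlocks_zero₂₁, Matrix.det_neg, Matrix.det_transpose]
  exact mul_ne_zero (mul_ne_zero (pow_ne_zero _ (neg_ne_zero.2 one_ne_zero)) A.det_ne_zero)
    A.det_ne_zero

lemma coeff_jet_rho_eq_zero {n : ℕ} (hn : 0 < n) (j : Φ ⊕ Λ) (a : ℕ) (ha : n ≤ a) :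
    PowerSeries.coeff a (jet A.Z n (A.rho (X j))) = 0 := by
  rcases A.exists_col_or j with ⟨k, rfl⟩ | ⟨i, rfl⟩
  · obtain ⟨c, hc⟩ := A.rho_X_col k
    rw [hc, jet_C, PowerSeries.coeff_C, if_neg (by omega)]
  · rw [rho_X, coeff_jet_X_of_le _ _ ha]

variable {q : Type} [LieRing q] [LieAlgebra ℂ q] {n : ℕ}

/-- The section of the restriction to the space of jets of the Kostant slice. -/
def sec (n : ℕ) : MvPolynomial (A.Z × Fin n) ℂ →ₐ[ℂ] MvPolynomial ((Φ ⊕ Λ) × Fin n) ℂ :=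
  rename fun i => (D.posIncl i.1.1, i.2)

lemma jetMap_X (i : A.Z) (a : Fin n) : jetMap n A.rho (X (D.posIncl i.1, a)) = X (i, a) := by
  simp [jetMap, rho_X, coeff_jet_X]

lemma jetMap_sec (p : MvPolynomial (A.Z × Fin n) ℂ) : jetMap n A.rho (A.sec n p) = p := by
  have h : (jetMap n A.rho).comp (A.sec n) = AlgHom.id ℂ _ :=
    MvPolynomial.algHom_ext fun i => by simp [sec, jetMap_X]
  exact DFunLike.congr_fun h p

lemma sec_jetMap_col (k : D.Pos ⊕ D.Pos) (a : Fin n) :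
    ∃ c : ℂ, A.sec n (jetMap n A.rho (X (A.col k, a))) = C c := by
  obtain ⟨c, hc⟩ := A.rho_X_col k
  rw [jetMap, aeval_X, hc, jet_C, PowerSeries.coeff_C]
  split_ifs
  · exact ⟨c, by simp [sec]⟩
  · exact ⟨0, by simp⟩

/-- The transverse coordinates on the space of jets. -/
def vert (n : ℕ) (k : (D.Pos ⊕ D.Pos) × Fin n) : MvPolynomial ((Φ ⊕ Λ) × Fin n) ℂ :=
  X (A.col k.1, k.2) - A.sec n (jetMap n A.rho (X (A.col k.1, k.2)))

lemma mem_span_vert {p : MvPolynomial ((Φ ⊕ Λ) × Fin n) ℂ} (hp : jetMap n A.rho p = 0) :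
    p ∈ Ideal.span (Set.range (A.vert n)) := by
  have h := sub_aeval_mem (fun j => A.sec n (jetMap n A.rho (X j)))
    (I := Ideal.span (Set.range (A.vert n))) (fun j => ?_) p
  · have h1 : aeval (fun j => A.sec n (jetMap n A.rho (X j))) =
        (A.sec n).comp (jetMap n A.rho) := MvPolynomial.algHom_ext fun j => by simp
    rwa [h1, AlgHom.comp_apply, hp, map_zero, sub_zero] at h
  · obtain ⟨j, a⟩ := j
    rcases A.exists_col_or j with ⟨k, rfl⟩ | ⟨i, rfl⟩
    · exact Ideal.subset_span ⟨(k, a), rfl⟩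
    · rw [jetMap_X]
      simp [sec]

lemma jetMap_eq_zero {p : MvPolynomial ((Φ ⊕ Λ) × Fin n) ℂ}
    (hp : p ∈ Ideal.span (Set.range (A.vert n))) : jetMap n A.rho p = 0 := by
  rw [← RingHom.mem_ker]
  refine (Ideal.span_le.2 ?_) hp
  rintro _ ⟨k, rfl⟩
  show jetMap n A.rho (A.vert n k) = 0
  rw [vert, map_sub, jetMap_sec, sub_self]

lemma jetMap_act_vert (hn : 0 < n) (T : TakiffData D.b q n) (r k : (D.Pos ⊕ D.Pos) × Fin n) :
    jetMap n A.rho (act T.basis (T.τ r.2.1 (D.b (A.row r.1))) (A.vert n k)) =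
      jetMatrix n A.mat' r k := by
  obtain ⟨r, c⟩ := r
  obtain ⟨k, a⟩ := k
  obtain ⟨e, he⟩ := A.sec_jetMap_col k a
  rw [vert, map_sub, he, derivation_C, sub_zero, act_X, T.basis_apply, T.lie_τ, jetMatrix,
    Matrix.of_apply]
  simp only
  split_ifs with hca
  · have hca : c.1 ≤ a.1 := hca
    have h1 := T.coeff_jet_lin ⁅D.b (A.row r), D.b (A.col k)⁆ ⟨a.1 - c.1, by omega⟩
    have h2 : c.1 + (n - 1 - a.1) = n - 1 - (a.1 - c.1) := by omega
    rw [h2, ← h1, jetMap_coeff_jet (A.coeff_jet_rho_eq_zero hn)]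
    rfl
  · have hca : a.1 < c.1 := not_le.1 hca
    rw [T.τ_eq_zero _ (by omega)]
    simp

/-- Invariants of the Lie algebra of jets are determined by their restriction to the slice. -/
lemma eq_zero_of_jetMap_eq_zero (hn : 0 < n) (T : TakiffData D.b q n)
    {G : MvPolynomial ((Φ ⊕ Λ) × Fin n) ℂ} (hG : ∀ y, act T.basis y G = 0)
    (h : jetMap n A.rho G = 0) : G = 0 := by
  classical
  let v : (D.Pos ⊕ D.Pos) × Fin n → MvPolynomial ((Φ ⊕ Λ) × Fin n) ℂ := A.vert n
  let u : (D.Pos ⊕ D.Pos) × Fin n → Derivation ℂ (MvPolynomial ((Φ ⊕ Λ) × Fin n) ℂ)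
    (MvPolynomial ((Φ ⊕ Λ) × Fin n) ℂ) := fun r => act T.basis (T.τ r.2.1 (D.b (A.row r.1)))
  have hdet : IsUnit (jetMatrix n A.mat').det := by
    rw [det_jetMatrix A.mat' A.omega' lev (fun i j => A.mat'_eq_zero) (fun i j => A.mat'_eq)
      fun i j => A.omega'_eq_zero]
    exact (isUnit_iff_ne_zero.2 (pow_ne_zero _ A.det_omega'_ne_zero)).map C
  let Y : (D.Pos ⊕ D.Pos) × Fin n → (D.Pos ⊕ D.Pos) × Fin n →
    MvPolynomial ((Φ ⊕ Λ) × Fin n) ℂ := fun k r => A.sec n ((jetMatrix n A.mat')⁻¹ k r)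
  have hYN : ∀ k' k, ∑ i, Y k' i * u i (v k) - (if k' = k then 1 else 0) ∈
      Ideal.span (Set.range v) := by
    intro k' k
    refine A.mem_span_vert ?_
    have h1 := congrFun (congrFun (Matrix.nonsing_inv_mul _ hdet) k') k
    rw [Matrix.mul_apply, Matrix.one_apply] at h1
    rw [map_sub, map_sum, sub_eq_zero]
    refine (Finset.sum_congr rfl fun i _ => ?_).trans (h1.trans ?_)
    · rw [map_mul]
      congr 1
      · exact A.jetMap_sec _
      · exact A.jetMap_act_vert hn T i k
    · split_ifs <;> simp
  have hmem : ∀ K, G ∈ Ideal.span (Set.range v) ^ K := by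
    intro K
    refine mem_pow_of_euler_mem v u Y 1 hYN (fun k x hx => by rwa [one_mul] at hx)
      (A.mem_span_vert h) ?_
    rw [euler_apply, Finset.sum_eq_zero]
    · exact zero_mem _
    · intro r _
      rw [show u r G = 0 from hG _, mul_zero]
  have htop : Ideal.span (Set.range v) ≠ ⊤ := by
    intro htop
    have h1 : (1 : MvPolynomial ((Φ ⊕ Λ) × Fin n) ℂ) ∈ Ideal.span (Set.range v) := by
      rw [htop]
      trivial
    have := A.jetMap_eq_zero h1
    rw [map_one] at this
    exact one_ne_zero this
  have hbot := Ideal.iInf_pow_eq_bot_of_isDomain _ htop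
  rw [← Ideal.mem_bot, ← hbot, Ideal.mem_iInf]
  exact hmem

/-- The center of the enveloping algebra of a Lie algebra of jets is a polynomial algebra. -/
theorem nonempty_center_equiv (hn : 0 < n) (T : TakiffData D.b q n)
    (had : Function.Injective (LieAlgebra.ad ℂ g)) :
    Nonempty (Subalgebra.center ℂ (UniversalEnvelopingAlgebra ℂ q) ≃ₐ[ℂ]
      MvPolynomial (A.Z × Fin n) ℂ) := by
  choose F hFd hFi hF using A.exists_invariant_extension
  choose d hd using hFd
  let Fj : A.Z × Fin n → MvPolynomial ((Φ ⊕ Λ) × Fin n) ℂ := fun i =>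
    PowerSeries.coeff i.2.1 (jet (Φ ⊕ Λ) n (F i.1))
  have hFj : ∀ i, jetMap n A.rho (Fj i) = X i := by
    intro i
    have h1 : A.rho (F i.1) = X i.1 := hF i.1
    rw [jetMap_coeff_jet (A.coeff_jet_rho_eq_zero hn), h1, coeff_jet_X]
  have hinv : ∀ i y, act T.basis y (Fj i) = 0 := fun i y =>
    T.act_coeff_jet_of_invariant (hFi i.1) i.2 y
  have hleft : ∀ p : MvPolynomial (A.Z × Fin n) ℂ, jetMap n A.rho (aeval Fj p) = p := by
    intro p
    have h : (jetMap n A.rho).comp (aeval (R := ℂ) Fj) = AlgHom.id ℂ _ :=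
      MvPolynomial.algHom_ext fun i => by rw [AlgHom.comp_apply, aeval_X, hFj]; rfl
    exact DFunLike.congr_fun h p
  refine TakiffCenter.nonempty_center_equiv T.basis (T.ad_injective had) Fj (fun i => d i.1)
    (fun i => coeff_jet_isHomogeneous (hd i.1) _) hinv (Function.LeftInverse.injective hleft) ?_
  intro f hf
  refine ⟨jetMap n A.rho f, ?_⟩
  rw [← sub_eq_zero]
  refine A.eq_zero_of_jetMap_eq_zero hn T (fun y => ?_) ?_
  · have h1 : ∀ p : MvPolynomial (A.Z × Fin n) ℂ, act T.basis y (aeval Fj p) = 0 := by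
      intro p
      induction p using MvPolynomial.induction_on with
      | C c => rw [← algebraMap_eq, AlgHom.commutes, Derivation.map_algebraMap]
      | add p q hp hq => rw [map_add, map_add, hp, hq, add_zero]
      | mul_X p i hp =>
        rw [map_mul, aeval_X, Derivation.leibniz, hp, hinv, smul_zero, smul_zero, add_zero]
    rw [map_sub, h1, hf, sub_zero]
  · rw [map_sub, hleft, sub_self]

end Transversal

end RootData

section Cartan

open LieAlgebra

/-- A Lie algebra over an infinite field has a Cartan subalgebra of dimension equal to the rank. -/
lemma exists_isCartanSubalgebra_finrank_eq (K L : Type) [Field K] [Infinite K] [LieRing L]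
    [LieAlgebra K L] [FiniteDimensional K L] :
    ∃ H : LieSubalgebra K L, H.IsCartanSubalgebra ∧ Module.finrank K H = LieAlgebra.rank K L := by
  obtain ⟨x, hx⟩ := LieAlgebra.exists_isRegular K L
  have hr := (isRegular_iff_finrank_engel_eq_rank K x).mp hx
  refine ⟨LieSubalgebra.engel K x, ⟨?_, LieSubalgebra.normalizer_engel _ _⟩, hr⟩
  apply LieSubalgebra.isNilpotent_of_forall_le_engel
  intro y hy
  have hbot : IsBot (⟨LieSubalgebra.engel K x, x, LieSubalgebra.self_mem_engel _ _, rfl⟩ :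
      {LieSubalgebra.engel K z | z ∈ LieSubalgebra.engel K x}) := by
    refine engel_isBot_of_isMin
      (Cardinal.natCast_le_aleph0.trans <| Cardinal.infinite_iff.mp ‹Infinite K›)
      (LieSubalgebra.engel K x) _ le_rfl ?_
    rintro ⟨_, y, hy, rfl⟩ hyx
    have h1 : Module.finrank K (LieSubalgebra.engel K x) ≤
        Module.finrank K (LieSubalgebra.engel K y) := by
      rw [hr]
      exact rank_le_finrank_engel _ _
    have h2 : LieSubalgebra.engel K y = LieSubalgebra.engel K x := by
      apply LieSubalgebra.toSubmodule_injective
      exact Submodule.eq_of_le_of_finrank_le hyx h1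
    exact h2.ge
  exact hbot ⟨LieSubalgebra.engel K y, y, hy, rfl⟩

end Cartan

section RootVectors

open LieAlgebra LieAlgebra.IsKilling LieModule

variable {L : Type} [LieRing L] [LieAlgebra ℂ L] [FiniteDimensional ℂ L]
  {H : LieSubalgebra ℂ L} [H.IsCartanSubalgebra]

/-- A nonzero vector in a root space. -/
def rootVec (α : H.root) : L := (α : Weight ℂ H L).exists_ne_zero.choose

lemma rootVec_mem (α : H.root) : rootVec α ∈ rootSpace H (α : Weight ℂ H L) :=
  (α : Weight ℂ H L).exists_ne_zero.choose_spec.1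

lemma rootVec_ne_zero (α : H.root) : rootVec α ≠ 0 :=
  (α : Weight ℂ H L).exists_ne_zero.choose_spec.2

variable [IsKilling ℂ L]

lemma exists_eq_smul_rootVec (α : H.root) {y : L}
    (hy : y ∈ rootSpace H (α : Weight ℂ H L)) : ∃ c : ℂ, y = c • rootVec α := by
  have h := finrank_rootSpace_eq_one (α : Weight ℂ H L) (H.isNonZero_coe_root α)
  obtain ⟨c, hc⟩ := (finrank_eq_one_iff_of_nonzero' (K := ℂ)
    (⟨rootVec α, rootVec_mem α⟩ : rootSpace H (α : Weight ℂ H L))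
    (fun h0 => rootVec_ne_zero α (congrArg Subtype.val h0))).mp h ⟨y, hy⟩
  exact ⟨c, (congrArg Subtype.val hc).symm⟩

lemma lie_cartan_rootVec (h : H) (α : H.root) :
    ⁅(h : L), rootVec α⁆ = (α : Weight ℂ H L) h • rootVec α :=
  lie_eq_smul_of_mem_rootSpace (rootVec_mem α) h

variable (H) in
/-- A basis of the Lie algebra made of root vectors and a basis of the Cartan subalgebra. -/
lemma exists_rootBasis {Λ : Type} (e : Module.Basis Λ ℂ H) :
    ∃ b : Module.Basis (H.root ⊕ Λ) ℂ L,
      (∀ α, b (Sum.inl α) = rootVec α) ∧ ∀ i, b (Sum.inr i) = (e i : L) := by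
  have hind : iSupIndep fun χ : H → ℂ => (rootSpace H χ).toSubmodule :=
    LieSubmodule.iSupIndep_toSubmodule.mpr (iSupIndep_genWeightSpace ℂ H L)
  have hinj : Function.Injective fun α : H.root => ((α : Weight ℂ H L) : H → ℂ) :=
    DFunLike.coe_injective.comp Subtype.val_injective
  have hzero : ∀ y : L, y ∈ rootSpace H (0 : H → ℂ) ↔ y ∈ H := by
    intro y
    rw [rootSpace_zero_eq ℂ L H]
    rfl
  have hli : LinearIndependent ℂ (Sum.elim (rootVec : H.root → L) fun i => (e i : L)) := by
    refine LinearIndependent.sum_type ?_ ?_ ?_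
    · exact (hind.comp hinj).linearIndependent _ (fun α => rootVec_mem α) rootVec_ne_zero
    · exact e.linearIndependent.map' H.toSubmodule.subtype (Submodule.ker_subtype _)
    · refine ((hind 0).mono (Submodule.span_le.mpr ?_) (Submodule.span_le.mpr ?_)).symm
      · rintro _ ⟨i, rfl⟩
        exact (hzero _).mpr (e i).2
      · rintro _ ⟨α, rfl⟩
        have hne : ((α : Weight ℂ H L) : H → ℂ) ≠ 0 := H.isNonZero_coe_root α
        exact Submodule.mem_iSup_of_mem _ (Submodule.mem_iSup_of_mem hne (rootVec_mem α))
  have hsp : ⊤ ≤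
      Submodule.span ℂ (Set.range (Sum.elim (rootVec : H.root → L) fun i => (e i : L))) := by
    have htop := iSup_genWeightSpace_eq_top' ℂ H L
    rw [← LieSubmodule.toSubmodule_inj, LieSubmodule.iSup_toSubmodule] at htop
    rw [← LieSubmodule.top_toSubmodule (R := ℂ) (L := H), ← htop]
    refine iSup_le fun χ y hy => ?_
    by_cases hχ : χ.IsZero
    · replace hy : y ∈ H := (hzero y).mp (by rw [← hχ]; exact hy)
      have hmem : (⟨y, hy⟩ : H) ∈ Submodule.span ℂ (Set.range e) := by rw [e.span_eq]; trivial
      have h2 := Submodule.mem_map_of_mem (f := H.toSubmodule.subtype) hmem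
      rw [Submodule.map_span, ← Set.range_comp] at h2
      refine Submodule.span_mono ?_ h2
      rintro _ ⟨i, rfl⟩
      exact ⟨Sum.inr i, rfl⟩
    · obtain ⟨c, rfl⟩ :=
        exists_eq_smul_rootVec (⟨χ, by simpa [LieSubalgebra.root] using hχ⟩ : H.root) hy
      exact Submodule.smul_mem _ _ (Submodule.subset_span ⟨Sum.inl _, rfl⟩)
  exact ⟨Module.Basis.mk hli hsp, fun α => by simp, fun i => by simp⟩

end RootVectors

section RootSystem

open LieAlgebra LieAlgebra.IsKilling LieModule

variable {L : Type} [LieRing L] [LieAlgebra ℂ L] [FiniteDimensional ℂ L] [IsKilling ℂ L]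
  {H : LieSubalgebra ℂ L} [H.IsCartanSubalgebra]

/-- The negative of a root. -/
def negRoot (α : H.root) : H.root := (rootSystem H).reflectionPerm α α

lemma root_negRoot (α : H.root) :
    (rootSystem H).root (negRoot α) = -(rootSystem H).root α := by
  rw [negRoot, RootPairing.root_reflectionPerm, RootPairing.reflection_apply_self]

lemma negRoot_apply (α : H.root) (h : H) :
    (negRoot α : Weight ℂ H L) h = -(α : Weight ℂ H L) h :=
  DFunLike.congr_fun (root_negRoot α) h

lemma coe_negRoot (α : H.root) : (negRoot α : Weight ℂ H L) = -(α : Weight ℂ H L) := by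
  ext h
  exact negRoot_apply α h

lemma negRoot_negRoot (α : H.root) : negRoot (negRoot α) = α := by
  apply Subtype.ext
  rw [coe_negRoot, coe_negRoot, neg_neg]

lemma rootVec_negRoot_mem (α : H.root) :
    rootVec (negRoot α) ∈ rootSpace H (-((α : Weight ℂ H L) : H → ℂ)) := by
  have h := rootVec_mem (negRoot α)
  rwa [coe_negRoot, Weight.coe_neg] at h

lemma killingForm_rootVec_negRoot_ne_zero (α : H.root) :
    killingForm ℂ L (rootVec α) (rootVec (negRoot α)) ≠ 0 := by
  intro h0
  have h := mem_ker_killingForm_of_mem_rootSpace_of_forall_rootSpace_neg ℂ L H (rootVec_mem α)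
    (fun y hy => by
      rw [← Weight.coe_neg, ← coe_negRoot] at hy
      obtain ⟨c, rfl⟩ := exists_eq_smul_rootVec _ hy
      rw [map_smul, h0, smul_zero])
  rw [ker_killingForm_eq_bot] at h
  exact rootVec_ne_zero α h

lemma killingForm_rootVec_eq_zero {α β : H.root} (h : β ≠ negRoot α) :
    killingForm ℂ L (rootVec α) (rootVec β) = 0 := by
  refine killingForm_apply_eq_zero_of_mem_rootSpace_of_add_ne_zero ℂ L H (rootVec_mem α)
    (rootVec_mem β) fun h0 => h (Subtype.ext ?_)
  rw [coe_negRoot]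
  apply DFunLike.coe_injective
  rw [Weight.coe_neg]
  exact eq_neg_of_add_eq_zero_right h0

omit [IsKilling ℂ L] in
lemma killingForm_rootVec_cartan (α : H.root) (h : H) :
    killingForm ℂ L (rootVec α) h = 0 := by
  refine killingForm_apply_eq_zero_of_mem_rootSpace_of_add_ne_zero ℂ L H (β := 0) (rootVec_mem α)
    ?_ ?_
  · rw [rootSpace_zero_eq ℂ L H]
    exact h.2
  · rw [add_zero]
    exact H.isNonZero_coe_root α

/-- The bracket of opposite root vectors, as an element of the Cartan subalgebra. -/
def cartanVec (α : H.root) : H :=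
  killingForm ℂ L (rootVec α) (rootVec (negRoot α)) •
    (cartanEquivDual H).symm (α : Weight ℂ H L)

lemma lie_rootVec_negRoot (α : H.root) :
    ⁅rootVec α, rootVec (negRoot α)⁆ = (cartanVec α : L) :=
  lie_eq_killingForm_smul_of_mem_rootSpace_of_mem_rootSpace_neg (rootVec_mem α)
    (rootVec_negRoot_mem α)

lemma exists_cartanVec_eq_smul_coroot (α : H.root) :
    ∃ d : ℂ, d ≠ 0 ∧ cartanVec α = d • (rootSystem H).coroot α := by
  have h1 := root_apply_cartanEquivDual_symm_ne_zero (H.isNonZero_coe_root α)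
  have h2 := killingForm_rootVec_negRoot_ne_zero α
  refine ⟨killingForm ℂ L (rootVec α) (rootVec (negRoot α)) *
    ((2 : ℂ)⁻¹ * (α : Weight ℂ H L) ((cartanEquivDual H).symm (α : Weight ℂ H L))),
    mul_ne_zero h2 (mul_ne_zero (inv_ne_zero two_ne_zero) h1), ?_⟩
  rw [rootSystem_coroot_apply, coroot, cartanVec, mul_smul]
  congr 1
  rw [two_smul, ← two_smul ℂ, smul_smul, smul_smul]
  rw [show ((2 : ℂ)⁻¹ * (α : Weight ℂ H L) ((cartanEquivDual H).symm (α : Weight ℂ H L)) * 2 *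
    ((α : Weight ℂ H L) ((cartanEquivDual H).symm (α : Weight ℂ H L)))⁻¹) = 1 by field_simp,
    one_smul]

lemma root_apply_cartanVec_ne_zero (α : H.root) : (α : Weight ℂ H L) (cartanVec α) ≠ 0 := by
  obtain ⟨d, hd, h⟩ := exists_cartanVec_eq_smul_coroot α
  rw [h]
  have h2 : (α : Weight ℂ H L) ((rootSystem H).coroot α) = 2 :=
    root_apply_coroot (H.isNonZero_coe_root α)
  have h3 : (α : Weight ℂ H L) (d • (rootSystem H).coroot α) = d * 2 := by
    rw [← h2]
    exact map_smul (Weight.toLinear ℂ H L (α : Weight ℂ H L)) d _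
  rw [h3]
  exact mul_ne_zero hd two_ne_zero

lemma cartanVec_ne_smul {α β : H.root} (h1 : β ≠ α) (h2 : β ≠ negRoot α) (c : ℂ) :
    cartanVec β ≠ c • cartanVec α := by
  intro h
  have hk := killingForm_rootVec_negRoot_ne_zero β
  have h3 := congrArg (cartanEquivDual H) h
  simp only [cartanVec, map_smul, LinearEquiv.apply_symm_apply] at h3
  have h4 : ((β : Weight ℂ H L) : H → ℂ) =
      ((killingForm ℂ L (rootVec β) (rootVec (negRoot β)))⁻¹ * (c *
        killingForm ℂ L (rootVec α) (rootVec (negRoot α)))) • ((α : Weight ℂ H L) : H → ℂ) := by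
    funext x
    have h5 := DFunLike.congr_fun h3 x
    simp only [LinearMap.smul_apply, Weight.toLinear_apply, smul_eq_mul] at h5
    simp only [Pi.smul_apply, smul_eq_mul]
    field_simp
    linear_combination h5
  rcases eq_neg_or_eq_of_eq_smul _ _ (H.isNonZero_coe_root β) _ h4 with h6 | h6
  · exact h2 (Subtype.ext (by rw [coe_negRoot, h6]))
  · exact h1 (Subtype.ext h6)

lemma lie_rootVec_rootVec {α β : H.root} (h : β ≠ negRoot α) :
    ⁅rootVec α, rootVec β⁆ = 0 ∨ ∃ γ : H.root, ∃ c : ℂ, ⁅rootVec α, rootVec β⁆ = c • rootVec γ ∧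
      (rootSystem H).root γ = (rootSystem H).root α + (rootSystem H).root β := by
  by_cases h0 : ⁅rootVec α, rootVec β⁆ = 0
  · exact Or.inl h0
  right
  have hmem : ⁅rootVec α, rootVec β⁆ ∈
      rootSpace H (((α : Weight ℂ H L) : H → ℂ) + ((β : Weight ℂ H L) : H → ℂ)) :=
    lie_mem_genWeightSpace_of_mem_genWeightSpace (rootVec_mem α) (rootVec_mem β)
  let W : Weight ℂ H L := ⟨((α : Weight ℂ H L) : H → ℂ) + ((β : Weight ℂ H L) : H → ℂ), by
    intro hbot
    exact h0 ((LieSubmodule.eq_bot_iff _).mp hbot _ hmem)⟩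
  have hW : W.IsNonZero := by
    intro hz
    apply h
    apply Subtype.ext
    rw [coe_negRoot]
    apply DFunLike.coe_injective
    rw [Weight.coe_neg]
    exact eq_neg_of_add_eq_zero_right hz
  let γ : H.root := ⟨W, by simpa [LieSubalgebra.root] using hW⟩
  obtain ⟨c, hc⟩ := exists_eq_smul_rootVec γ (y := ⁅rootVec α, rootVec β⁆) hmem
  exact ⟨γ, c, hc, rfl⟩

lemma root_ne_add_self (α γ : H.root) :
    (rootSystem H).root γ ≠ (rootSystem H).root α + (rootSystem H).root α := by
  intro h
  have h1 := rootSpace_two_smul (α : Weight ℂ H L) (H.isNonZero_coe_root α)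
  apply (γ : Weight ℂ H L).genWeightSpace_ne_bot
  rw [← h1]
  congr 1
  funext x
  have h2 := DFunLike.congr_fun h x
  simp only [rootSystem_root_apply, LinearMap.add_apply, Weight.toLinear_apply] at h2
  rw [h2, two_smul]
  rfl

end RootSystem

section CartanForm

variable {L : Type} [LieRing L] [LieAlgebra ℂ L] {H : LieSubalgebra ℂ L} {Λ : Type} [Fintype Λ]
  (e : Module.Basis Λ ℂ H)

/-- The linear form on the dual of the Cartan subalgebra given by an element. -/
def cartanForm (h : H) : MvPolynomial Λ ℂ :=
  linForm fun i => e.repr h i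

lemma pair_repr (h : H) (f : Module.Dual ℂ H) :
    pair (fun i => e.repr h i) (fun i => f (e i)) = f h := by
  conv_rhs => rw [← e.sum_repr h, map_sum]
  simp [pair]

lemma cartanForm_basis (i : Λ) : cartanForm e (e i) = X i := by
  classical
  rw [cartanForm, linForm, Finset.sum_eq_single i]
  · simp
  · intro j _ hj
    simp [hj.symm]
  · simp

lemma cartanForm_add (h k : H) : cartanForm e (h + k) = cartanForm e h + cartanForm e k := by
  simp [cartanForm, linForm, add_mul, Finset.sum_add_distrib]

lemma cartanForm_smul (c : ℂ) (h : H) : cartanForm e (c • h) = C c * cartanForm e h := by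
  simp [cartanForm, linForm, Finset.mul_sum, mul_assoc]

lemma algHom_ext_cartanForm {T₁ T₂ : MvPolynomial Λ ℂ →ₐ[ℂ] MvPolynomial Λ ℂ}
    (h : ∀ k : H, T₁ (cartanForm e k) = T₂ (cartanForm e k)) : T₁ = T₂ := by
  refine MvPolynomial.algHom_ext fun i => ?_
  rw [← cartanForm_basis e i, h]

end CartanForm

section Height

open LieAlgebra LieAlgebra.IsKilling LieModule

variable {L : Type} [LieRing L] [LieAlgebra ℂ L] [FiniteDimensional ℂ L] [IsKilling ℂ L]
  {H : LieSubalgebra ℂ L} [H.IsCartanSubalgebra] (B : (rootSystem H).Base)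

lemma height_negRoot (α : H.root) : B.height (negRoot α) = -B.height α :=
  B.height_reflectionPerm_self α

/-- The sum of the fundamental coweights. -/
lemma exists_apply_eq_height :
    ∃ h : H, ∀ α : H.root, (α : Weight ℂ H L) h = B.height α := by
  let φ : Module.Dual ℂ (Module.Dual ℂ H) := B.toWeightBasis.constr ℂ fun _ => 1
  refine ⟨(Module.evalEquiv ℂ H).symm φ, fun α => ?_⟩
  have h1 : (α : Weight ℂ H L) ((Module.evalEquiv ℂ H).symm φ) = φ ((rootSystem H).root α) := by
    rw [← Module.apply_evalEquiv_symm_apply]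
    rfl
  have hsimple : ∀ j ∈ B.support, φ ((rootSystem H).root j) = 1 := by
    intro j hj
    have h2 := B.toWeightBasis.constr_basis ℂ (fun _ => (1 : ℂ)) ⟨j, hj⟩
    rwa [RootPairing.Base.toWeightBasis_apply] at h2
  obtain ⟨f, -, -, hf⟩ := B.exists_root_eq_sum_int α
  rw [h1, RootPairing.Base.height_eq_sum hf, hf, map_sum, Int.cast_sum]
  refine Finset.sum_congr rfl fun j hj => ?_
  rw [map_zsmul, hsimple j hj, zsmul_eq_mul, mul_one]

lemma mem_support_or_two_le_height {α : H.root} (hα : B.IsPos α) :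
    α ∈ B.support ∨ 2 ≤ B.height α := by
  have h : B.IsPos α ∧ (α ∈ B.support ∨ 2 ≤ B.height α) := by
    refine hα.induction_on_add (p := fun α => B.IsPos α ∧ (α ∈ B.support ∨ 2 ≤ B.height α))
      (fun i hi => ⟨RootPairing.Base.isPos_of_mem_support hi, Or.inl hi⟩) ?_
    intro i j k hk hi hj
    have h1 := B.height_add hk
    have h2 := RootPairing.Base.height_one_of_mem_support hj
    have h3 : 0 < B.height i := hi.1
    refine ⟨?_, Or.inr (by omega)⟩
    rw [RootPairing.Base.isPos_iff]
    omega
  exact h.2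

lemma height_eq_one_iff (α : H.root) : B.height α = 1 ↔ α ∈ B.support := by
  refine ⟨fun h => ?_, fun h => RootPairing.Base.height_one_of_mem_support h⟩
  rcases mem_support_or_two_le_height B (α := α) (by rw [RootPairing.Base.isPos_iff]; omega)
    with h1 | h1
  · exact h1
  · omega

section Reflection

variable {Λ : Type} [Fintype Λ] (e : Module.Basis Λ ℂ H)

/-- The reflection of polynomial functions attached to a root. -/
def rootReflHom (α : H.root) : MvPolynomial Λ ℂ →ₐ[ℂ] MvPolynomial Λ ℂ :=
  reflHom (fun i => e.repr (cartanVec α) i) fun i => (α : Weight ℂ H L) (e i)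

lemma rootReflHom_cartanForm (α : H.root) (h : H) :
    rootReflHom e α (cartanForm e h) = cartanForm e ((rootSystem H).coreflection α h) := by
  obtain ⟨d, hd, hc⟩ := exists_cartanVec_eq_smul_coroot α
  have hα2 : (α : Weight ℂ H L) ((rootSystem H).coroot α) = 2 :=
    root_apply_coroot (H.isNonZero_coe_root α)
  have hp : pair (fun i => e.repr (cartanVec α) i) (fun i => (α : Weight ℂ H L) (e i)) = d * 2 := by
    rw [show pair (fun i => e.repr (cartanVec α) i) (fun i => (α : Weight ℂ H L) (e i)) =
      (rootSystem H).root α (cartanVec α) from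
        pair_repr e (cartanVec α) ((rootSystem H).root α), hc, map_smul, smul_eq_mul]
    congr 1
  have hX : ∀ i, rootReflHom e α (X i) =
      X i - C ((α : Weight ℂ H L) (e i)) * cartanForm e ((rootSystem H).coroot α) := by
    intro i
    rw [rootReflHom, reflHom, aeval_X, hp]
    congr 1
    have h2 : linForm (fun i => e.repr (cartanVec α) i) =
        C d * cartanForm e ((rootSystem H).coroot α) := by
      rw [← cartanForm_smul, ← hc]
      rfl
    rw [h2, ← mul_assoc, ← C_mul]
    congr 2
    field_simp
  have hsum : ∀ k : H, cartanForm e k = ∑ i, C (e.repr k i) * X i := fun k => rfl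
  have hrefl : (rootSystem H).coreflection α h =
      h + (-(α : Weight ℂ H L) h) • (rootSystem H).coroot α := by
    rw [neg_smul, ← sub_eq_add_neg]
    rfl
  have hαh : (α : Weight ℂ H L) h = ∑ i, e.repr h i * (α : Weight ℂ H L) (e i) :=
    (pair_repr e h ((rootSystem H).root α)).symm
  rw [hrefl, cartanForm_add, cartanForm_smul, hsum h, map_sum, hαh, C_neg, map_sum, neg_mul,
    Finset.sum_mul, ← sub_eq_add_neg, ← Finset.sum_sub_distrib]
  refine Finset.sum_congr rfl fun i _ => ?_
  rw [map_mul, hX, C_mul, ← algebraMap_eq, AlgHom.commutes]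
  ring

lemma coreflection_reflectionPerm (α β : H.root) (k : H) :
    (rootSystem H).coreflection ((rootSystem H).reflectionPerm β α) k =
      (rootSystem H).coreflection β ((rootSystem H).coreflection α
        ((rootSystem H).coreflection β k)) := by
  have h := RootPairing.reflection_reflectionPerm (P := (rootSystem H).flip) (i := α) (j := β)
  exact LinearEquiv.congr_fun h k

lemma rootReflHom_reflectionPerm (α β : H.root) :
    rootReflHom e ((rootSystem H).reflectionPerm β α) =
      (rootReflHom e β).comp ((rootReflHom e α).comp (rootReflHom e β)) := by
  refine algHom_ext_cartanForm e fun k => ?_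
  simp only [AlgHom.comp_apply, rootReflHom_cartanForm, coreflection_reflectionPerm]

lemma rootReflHom_fixed_of_simple (f : MvPolynomial Λ ℂ)
    (hf : ∀ α, B.height α = 1 → rootReflHom e α f = f) (α : H.root) :
    rootReflHom e α f = f := by
  refine B.induction_reflect (p := fun α => rootReflHom e α f = f) α ?_ ?_ ?_
  · intro α hα
    rw [rootReflHom_reflectionPerm]
    simp only [AlgHom.comp_apply, hα]
  · intro α hα
    exact hf α (RootPairing.Base.height_one_of_mem_support hα)
  · intro α β hα hβ
    have hβ' := hf β (RootPairing.Base.height_one_of_mem_support hβ)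
    rw [rootReflHom_reflectionPerm]
    simp only [AlgHom.comp_apply, hα, hβ']

end Reflection

end Height

section RegularNilpotent

open LieAlgebra LieAlgebra.IsKilling LieModule

variable {L : Type} [LieRing L] [LieAlgebra ℂ L] [FiniteDimensional ℂ L] [IsKilling ℂ L]
  {H : LieSubalgebra ℂ L} [H.IsCartanSubalgebra] (B : (rootSystem H).Base)

open Classical in
/-- The sum of the simple root vectors. -/
def regNilp : L := ∑ α : H.root with B.height α = 1, rootVec α

/-- The Killing form with the sum of the simple root vectors. -/
def regChar : L →ₗ[ℂ] ℂ := killingForm ℂ L (regNilp B)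

/-- The span of the negative root vectors. -/
def negSpan : Submodule ℂ L := Submodule.span ℂ {x | ∃ α, B.height α < 0 ∧ x = rootVec α}

lemma regChar_cartan (h : H) : regChar B h = 0 := by
  simp [regChar, regNilp, killingForm_rootVec_cartan]

lemma regChar_rootVec_ne_zero_iff (α : H.root) :
    regChar B (rootVec α) ≠ 0 ↔ B.height α = -1 := by
  classical
  simp only [regChar, regNilp, map_sum, LinearMap.sum_apply]
  constructor
  · intro h
    obtain ⟨β, hβ, h1⟩ := Finset.exists_ne_zero_of_sum_ne_zero h
    have h2 : α = negRoot β := by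
      by_contra h2
      exact h1 (killingForm_rootVec_eq_zero h2)
    rw [h2, height_negRoot, (Finset.mem_filter.mp hβ).2]
  · intro h
    rw [Finset.sum_eq_single (negRoot α)]
    · have := killingForm_rootVec_negRoot_ne_zero (negRoot α)
      rwa [negRoot_negRoot] at this
    · intro β _ hβ
      refine killingForm_rootVec_eq_zero fun h2 => hβ ?_
      rw [h2, negRoot_negRoot]
    · intro h2
      exact absurd (Finset.mem_filter.mpr
        ⟨Finset.mem_univ _, by rw [height_negRoot, h, neg_neg]⟩) h2

variable (H) in
lemma eq_zero_of_killingForm_eq_zero {v : L} (h1 : ∀ h : H, killingForm ℂ L v h = 0)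
    (h2 : ∀ β : H.root, killingForm ℂ L v (rootVec β) = 0) : v = 0 := by
  obtain ⟨b, hb1, hb2⟩ := exists_rootBasis H (Module.finBasis ℂ H)
  have h : killingForm ℂ L v = 0 := by
    refine b.ext fun i => ?_
    rcases i with α | i
    · rw [hb1, h2, LinearMap.zero_apply]
    · rw [hb2, h1, LinearMap.zero_apply]
  have h3 : v ∈ LinearMap.ker (killingForm ℂ L) := h
  rwa [ker_killingForm_eq_bot, Submodule.mem_bot] at h3

lemma killingForm_negSpan_cartan {u : L} (hu : u ∈ negSpan B) (h : H) :
    killingForm ℂ L u h = 0 := by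
  have : negSpan B ≤ LinearMap.ker ((killingForm ℂ L).flip (h : L)) := by
    refine Submodule.span_le.mpr ?_
    rintro _ ⟨α, -, rfl⟩
    exact killingForm_rootVec_cartan α h
  exact this hu

lemma killingForm_negSpan_rootVec {u : L} (hu : u ∈ negSpan B) {β : H.root}
    (hβ : B.height β < 0) : killingForm ℂ L u (rootVec β) = 0 := by
  have : negSpan B ≤ LinearMap.ker ((killingForm ℂ L).flip (rootVec β)) := by
    refine Submodule.span_le.mpr ?_
    rintro _ ⟨α, hα, rfl⟩
    refine killingForm_rootVec_eq_zero fun h => ?_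
    rw [h, height_negRoot] at hβ
    omega
  exact this hu

lemma height_eq_add {α β γ : H.root}
    (h : (rootSystem H).root γ = (rootSystem H).root α + (rootSystem H).root β) :
    B.height γ = B.height α + B.height β := B.height_add h

lemma regChar_lie_negSpan {u : L} (hu : u ∈ negSpan B) {β : H.root}
    (hβ : B.height β < 0) : regChar B ⁅u, rootVec β⁆ = 0 := by
  have : negSpan B ≤ LinearMap.ker ((regChar B).comp
      ((LieModule.toEnd ℂ L L : L →ₗ[ℂ] Module.End ℂ L).flip (rootVec β))) := by
    refine Submodule.span_le.mpr ?_
    rintro _ ⟨α, hα, rfl⟩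
    change regChar B ⁅rootVec α, rootVec β⁆ = 0
    have hne : β ≠ negRoot α := by
      intro h
      rw [h, height_negRoot] at hβ
      omega
    rcases lie_rootVec_rootVec hne with h | ⟨γ, c, h, hγ⟩
    · rw [h, map_zero]
    · rw [h, map_smul]
      have h1 := height_eq_add B hγ
      have h2 : regChar B (rootVec γ) = 0 := by
        by_contra h2
        rw [← ne_eq, regChar_rootVec_ne_zero_iff] at h2
        omega
      rw [h2, smul_zero]
  exact this hu

lemma killingForm_lie_regNilp (u y : L) :
    killingForm ℂ L ⁅regNilp B, u⁆ y = regChar B ⁅u, y⁆ :=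
  LieModule.traceForm_apply_lie_apply ℂ L L _ _ _

lemma lie_regNilp_eq_zero {u : L} (hu : u ∈ negSpan B)
    (h1 : ∀ h : H, regChar B ⁅u, (h : L)⁆ = 0)
    (h2 : ∀ α : H.root, 0 < B.height α → regChar B ⁅u, rootVec α⁆ = 0) :
    ⁅regNilp B, u⁆ = 0 := by
  refine eq_zero_of_killingForm_eq_zero H (fun h => ?_) fun β => ?_
  · rw [killingForm_lie_regNilp, h1]
  · rw [killingForm_lie_regNilp]
    rcases lt_trichotomy (B.height β) 0 with h | h | h
    · exact regChar_lie_negSpan B hu h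
    · exact absurd h (B.height_ne_zero β)
    · exact h2 β h

lemma lie_rootVec_negRoot_simple {α β : H.root} (hα : α ∈ B.support) (hβ : β ∈ B.support)
    (hne : α ≠ β) : ⁅rootVec α, rootVec (negRoot β)⁆ = 0 := by
  have h : negRoot β ≠ negRoot α := fun h => hne (by
    rw [← negRoot_negRoot α, ← h, negRoot_negRoot])
  rcases lie_rootVec_rootVec h with h | ⟨γ, c, h, hγ⟩
  · exact h
  · refine absurd ⟨γ, ?_⟩ (B.sub_notMem_range_root hα hβ)
    rw [hγ, root_negRoot, sub_eq_add_neg]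

open Classical in
/-- The regular nilpotent element is part of an `sl₂`-triple. -/
lemma exists_isSl2Triple_regNilp (ρ : H) (hρ : ∀ α : H.root, (α : Weight ℂ H L) ρ = B.height α)
    (h0 : ρ ≠ 0) : ∃ f : L, IsSl2Triple ((2 : ℂ) • (ρ : L)) (regNilp B) f := by
  choose d hd hdc using exists_cartanVec_eq_smul_coroot (H := H)
  let c : H.root → ℂ := fun α =>
    if h : α ∈ B.support then (d α)⁻¹ * B.toCoweightBasis.repr ((2 : ℂ) • ρ) ⟨α, h⟩ else 0
  refine ⟨∑ β : H.root with B.height β = 1, c β • rootVec (negRoot β), ?_, ?_, ?_, ?_⟩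
  · intro h
    have h1 := (smul_eq_zero.mp h).resolve_left two_ne_zero
    exact h0 (Subtype.ext h1)
  · have h1 : ∀ α, B.height α = 1 → ⁅rootVec α,
        ∑ β : H.root with B.height β = 1, c β • rootVec (negRoot β)⁆ =
          c α • (cartanVec α : L) := by
      intro α hα
      rw [lie_sum, Finset.sum_eq_single α]
      · rw [lie_smul, lie_rootVec_negRoot]
      · intro β hβ hne
        rw [lie_smul, lie_rootVec_negRoot_simple B ((height_eq_one_iff B α).mp hα)
          ((height_eq_one_iff B β).mp (Finset.mem_filter.mp hβ).2) hne.symm, smul_zero]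
      · intro h
        exact absurd (by simpa using hα) h
    rw [regNilp, sum_lie, Finset.sum_congr rfl fun α hα => h1 α (Finset.mem_filter.mp hα).2]
    have h2 : ∑ α : H.root with B.height α = 1, c α • cartanVec α = (2 : ℂ) • ρ := by
      rw [← B.toCoweightBasis.sum_repr ((2 : ℂ) • ρ)]
      symm
      refine Finset.sum_bij (fun α _ => (α : H.root)) ?_ ?_ ?_ ?_
      · intro α _
        exact Finset.mem_filter.mpr ⟨Finset.mem_univ _, (height_eq_one_iff B _).mpr α.2⟩
      · intro α _ β _ h
        exact Subtype.ext h
      · intro α hα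
        exact ⟨⟨α, (height_eq_one_iff B α).mp (Finset.mem_filter.mp hα).2⟩, Finset.mem_univ _, rfl⟩
      · intro α _
        rw [RootPairing.Base.toCoweightBasis_apply, hdc, smul_smul]
        congr 1
        simp only [c, dif_pos α.2]
        field_simp [hd]
    have h3 := congrArg (H.toSubmodule.subtype) h2
    rw [map_sum, map_smul] at h3
    exact h3
  · rw [regNilp, lie_sum, Finset.smul_sum]
    refine Finset.sum_congr rfl fun α hα => ?_
    rw [smul_lie, lie_cartan_rootVec, hρ, (Finset.mem_filter.mp hα).2, Int.cast_one, one_smul,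
      ofNat_smul_eq_nsmul ℂ 2]
  · rw [lie_sum, Finset.smul_sum, ← Finset.sum_neg_distrib]
    refine Finset.sum_congr rfl fun α hα => ?_
    rw [lie_smul, smul_lie, lie_cartan_rootVec, hρ, height_negRoot, (Finset.mem_filter.mp hα).2,
      Int.cast_neg, Int.cast_one, ← ofNat_smul_eq_nsmul ℂ 2, smul_smul, smul_smul, smul_smul,
      ← neg_smul]
    congr 1
    ring

lemma eq_zero_of_lie_regNilp_eq_zero {u : L} (hu : u ∈ negSpan B) (h : ⁅regNilp B, u⁆ = 0) :
    u = 0 := by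
  classical
  by_contra hu0
  obtain ⟨ρ, hρ⟩ := exists_apply_eq_height B
  have hneg : ∀ v ∈ negSpan B, ⁅(ρ : L), v⁆ ∈ negSpan B := by
    intro v hv
    have : negSpan B ≤ (negSpan B).comap (LieModule.toEnd ℂ L L (ρ : L)) := by
      refine Submodule.span_le.mpr ?_
      rintro _ ⟨α, hα, rfl⟩
      change ⁅(ρ : L), rootVec α⁆ ∈ negSpan B
      rw [lie_cartan_rootVec]
      exact Submodule.smul_mem _ _ (Submodule.subset_span ⟨α, hα, rfl⟩)
    exact this hv
  have he : ⁅(ρ : L), regNilp B⁆ = regNilp B := by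
    rw [regNilp, lie_sum]
    refine Finset.sum_congr rfl fun α hα => ?_
    rw [lie_cartan_rootVec, hρ, (Finset.mem_filter.mp hα).2, Int.cast_one, one_smul]
  let M : Submodule ℂ L := negSpan B ⊓ LinearMap.ker (LieModule.toEnd ℂ L L (regNilp B))
  have hM : ∀ v ∈ M, LieModule.toEnd ℂ L L (ρ : L) v ∈ M := by
    rintro v ⟨hv1, hv2⟩
    refine ⟨hneg v hv1, ?_⟩
    have hv2 : ⁅regNilp B, v⁆ = 0 := hv2
    change ⁅regNilp B, ⁅(ρ : L), v⁆⁆ = 0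
    rw [leibniz_lie, hv2, lie_zero, add_zero, ← lie_skew (regNilp B) (ρ : L), he, neg_lie, hv2,
      neg_zero]
  have hnt : Nontrivial M := ⟨⟨⟨u, hu, h⟩, 0, fun h1 => hu0 (congrArg Subtype.val h1)⟩⟩
  obtain ⟨μ, hμ⟩ := Module.End.exists_eigenvalue ((LieModule.toEnd ℂ L L (ρ : L)).restrict hM)
  obtain ⟨⟨v, hv⟩, hv1⟩ := hμ.exists_hasEigenvector
  have hv0 : v ≠ 0 := fun h1 => hv1.2 (Subtype.ext h1)
  have hvμ : ⁅(ρ : L), v⁆ = μ • v := congrArg Subtype.val hv1.apply_eq_smul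
  obtain ⟨β, hβ⟩ : ∃ β : H.root, killingForm ℂ L v (rootVec β) ≠ 0 := by
    by_contra! hc
    exact hv0 (eq_zero_of_killingForm_eq_zero H (killingForm_negSpan_cartan B hv.1) hc)
  have hβpos : 0 < B.height β := by
    rcases lt_trichotomy (B.height β) 0 with h | h | h
    · exact absurd (killingForm_negSpan_rootVec B hv.1 h) hβ
    · exact absurd h (B.height_ne_zero β)
    · exact h
  have hμβ : μ = -B.height β := by
    have h1 : killingForm ℂ L ⁅v, (ρ : L)⁆ (rootVec β) =
        killingForm ℂ L v ⁅(ρ : L), rootVec β⁆ :=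
      LieModule.traceForm_apply_lie_apply ℂ L L _ _ _
    rw [← lie_skew, hvμ, lie_cartan_rootVec, hρ, map_neg, LinearMap.neg_apply, map_smul, map_smul,
      LinearMap.smul_apply, smul_eq_mul, smul_eq_mul, ← neg_mul] at h1
    rw [← mul_right_cancel₀ hβ h1, neg_neg]
  have hρ0 : ρ ≠ 0 := by
    rintro rfl
    have h1 := hρ β
    rw [show (β : Weight ℂ H L) (0 : H) = 0 from map_zero ((rootSystem H).root β)] at h1
    have h2 : B.height β = 0 := by exact_mod_cast h1.symm
    omega
  obtain ⟨f, hf⟩ := exists_isSl2Triple_regNilp B ρ hρ hρ0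
  have hprim : hf.HasPrimitiveVectorWith v (2 * μ) :=
    ⟨hv0, by rw [smul_lie, hvμ, smul_smul], hv.2⟩
  obtain ⟨k, hk⟩ := hprim.exists_nat
  rw [hμβ] at hk
  have h1 : 2 * -B.height β = (k : ℤ) := by exact_mod_cast hk
  omega

end RegularNilpotent

section Assembly

open LieAlgebra LieAlgebra.IsKilling LieModule

variable {L : Type} [LieRing L] [LieAlgebra ℂ L] [FiniteDimensional ℂ L] [IsKilling ℂ L]

/-- The root data of a semisimple Lie algebra with a chosen Cartan subalgebra. -/
lemma nonempty_rootData (H : LieSubalgebra ℂ L) [H.IsCartanSubalgebra] :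
    Nonempty (RootData L H.root (Fin (Module.finrank ℂ H))) := by
  let e := Module.finBasis ℂ H
  obtain ⟨b, hx, hh⟩ := exists_rootBasis H e
  obtain ⟨B⟩ := (rootSystem H).nonempty_base
  obtain ⟨ρ, hρ⟩ := exists_apply_eq_height B
  have hpair : ∀ (h : H) (α : H.root), pair (fun i => e.repr h i)
      (fun i => (α : Weight ℂ H L) (e i)) = (α : Weight ℂ H L) h :=
    fun h α => pair_repr e h ((rootSystem H).root α)
  have hroot : ∀ f k : Module.Dual ℂ H, (fun i => f (e i)) = (fun i => k (e i)) → f = k :=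
    fun f k h => e.ext fun i => congrFun h i
  exact ⟨{
    b := b
    neg := negRoot
    wt := fun α i => (α : Weight ℂ H L) (e i)
    cr := fun α i => e.repr (cartanVec α) i
    ht := B.height
    χ := regChar B
    h0 := fun i => e.repr ρ i
    neg_neg := negRoot_negRoot
    wt_neg := fun α => funext fun i => negRoot_apply α (e i)
    ht_neg := height_negRoot B
    ht_ne_zero := fun α => B.height_ne_zero α
    wt_ne_two := fun α γ h => root_ne_add_self α γ (hroot _ _ h)
    lie_hh := fun i j => by
      rw [hh, hh, ← LieSubalgebra.coe_bracket, trivial_lie_zero, ZeroMemClass.coe_zero]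
    lie_hx := fun i α => by rw [hh, hx, lie_cartan_rootVec]
    lie_xx_neg := fun α => by
      rw [hx, hx, lie_rootVec_negRoot]
      have h1 := congrArg H.toSubmodule.subtype (e.sum_repr (cartanVec α))
      rw [map_sum] at h1
      rw [show (cartanVec α : L) = H.toSubmodule.subtype (cartanVec α) from rfl, ← h1]
      refine Finset.sum_congr rfl fun i _ => ?_
      rw [hh]
      rfl
    lie_xx := fun α β hne => by
      rw [hx, hx]
      rcases lie_rootVec_rootVec hne with h | ⟨γ, c, h, hγ⟩
      · exact Or.inl h
      · refine Or.inr ⟨γ, c, by rw [h, hx], ?_, height_eq_add B hγ⟩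
        exact funext fun i => DFunLike.congr_fun hγ (e i)
    pair_ne_zero := fun α => by
      rw [hpair]
      exact root_apply_cartanVec_ne_zero α
    cr_indep := fun α β h1 h2 c h => cartanVec_ne_smul h1 h2 c (e.repr.injective (by
      ext i
      rw [map_smul]
      exact congrFun h i))
    refl_closed := fun f hf α => rootReflHom_fixed_of_simple B e f hf α
    h0_wt := fun α => by rw [hpair, hρ]
    χ_inr := fun i => by rw [hh, regChar_cartan]
    χ_inl := fun α => by rw [hx, regChar_rootVec_ne_zero_iff]
    χ_nondeg := fun u hu h1 h2 => by
      have hu' : u ∈ negSpan B := by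
        simpa only [negSpan, hx] using hu
      refine eq_zero_of_lie_regNilp_eq_zero B hu' (lie_regNilp_eq_zero B hu' (fun h => ?_)
        fun α hα => ?_)
      · rw [← e.sum_repr h]
        have h3 : ((∑ i, e.repr h i • e i : H) : L) = ∑ i, e.repr h i • (e i : L) := by
          rw [show ((∑ i, e.repr h i • e i : H) : L) =
            H.toSubmodule.subtype (∑ i, e.repr h i • e i) from rfl, map_sum]
          rfl
        rw [h3, lie_sum, map_sum]
        refine Finset.sum_eq_zero fun i _ => ?_
        rw [lie_smul, map_smul, ← hh, h1, smul_zero]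
      · have h3 := h2 α hα
        rwa [hx] at h3 }⟩

end Assembly

section Takiff

/-- The class of the variable in the truncated polynomial ring. -/
def truncX (n : ℕ) : TruncPoly n := Ideal.Quotient.mk _ Polynomial.X

lemma truncX_pow_eq_zero {n a : ℕ} (h : n ≤ a) : truncX n ^ a = 0 := by
  have h1 : truncX n ^ n = 0 := by
    rw [truncX, ← map_pow]
    exact Ideal.Quotient.eq_zero_iff_mem.mpr (Ideal.mem_span_singleton_self _)
  exact pow_eq_zero_of_le h h1

lemma exists_powBasis (n : ℕ) :
    ∃ p : Module.Basis (Fin n) ℂ (TruncPoly n), ∀ i, p i = truncX n ^ i.1 := by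
  let P := AdjoinRoot.powerBasis' (Polynomial.monic_X_pow (R := ℂ) n)
  have hd : P.dim = n := by
    rw [AdjoinRoot.powerBasis'_dim, Polynomial.natDegree_X_pow]
  refine ⟨P.basis.reindex (finCongr hd), fun i => ?_⟩
  exact (P.basis.reindex_apply _ i).trans ((P.basis_eq_pow _).trans
    (by rw [AdjoinRoot.powerBasis'_gen]; rfl))

/-- The Takiff algebra as a tensor product over the ground field. -/
def takiffEquiv (n : ℕ) : (TruncPoly n ⊗[ℂ] L) ≃ₗ[ℂ] Takiff L n where
  toFun x := x
  invFun x := x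
  map_add' _ _ := rfl
  map_smul' c x := (algebraMap_smul (TruncPoly n) c x).symm

lemma lie_takiffEquiv_tmul (n : ℕ) (s t : TruncPoly n) (x y : L) :
    ⁅takiffEquiv L n (s ⊗ₜ x), takiffEquiv L n (t ⊗ₜ y)⁆ = takiffEquiv L n ((s * t) ⊗ₜ ⁅x, y⁆) :=
  rfl

variable {L} in
lemma nonempty_takiffData_of_linearEquiv {J : Type} (b : Module.Basis J ℂ L) {q : Type} [LieRing q]
    [LieAlgebra ℂ q] {n : ℕ} (E : (TruncPoly n ⊗[ℂ] L) ≃ₗ[ℂ] q)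
    (hE : ∀ s t x y, ⁅E (s ⊗ₜ x), E (t ⊗ₜ y)⁆ = E ((s * t) ⊗ₜ ⁅x, y⁆)) :
    Nonempty (TakiffData b q n) := by
  obtain ⟨p, hp⟩ := exists_powBasis n
  exact ⟨{
    τ := fun a => E.toLinearMap.comp (TensorProduct.mk ℂ (TruncPoly n) L (truncX n ^ a))
    τ_eq_zero := fun a ha => by
      ext x
      change E ((truncX n ^ a) ⊗ₜ x) = 0
      rw [truncX_pow_eq_zero ha, TensorProduct.zero_tmul, map_zero]
    lie_τ := fun a c x y => by
      rw [pow_add]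
      exact hE _ _ x y
    basis := ((p.tensorProduct b).map E).reindex
      ((Equiv.prodComm _ _).trans ((Equiv.refl J).prodCongr Fin.revPerm))
    basis_apply := fun j a => by
      rw [Module.Basis.reindex_apply, Module.Basis.map_apply]
      change E (p.tensorProduct b (Fin.rev a, j)) = E ((truncX n ^ (n - 1 - a.1)) ⊗ₜ b j)
      rw [Module.Basis.tensorProduct_apply, hp, Fin.val_rev, Nat.add_comm, Nat.sub_add_eq] }⟩

lemma nonempty_takiffData {J : Type} (b : Module.Basis J ℂ L) (n : ℕ) :
    Nonempty (TakiffData b (Takiff L n) n) :=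
  nonempty_takiffData_of_linearEquiv b (q := Takiff L n) (takiffEquiv L n)
    (lie_takiffEquiv_tmul L n)

end Takiff

end TakiffCenter

theorem takiff_center_iso_polynomial
    [FiniteDimensional ℂ L] [LieAlgebra.IsSimple ℂ L] (n : ℕ) (hn : 1 ≤ n) :
    Nonempty
      ((Subalgebra.center ℂ (UniversalEnvelopingAlgebra ℂ (Takiff L n))) ≃ₐ[ℂ]
        MvPolynomial (Fin (LieAlgebra.rank ℂ L) × Fin n) ℂ) := by
  obtain ⟨H, hH, hrank⟩ := TakiffCenter.exists_isCartanSubalgebra_finrank_eq ℂ L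
  obtain ⟨D⟩ := TakiffCenter.nonempty_rootData H
  obtain ⟨A⟩ := D.nonempty_transversal
  obtain ⟨T⟩ := TakiffCenter.nonempty_takiffData L D.b n
  have had : Function.Injective (LieAlgebra.ad ℂ L) := LieModule.IsFaithful.injective_toEnd
  obtain ⟨E⟩ := A.nonempty_center_equiv hn T had
  have hcard : Nat.card A.Z = Nat.card (Fin (LieAlgebra.rank ℂ L)) := by
    rw [A.card_Z, Nat.card_eq_fintype_card, Fintype.card_fin, hrank, Nat.card_eq_fintype_card,
      Fintype.card_fin]
  obtain ⟨σ⟩ := Finite.card_eq.mp hcard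
  exact ⟨E.trans (MvPolynomial.renameEquiv ℂ (σ.prodCongr (Equiv.refl _)))⟩

end
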